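/- arXiv:1702.08854 — 3 statements merged into one kernel-verified Lean document; each statement's English description precedes it below -/
import Mathlib

section
/- Let σ be a nonnegative integer with the property that for every m ≥ 1, every positive semidefinite hermitian matrix in M_m(𝓞) of rank at most 2 all of whose entries lie in 2^σ𝓞 is represented by I₃. Let n ≥ 2, let tᵢⱼ (1 ≤ i, j ≤ n) be positive rational integers, and let S = (sᵢⱼ) ∈ Mₙ(𝓞) be hermitian (S* = S). Suppose tᵢⱼ·tⱼᵢ ≥ |sᵢⱼ|² for all i, j, and tᵢᵢ + sᵢᵢ ≥ 2^σ·(n−1)·(N(ω)+4) for all i, where N(ω) = ω·ω̄ (so N(ω) = ℓ if ℓ ≡ 1, 2 (mod 4) and N(ω) = (1+ℓ)/4 if ℓ ≡ 3 (mod 4)). Let A = diag(a₁,…,aₙ) with aᵢ = Σ_{j=1}^n tᵢⱼ. Then A + S is represented by I_{2^{σ+2}n²}, i.e., A + S = B*B for some 2^{σ+2}n² × n matrix B with entries in 𝓞. -/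
open scoped Matrix ComplexOrder

/-- `ω = √−ℓ` if `ℓ ≡ 1, 2 (mod 4)` and `ω = (1+√−ℓ)/2` if `ℓ ≡ 3 (mod 4)`,
realized inside `ℂ` (with `√−ℓ = √ℓ·i`). -/
noncomputable def omegaC (ℓ : ℕ) : ℂ :=
  if ℓ % 4 = 3 then (1 + Real.sqrt ℓ * Complex.I) / 2 else Real.sqrt ℓ * Complex.I

/-- The ring of integers `𝓞 = ℤ[ω] = ℤ + ℤω` of `ℚ(√−ℓ)`, as a subring of `ℂ`. -/
noncomputable def intO (ℓ : ℕ) : Subring ℂ := Subring.closure {omegaC ℓ}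

/-- `M = Bᴴ * B` for some `k × ι` matrix `B` with entries in `𝓞`: the hermitian matrix `M` is
represented by `I_k`. -/
def RepresentedBy (ℓ k : ℕ) {ι : Type*} (M : Matrix ι ι ℂ) : Prop :=
  ∃ B : Matrix (Fin k) ι ℂ, (∀ i j, B i j ∈ intO ℓ) ∧ M = Bᴴ * B

namespace RepresentedBy

variable {ℓ k l : ℕ} {ι κ : Type*}

theorem zero (ℓ k : ℕ) : RepresentedBy ℓ k (0 : Matrix ι ι ℂ) :=
  ⟨0, fun _ _ => (intO ℓ).zero_mem, by simp⟩

theorem add {M M' : Matrix ι ι ℂ} (h : RepresentedBy ℓ k M) (h' : RepresentedBy ℓ l M') :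
    RepresentedBy ℓ (k + l) (M + M') := by
  obtain ⟨B, hB, rfl⟩ := h
  obtain ⟨C, hC, rfl⟩ := h'
  have hl : ∀ i, Fin.append B C (Fin.castAdd l i) = B i := Fin.append_left B C
  have hr : ∀ i, Fin.append B C (Fin.natAdd k i) = C i := Fin.append_right B C
  refine ⟨Matrix.of (Fin.append B C), fun i j => ?_, ?_⟩
  · refine Fin.addCases (fun i => ?_) (fun i => ?_) i
    · simpa [hl] using hB i j
    · simpa [hr] using hC i j
  · ext i j
    simp [Matrix.mul_apply, Fin.sum_univ_add, hl, hr]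

theorem mono {M : Matrix ι ι ℂ} (h : RepresentedBy ℓ k M) (hkl : k ≤ l) :
    RepresentedBy ℓ l M := by
  obtain ⟨d, rfl⟩ := Nat.exists_eq_add_of_le hkl
  simpa using h.add (zero ℓ d)

theorem sum {α : Type*} (s : Finset α) {M : α → Matrix ι ι ℂ}
    (h : ∀ a ∈ s, RepresentedBy ℓ k (M a)) :
    RepresentedBy ℓ (s.card * k) (∑ a ∈ s, M a) := by
  classical
  induction s using Finset.induction_on with
  | empty => simpa using zero ℓ 0
  | insert a s ha ih =>
    rw [Finset.sum_insert ha, Finset.card_insert_of_notMem ha, add_one_mul, add_comm (s.card * k)]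
    exact (h a (by simp)).add (ih fun b hb => h b (by simp [hb]))

theorem nsmul (r : ℕ) {M : Matrix ι ι ℂ} (h : RepresentedBy ℓ 1 M) :
    RepresentedBy ℓ r (r • M) := by
  simpa using sum (Finset.range r) (M := fun _ => M) fun _ _ => h

theorem vecMulVec {v : ι → ℂ} (hv : ∀ i, v i ∈ intO ℓ) :
    RepresentedBy ℓ 1 (Matrix.vecMulVec (star v) v) :=
  ⟨Matrix.of fun _ => v, fun _ => hv, by
    ext i j; simp [Matrix.mul_apply, Matrix.vecMulVec_apply]⟩

theorem conjTranspose_mul_mul [Fintype ι] {M : Matrix ι ι ℂ} (h : RepresentedBy ℓ k M)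
    {P : Matrix ι κ ℂ} (hP : ∀ i j, P i j ∈ intO ℓ) : RepresentedBy ℓ k (Pᴴ * M * P) := by
  obtain ⟨B, hB, rfl⟩ := h
  refine ⟨B * P, fun i j => ?_, by simp [Matrix.mul_assoc]⟩
  rw [Matrix.mul_apply]
  exact (intO ℓ).sum_mem fun x _ => (intO ℓ).mul_mem (hB i x) (hP x j)

theorem block {n : ℕ} {a b c d : ℂ} (h : RepresentedBy ℓ k !![a, b; c, d]) (i j : Fin n) :
    RepresentedBy ℓ k (Matrix.single i i a + Matrix.single i j b +
      (Matrix.single j j d + Matrix.single j i c)) := by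
  have hP : ∀ x y, (Matrix.of ![Pi.single i 1, Pi.single j 1] : Matrix (Fin 2) (Fin n) ℂ) x y
      ∈ intO ℓ := by
    intro x y
    fin_cases x
    · by_cases hy : y = i <;> simp [Pi.single_apply, hy, (intO ℓ).zero_mem, (intO ℓ).one_mem]
    · by_cases hy : y = j <;> simp [Pi.single_apply, hy, (intO ℓ).zero_mem, (intO ℓ).one_mem]
  convert h.conjTranspose_mul_mul hP using 1
  ext x y
  simp only [Matrix.mul_apply, Fin.sum_univ_two, Matrix.add_apply, Matrix.single_apply,
    Matrix.conjTranspose_apply, Matrix.of_apply, Matrix.cons_val_zero, Matrix.cons_val_one,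
    Pi.single_apply, eq_comm (a := i), eq_comm (a := j)]
  split_ifs <;> (simp_all; try ring)

theorem single {n : ℕ} {a : ℂ} (h : RepresentedBy ℓ k !![a]) (i : Fin n) :
    RepresentedBy ℓ k (Matrix.single i i a) := by
  have hP : ∀ x y, (Matrix.of ![Pi.single i 1] : Matrix (Fin 1) (Fin n) ℂ) x y ∈ intO ℓ := by
    intro x y
    by_cases hy : y = i <;> simp [hy, (intO ℓ).zero_mem, (intO ℓ).one_mem]
  convert h.conjTranspose_mul_mul hP using 1
  ext x y
  simp only [Matrix.mul_apply, Finset.univ_unique, Finset.sum_singleton, Matrix.single_apply,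
    Matrix.conjTranspose_apply, Matrix.of_apply, Matrix.cons_val_fin_one,
    Pi.single_apply, eq_comm (a := i)]
  split_ifs <;> simp_all

/-- A hermitian matrix is represented by `I_{n²k}` as soon as it splits into `2 × 2` and `1 × 1`
principal pieces represented by `I_k`. -/
theorem diagonal_add {n : ℕ} {u : Fin n → Fin n → ℂ} {S : Matrix (Fin n) (Fin n) ℂ}
    (hlt : ∀ i j, i < j → RepresentedBy ℓ k !![u i j, S i j; S j i, u j i])
    (heq : ∀ i, RepresentedBy ℓ k !![u i i + S i i]) :
    RepresentedBy ℓ (n ^ 2 * k) (Matrix.diagonal (fun i => ∑ j, u i j) + S) := by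
  let F : Fin n → Fin n → Matrix (Fin n) (Fin n) ℂ := fun i j =>
    Matrix.single i i (u i j) + Matrix.single i j (S i j)
  have key : RepresentedBy ℓ (n ^ 2 * k) (∑ p : Fin n × Fin n,
      if p.1 < p.2 then F p.1 p.2 + F p.2 p.1 else if p.1 = p.2 then F p.1 p.1 else 0) := by
    have := sum (ℓ := ℓ) (k := k) (Finset.univ : Finset (Fin n × Fin n)) (M := fun p =>
      if p.1 < p.2 then F p.1 p.2 + F p.2 p.1 else if p.1 = p.2 then F p.1 p.1 else 0) ?_
    · simpa [sq] using this
    · rintro ⟨i, j⟩ -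
      dsimp only
      split_ifs with h h'
      · exact (hlt i j h).block i j
      · simpa [F, Matrix.single_add] using (heq i).single i
      · exact zero ℓ k
  convert key using 1
  have hsplit : ∀ i j, (if i < j then F i j + F j i else if i = j then F i i else 0)
      = (if i < j then F i j else 0) + (if i < j then F j i else 0)
        + (if i = j then F i j else 0) := by
    intro i j
    rcases lt_trichotomy i j with h | rfl | h
    · simp [h, h.ne]
    · simp
    · simp [h.ne', h.not_gt]
  rw [Fintype.sum_prod_type]
  simp only [hsplit, Finset.sum_add_distrib]
  rw [Finset.sum_comm (f := fun i j => if i < j then F j i else 0)]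
  simp only [← Finset.sum_add_distrib]
  have hmerge : ∀ i j, (if i < j then F i j else 0) + (if j < i then F i j else 0)
        + (if i = j then F i j else 0) = F i j := by
    intro i j
    rcases lt_trichotomy i j with h | rfl | h
    · simp [h, h.ne, h.not_gt]
    · simp
    · simp [h, h.ne', h.not_gt]
  simp only [hmerge, F, Finset.sum_add_distrib]
  congr 1
  · ext x y
    simp only [Matrix.sum_apply, Matrix.single_apply, Matrix.diagonal_apply]
    by_cases h : x = y
    · subst h
      simp [Finset.sum_ite_irrel]
    · rw [if_neg h]
      refine (Finset.sum_eq_zero fun i _ => Finset.sum_eq_zero fun j _ => if_neg ?_).symm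
      rintro ⟨rfl, rfl⟩
      exact h rfl
  · exact Matrix.matrix_eq_sum_single S

end RepresentedBy

theorem omegaC_mem_intO (ℓ : ℕ) : omegaC ℓ ∈ intO ℓ := Subring.subset_closure rfl

theorem omegaC_im_pos {ℓ : ℕ} (hpos : 0 < ℓ) : 0 < (omegaC ℓ).im := by
  have : 0 < Real.sqrt ℓ := Real.sqrt_pos.2 (by exact_mod_cast hpos)
  unfold omegaC
  split_ifs <;> simp [this]

theorem exists_normSq_omegaC (ℓ : ℕ) : ∃ N : ℕ, Complex.normSq (omegaC ℓ) = N := by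
  have hs : Real.sqrt ℓ * Real.sqrt ℓ = ℓ := Real.mul_self_sqrt (Nat.cast_nonneg ℓ)
  unfold omegaC
  split_ifs with h
  · refine ⟨ℓ / 4 + 1, ?_⟩
    have h4 : (ℓ : ℝ) = 4 * ((ℓ / 4 : ℕ) : ℝ) + 3 := by
      exact_mod_cast (show ℓ = 4 * (ℓ / 4) + 3 by omega)
    simp [Complex.normSq_apply]
    linarith
  · exact ⟨ℓ, by simp [Complex.normSq_apply, hs]⟩

theorem exists_omegaC_re (ℓ : ℕ) : ∃ T : ℤ, 2 * (omegaC ℓ).re = T := by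
  unfold omegaC
  split_ifs
  · exact ⟨1, by simp⟩
  · exact ⟨0, by simp⟩

theorem exists_eq_add_mul_omegaC {ℓ : ℕ} {z : ℂ} (hz : z ∈ intO ℓ) :
    ∃ a b : ℤ, z = a + b * omegaC ℓ := by
  obtain ⟨N, hN⟩ := exists_normSq_omegaC ℓ
  obtain ⟨T, hT⟩ := exists_omegaC_re ℓ
  have hsq : omegaC ℓ * omegaC ℓ = T * omegaC ℓ - N := by
    rw [Complex.normSq_apply] at hN
    apply Complex.ext
    · simp [← hT]
      linarith
    · simp [← hT]
      ring
  induction hz using Subring.closure_induction with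
  | mem x hx => exact ⟨0, 1, by simpa using hx⟩
  | zero => exact ⟨0, 0, by simp⟩
  | one => exact ⟨1, 0, by simp⟩
  | add x y _ _ hx hy =>
    obtain ⟨a, b, rfl⟩ := hx
    obtain ⟨c, d, rfl⟩ := hy
    exact ⟨a + c, b + d, by push_cast; ring⟩
  | neg x _ hx =>
    obtain ⟨a, b, rfl⟩ := hx
    exact ⟨-a, -b, by push_cast; ring⟩
  | mul x y _ _ hx hy =>
    obtain ⟨a, b, rfl⟩ := hx
    obtain ⟨c, d, rfl⟩ := hy
    refine ⟨a * c - b * d * N, a * d + b * c + b * d * T, ?_⟩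
    push_cast
    linear_combination (b : ℂ) * d * hsq

theorem exists_int_eq_of_mem_intO {ℓ : ℕ} (hpos : 0 < ℓ) {z : ℂ} (hz : z ∈ intO ℓ)
    (him : z.im = 0) : ∃ a : ℤ, z = a := by
  obtain ⟨a, b, rfl⟩ := exists_eq_add_mul_omegaC hz
  have hb : b = 0 := by simpa [(omegaC_im_pos hpos).ne'] using him
  exact ⟨a, by simp [hb]⟩

theorem posSemidef_fin_two {p q : ℝ} {z : ℂ} (hp : 0 < p)
    (h : Complex.normSq z ≤ p * q) : (!![(p : ℂ), z; star z, (q : ℂ)]).PosSemidef := by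
  refine Matrix.PosSemidef.of_dotProduct_mulVec_nonneg ?_ fun x => ?_
  · ext i j
    fin_cases i <;> fin_cases j <;> simp
  · have hpC : (p : ℂ) ≠ 0 := by exact_mod_cast hp.ne'
    have key : star x ⬝ᵥ !![(p : ℂ), z; star z, (q : ℂ)] *ᵥ x
        = (((Complex.normSq (p * x 0 + z * x 1)
            + (p * q - Complex.normSq z) * Complex.normSq (x 1)) / p : ℝ) : ℂ) := by
      push_cast
      simp only [Complex.normSq_eq_conj_mul_self]
      rw [eq_div_iff hpC]
      simp [dotProduct, Matrix.mulVec, Fin.sum_univ_two]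
      ring
    rw [key, Complex.zero_le_real]
    exact div_nonneg (add_nonneg (Complex.normSq_nonneg _)
      (mul_nonneg (sub_nonneg.2 h) (Complex.normSq_nonneg _))) hp.le

theorem normSq_sub_le_mul_add {s r : ℂ} {t t' d d' : ℝ} (ht : 0 ≤ t) (ht' : 0 ≤ t')
    (hd : 0 ≤ d) (hd' : 0 ≤ d') (hs : Complex.normSq s ≤ t * t')
    (hr : Complex.normSq r ≤ d * d') : Complex.normSq (s - r) ≤ (t + d) * (t' + d') := by
  rw [Complex.normSq_eq_norm_sq] at *
  have h1 : ‖s - r‖ ≤ ‖s‖ + ‖r‖ := norm_sub_le s r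
  have h2 : ‖s - r‖ ^ 2 ≤ (‖s‖ + ‖r‖) ^ 2 := by gcongr
  have h3 : 2 * (‖s‖ * ‖r‖) ≤ t * d' + d * t' := by
    refine abs_le_of_sq_le_sq' ?_ (by positivity) |>.2
    have : ‖s‖ ^ 2 * ‖r‖ ^ 2 ≤ (t * t') * (d * d') := by gcongr
    nlinarith [sq_nonneg (t * d' - d * t')]
  nlinarith

theorem normSq_add_mul_le {w : ℂ} {a b c : ℝ} (ha : 0 ≤ a) (hac : a ≤ c) (hb : 0 ≤ b)
    (hbc : b ≤ c) :
    Complex.normSq (a + b * w) ≤ c * (Complex.normSq w + 1) * (c * 2) := by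
  rw [Complex.normSq_apply, Complex.normSq_apply]
  simp
  have h1 : a ^ 2 ≤ c ^ 2 := by gcongr
  have h2 : b ^ 2 ≤ c ^ 2 := by gcongr
  have h3 := mul_le_mul_of_nonneg_right h2 (add_nonneg (mul_self_nonneg w.re) (mul_self_nonneg w.im))
  nlinarith [sq_nonneg (a - b * w.re), sq_nonneg (b * w.im)]

/-- Every positive semidefinite hermitian matrix over `𝓞` of rank at most `2` with entries in
`2^σ𝓞` is represented by `I₃`. -/
def RankTwoRepresentable (ℓ σ : ℕ) : Prop :=
  ∀ m : ℕ, 1 ≤ m → ∀ M : Matrix (Fin m) (Fin m) ℂ,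
    (∀ i j, M i j ∈ intO ℓ) → M.PosSemidef → M.rank ≤ 2 →
    (∀ i j, ∃ w ∈ intO ℓ, M i j = 2 ^ σ * w) → RepresentedBy ℓ 3 M

theorem RankTwoRepresentable.representedBy_of_le_two {ℓ σ m : ℕ} (hσ : RankTwoRepresentable ℓ σ)
    (hm : 1 ≤ m) (hm2 : m ≤ 2) {M : Matrix (Fin m) (Fin m) ℂ} (hM : M.PosSemidef)
    (hdvd : ∀ i j, ∃ w ∈ intO ℓ, M i j = 2 ^ σ * w) : RepresentedBy ℓ 3 M := by
  refine hσ m hm M (fun i j => ?_) hM (M.rank_le_width.trans hm2) hdvd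
  obtain ⟨w, hw, h⟩ := hdvd i j
  rw [h]
  exact (intO ℓ).mul_mem (by exact_mod_cast natCast_mem (intO ℓ) (2 ^ σ)) hw

theorem RankTwoRepresentable.representedBy_natCast {ℓ σ : ℕ} (hσ : RankTwoRepresentable ℓ σ)
    (m : ℕ) : RepresentedBy ℓ (2 ^ (σ + 2)) !![(m : ℂ)] := by
  have h1 : RepresentedBy ℓ 3 !![((2 ^ σ * (m / 2 ^ σ) : ℕ) : ℂ)] := by
    refine hσ.representedBy_of_le_two le_rfl one_le_two ?_ fun i j =>
      ⟨(m / 2 ^ σ : ℕ), natCast_mem _ _, by fin_cases i; fin_cases j; simp⟩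
    convert Matrix.PosSemidef.diagonal (n := Fin 1) (R := ℂ)
      (d := fun _ => ((2 ^ σ * (m / 2 ^ σ) : ℕ) : ℂ)) (fun _ => Nat.cast_nonneg _) using 1
    ext i j
    fin_cases i; fin_cases j; simp
  have h2 : RepresentedBy ℓ (m % 2 ^ σ) ((m % 2 ^ σ) • Matrix.vecMulVec (star ![1]) ![1]) :=
    RepresentedBy.nsmul _ (RepresentedBy.vecMulVec fun i => by simp [(intO ℓ).one_mem])
  have hlt : m % 2 ^ σ < 2 ^ σ := Nat.mod_lt _ (by positivity)
  convert (h1.add h2).mono (l := 2 ^ (σ + 2)) (by rw [pow_add]; omega) using 1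
  ext i j
  fin_cases i; fin_cases j
  have := congrArg (Nat.cast (R := ℂ)) (Nat.div_add_mod m (2 ^ σ))
  simpa [Matrix.vecMulVec_apply] using this.symm

/-- Enlarging the diagonal of a `2 × 2` positive semidefinite matrix by at most `2^σ(N(ω)+4)`
makes it a sum of `2^(σ+2)` norms. -/
theorem RankTwoRepresentable.exists_representedBy_block {ℓ σ : ℕ}
    (hσ : RankTwoRepresentable ℓ σ) {N : ℕ} (hN : Complex.normSq (omegaC ℓ) = N) {t t' : ℤ}
    (ht : 0 < t) (ht' : 0 < t') {s : ℂ} (hsO : s ∈ intO ℓ)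
    (hs : Complex.normSq s ≤ ((t * t' : ℤ) : ℝ)) :
    ∃ u u' : ℤ, u ≤ t + 2 ^ σ * (N + 4) ∧ u' ≤ t' + 2 ^ σ * (N + 4) ∧
      RepresentedBy ℓ (2 ^ (σ + 2)) !![(u : ℂ), s; star s, (u' : ℂ)] := by
  obtain ⟨a, b, rfl⟩ := exists_eq_add_mul_omegaC hsO
  have hωN : (starRingEnd ℂ) (omegaC ℓ) * omegaC ℓ = N := by
    rw [← Complex.normSq_eq_conj_mul_self, hN]; simp
  obtain ⟨D, hD⟩ : ∃ D : ℤ, D = 2 ^ σ := ⟨_, rfl⟩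
  have hDpos : 0 < D := hD ▸ by positivity
  obtain ⟨x, hx⟩ := Int.eq_ofNat_of_zero_le (Int.emod_nonneg a hDpos.ne')
  obtain ⟨y, hy⟩ := Int.eq_ofNat_of_zero_le (Int.emod_nonneg b hDpos.ne')
  have hxD : (x : ℤ) < D := hx ▸ Int.emod_lt_of_pos a hDpos
  have hyD : (y : ℤ) < D := hy ▸ Int.emod_lt_of_pos b hDpos
  have ha : D * (a / D) + x = a := by rw [← hx]; exact Int.mul_ediv_add_emod a D
  have hb : D * (b / D) + y = b := by rw [← hy]; exact Int.mul_ediv_add_emod b D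
  have hceil : ∀ z : ℤ, ∃ e : ℤ, z ≤ D * e ∧ D * e ≤ z + D := fun z =>
    ⟨z / D + 1, by
      have h1 := Int.mul_ediv_add_emod z D
      have h2 := Int.emod_nonneg z hDpos.ne'
      have h3 := Int.emod_lt_of_pos z hDpos
      constructor <;> linarith⟩
  obtain ⟨e, he, he'⟩ := hceil t
  obtain ⟨f, hf, hf'⟩ := hceil t'
  have hDC : (2 : ℂ) ^ σ = D := by rw [hD]; push_cast; rfl
  have haC : (a : ℂ) = D * (a / D : ℤ) + x := by exact_mod_cast ha.symm
  have hbC : (b : ℂ) = D * (b / D : ℤ) + y := by exact_mod_cast hb.symm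
  set q : ℂ := (a / D : ℤ) + (b / D : ℤ) * omegaC ℓ with hq
  have hstarO : star q ∈ intO ℓ := by
    obtain ⟨T, hT⟩ := exists_omegaC_re ℓ
    have : star q = (a / D : ℤ) + (b / D : ℤ) * (T - omegaC ℓ) := by
      apply Complex.ext <;> simp [hq, ← hT]
      left; ring
    rw [this]
    exact add_mem (intCast_mem _ _) (mul_mem (intCast_mem _ _)
      (sub_mem (intCast_mem _ _) (omegaC_mem_intO ℓ)))
  have hqO : q ∈ intO ℓ := add_mem (intCast_mem _ _)
    (mul_mem (intCast_mem _ _) (omegaC_mem_intO ℓ))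
  have hrows1 : RepresentedBy ℓ x (x • Matrix.vecMulVec (star ![1, 1]) ![1, 1]) :=
    RepresentedBy.nsmul _ (RepresentedBy.vecMulVec fun i => by
      fin_cases i <;> simp [(intO ℓ).one_mem])
  have hrowsω : RepresentedBy ℓ y
      (y • Matrix.vecMulVec (star ![1, omegaC ℓ]) ![1, omegaC ℓ]) :=
    RepresentedBy.nsmul _ (RepresentedBy.vecMulVec fun i => by
      fin_cases i <;> simp [(intO ℓ).one_mem, omegaC_mem_intO])
  have hmain : RepresentedBy ℓ 3 !![((D * (e + (N + 1)) : ℤ) : ℂ), D * q;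
      star (D * q), ((D * (f + 2) : ℤ) : ℂ)] := by
    refine hσ.representedBy_of_le_two one_le_two le_rfl ?_ ?_
    · have heR : (t : ℝ) ≤ D * e := by exact_mod_cast he
      have hfR : (t' : ℝ) ≤ D * f := by exact_mod_cast hf
      have htR : (0 : ℝ) < t := by exact_mod_cast ht
      have htR' : (0 : ℝ) < t' := by exact_mod_cast ht'
      have hDR : (0 : ℝ) < D := by exact_mod_cast hDpos
      have hr := normSq_add_mul_le (w := omegaC ℓ) (a := x) (b := y) (c := D) (by positivity)
        (by exact_mod_cast hxD.le) (by positivity) (by exact_mod_cast hyD.le)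
      have hsr := normSq_sub_le_mul_add (t := D * e) (t' := D * f) (by linarith)
        (by linarith) (by rw [hN]; positivity) (by positivity) (hs.trans ?_) hr
      · have := posSemidef_fin_two (p := ((D * (e + (N + 1)) : ℤ) : ℝ))
          (q := ((D * (f + 2) : ℤ) : ℝ)) (z := D * q) ?_ ?_
        · simpa using this
        · push_cast
          nlinarith
        · convert hsr using 1
          · congr 1
            rw [haC, hbC, hq]
            push_cast
            ring
          · rw [hN]
            push_cast
            ring
      · push_cast
        exact mul_le_mul heR hfR htR'.le (htR.le.trans heR)
    · intro i j
      rw [hDC]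
      fin_cases i <;> fin_cases j
      · exact ⟨((e + (N + 1) : ℤ) : ℂ), intCast_mem _ _, by simp⟩
      · exact ⟨q, hqO, by simp⟩
      · exact ⟨star q, hstarO, by simp⟩
      · exact ⟨((f + 2 : ℤ) : ℂ), intCast_mem _ _, by simp⟩
  refine ⟨D * (e + (N + 1)) + (x + y), D * (f + 2) + (x + N * y), ?_, ?_, ?_⟩
  · rw [← hD]
    nlinarith
  · rw [← hD]
    nlinarith [mul_le_mul_of_nonneg_left hyD.le (Int.natCast_nonneg N)]
  · have hcard : 3 + (x + y) ≤ 2 ^ (σ + 2) := by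
      zify
      rw [pow_add, ← hD]
      linarith
    convert (hmain.add (hrows1.add hrowsω)).mono hcard using 1
    ext i j
    fin_cases i <;> fin_cases j
    · simp
    · simp [haC, hbC, hq]
      ring
    · simp [haC, hbC, hq]
      ring
    · simp [hωN]
      ring

/-- Let `σ ≥ 0` be such that every positive semidefinite hermitian matrix over `𝓞` of rank
at most `2` with entries in `2^σ𝓞` is represented by `I₃`.  Let `n ≥ 2`, `tᵢⱼ` positive
rational integers, and `S ∈ Mₙ(𝓞)` hermitian with `tᵢⱼ·tⱼᵢ ≥ |sᵢⱼ|²` for all `i, j` and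
`tᵢᵢ + sᵢᵢ ≥ 2^σ·(n−1)·(N(ω)+4)` for all `i`.  With `A = diag(a₁,…,aₙ)`, `aᵢ = Σⱼ tᵢⱼ`,
the matrix `A + S` is represented by `I_{2^{σ+2}n²}`. -/
theorem diagonal_add_hermitian_sum_of_norms (ℓ : ℕ) (hsf : Squarefree ℓ) (hpos : 0 < ℓ)
    (σ : ℕ)
    (hσ : ∀ m : ℕ, 1 ≤ m → ∀ M : Matrix (Fin m) (Fin m) ℂ,
      (∀ i j, M i j ∈ intO ℓ) → M.PosSemidef → M.rank ≤ 2 →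
      (∀ i j, ∃ w ∈ intO ℓ, M i j = 2 ^ σ * w) →
      ∃ B : Matrix (Fin 3) (Fin m) ℂ, (∀ i j, B i j ∈ intO ℓ) ∧ M = Bᴴ * B)
    (n : ℕ) (hn : 2 ≤ n) (t : Fin n → Fin n → ℤ) (ht : ∀ i j, 0 < t i j)
    (S : Matrix (Fin n) (Fin n) ℂ) (hSO : ∀ i j, S i j ∈ intO ℓ) (hSh : S.IsHermitian)
    (hts : ∀ i j, Complex.normSq (S i j) ≤ ((t i j * t j i : ℤ) : ℝ))
    (hdiag : ∀ i, (2 : ℝ) ^ σ * ((n : ℝ) - 1) * (Complex.normSq (omegaC ℓ) + 4)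
      ≤ (t i i : ℝ) + (S i i).re) :
    ∃ B : Matrix (Fin (2 ^ (σ + 2) * n ^ 2)) (Fin n) ℂ,
      (∀ i j, B i j ∈ intO ℓ) ∧
      Matrix.diagonal (fun i => ((∑ j, t i j : ℤ) : ℂ)) + S = Bᴴ * B := by
  obtain ⟨N, hN⟩ := exists_normSq_omegaC ℓ
  have hR : RankTwoRepresentable ℓ σ := hσ
  have hblock : ∀ i j, ∃ u u' : ℤ, u ≤ t i j + 2 ^ σ * (N + 4) ∧
      u' ≤ t j i + 2 ^ σ * (N + 4) ∧
      RepresentedBy ℓ (2 ^ (σ + 2)) !![(u : ℂ), S i j; star (S i j), (u' : ℂ)] := fun i j =>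
    hR.exists_representedBy_block hN (ht i j) (ht j i) (hSO i j) (hts i j)
  choose f g hf hg hfg using hblock
  have hdiagInt : ∀ i, ∃ a : ℤ, S i i = a := fun i =>
    exists_int_eq_of_mem_intO hpos (hSO i i) (Complex.conj_eq_iff_im.1 (hSh.apply i i))
  choose d hd using hdiagInt
  let v : Fin n → Fin n → ℤ := fun i j => if i < j then f i j else g j i
  have hv : ∀ i j, v i j ≤ t i j + 2 ^ σ * (N + 4) := by
    intro i j
    by_cases h : i < j
    · simpa [v, h] using hf i j
    · simpa [v, h] using hg j i
  let u : Fin n → Fin n → ℤ := fun i j =>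
    if i = j then ∑ k, t i k - ∑ k ∈ Finset.univ.erase i, v i k else v i j
  have hsum : ∀ i, ∑ j, u i j = ∑ j, t i j := by
    intro i
    have hne : ∑ j ∈ Finset.univ.erase i, u i j = ∑ j ∈ Finset.univ.erase i, v i j :=
      Finset.sum_congr rfl fun j hj => if_neg (Finset.ne_of_mem_erase hj).symm
    rw [← Finset.add_sum_erase _ _ (Finset.mem_univ i), hne]
    simp [u]
  have hnonneg : ∀ i, 0 ≤ u i i + d i := by
    intro i
    have h1 : ∑ k ∈ Finset.univ.erase i, v i k
        ≤ ∑ k ∈ Finset.univ.erase i, (t i k + 2 ^ σ * (N + 4)) :=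
      Finset.sum_le_sum fun k _ => hv i k
    have h2 := Finset.add_sum_erase _ (t i) (Finset.mem_univ i)
    have h3 := hdiag i
    rw [hd, hN, Complex.intCast_re] at h3
    have h4 : (2 : ℤ) ^ σ * ((n : ℤ) - 1) * (N + 4) ≤ t i i + d i := by exact_mod_cast h3
    rw [Finset.sum_add_distrib, Finset.sum_const, Finset.card_erase_of_mem (Finset.mem_univ i),
      Finset.card_univ, Fintype.card_fin, nsmul_eq_mul, Nat.cast_sub (by omega)] at h1
    simp only [u, if_true]
    push_cast at h1
    linarith
  have hrep := RepresentedBy.diagonal_add (ℓ := ℓ) (k := 2 ^ (σ + 2)) (S := S)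
    (u := fun i j => (u i j : ℂ)) (fun i j hij => ?_) (fun i => ?_)
  · rw [mul_comm] at hrep
    simp only [← Int.cast_sum, hsum] at hrep
    exact hrep
  · have h := hfg i j
    rw [hSh.apply j i] at h
    simpa [u, v, hij, hij.ne, hij.ne', hij.not_gt] using h
  · obtain ⟨m, hm⟩ := Int.eq_ofNat_of_zero_le (hnonneg i)
    have : (u i i : ℂ) + S i i = m := by rw [hd]; exact_mod_cast hm
    rw [this]
    exact hR.representedBy_natCast m
end

section
/- There exists a constant D₃ > 0 such that the following holds, where G(n) = D₃·n^{10}·e^{(4+2√2)√n + 2(ln n)²}: for every integer n ≥ 2 and every positive integer g, if every (n−1)-variable positive definite integral quadratic form that is represented by some I_r is represented by I_g, then every n-variable positive definite integral quadratic form that is represented by some I_r is represented by I_m, where m = max(g + ⌊G(n)⌋, 4n² + n). (Equivalently, g_ℤ(n) ≤ max{g_ℤ(n−1) + G(n), 4n² + n}.) -/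
open scoped Matrix

/-- `M` (the Gram matrix of an `n`-variable integral quadratic form) is represented by `I_r`,
i.e. the form is a sum of `r` squares of integral linear forms. -/
def RepBySquares (n r : ℕ) (M : Matrix (Fin n) (Fin n) ℤ) : Prop :=
  ∃ A : Matrix (Fin r) (Fin n) ℤ, M = Aᵀ * A

theorem repBySquares_transpose_mul_self {ι : Type*} [Fintype ι] {n r : ℕ}
    (A : Matrix ι (Fin n) ℤ) (h : Fintype.card ι ≤ r) : RepBySquares n r (Aᵀ * A) := by
  classical
  obtain ⟨f⟩ : Nonempty (ι ↪ Fin r) :=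
    Function.Embedding.nonempty_of_card_le (by simpa using h)
  refine ⟨Matrix.of (Function.extend f (fun i k => A i k) 0), ?_⟩
  ext k l
  simp only [Matrix.mul_apply, Matrix.transpose_apply, Matrix.of_apply]
  refine Fintype.sum_of_injective f f.injective _ _ (fun i hi => ?_) (fun i => ?_)
  · rw [Function.extend_apply' _ _ _ (by simpa using hi)]
    simp
  · rw [f.injective.extend_apply]

theorem RepBySquares.congr {n m r : ℕ} {M : Matrix (Fin n) (Fin n) ℤ}
    (hM : RepBySquares n r M) (T : Matrix (Fin n) (Fin m) ℤ) :
    RepBySquares m r (Tᵀ * M * T) := by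
  obtain ⟨A, rfl⟩ := hM
  exact ⟨A * T, by simp [Matrix.transpose_mul, Matrix.mul_assoc]⟩

/-- A symmetric integral matrix is diagonally dominant when each diagonal entry is at least the
sum of the absolute values of the other entries of its row. Such a matrix is a nonnegative
combination of the squares of the forms `x i` and `x i ± x j`. -/
theorem exists_eq_transpose_mul_self_of_diagonallyDominant {n : ℕ}
    (N : Matrix (Fin n) (Fin n) ℤ) (hN : N.IsSymm)
    (hd : ∀ i, ∑ j ∈ Finset.univ.erase i, |N i j| ≤ N i i) :
    ∃ C : Matrix ((Fin n × Fin n) × Fin 4) (Fin n) ℤ, N = Cᵀ * C := by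
  have four : ∀ m : ℤ, ∃ s : Fin 4 → ℤ, 0 ≤ m → ∑ q, s q * s q = m := by
    intro m
    obtain ⟨a, b, c, d, h⟩ := Nat.sum_four_squares m.toNat
    refine ⟨![a, b, c, d], fun hm => ?_⟩
    have h' : ((a ^ 2 + b ^ 2 + c ^ 2 + d ^ 2 : ℕ) : ℤ) = m := by rw [h]; simp [hm]
    push_cast at h'
    simp only [Fin.sum_univ_four, Matrix.cons_val]
    linarith
  choose s hs using four
  let e : Fin n → Fin n → ℤ := fun i k => if i = k then 1 else 0
  let w : Fin n → Fin n → ℤ := fun i j =>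
    if i < j then |N i j| else if i = j then N i i - ∑ j ∈ Finset.univ.erase i, |N i j| else 0
  let u : Fin n → Fin n → Fin n → ℤ := fun i j k =>
    if i < j then e i k + (N i j).sign * e j k else e i k
  have hw : ∀ i j, 0 ≤ w i j := by
    intro i j
    simp only [w]
    split_ifs
    · positivity
    · linarith [hd i]
    · rfl
  refine ⟨Matrix.of fun p k => s (w p.1.1 p.1.2) p.2 * u p.1.1 p.1.2 k, ?_⟩
  ext k l
  simp only [Matrix.mul_apply, Matrix.transpose_apply, Matrix.of_apply]
  have hterm : ∀ i j, ∑ q, s (w i j) q * u i j k * (s (w i j) q * u i j l)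
      = (if i < j then |N i j| else 0) * (e i k * e i l)
        + (if i < j then |N i j| else 0) * (e j k * e j l)
        + (if i < j then N i j else 0) * (e i k * e j l)
        + (if i < j then N i j else 0) * (e j k * e i l)
        + (if i = j then (N i i - ∑ j ∈ Finset.univ.erase i, |N i j|) * (e i k * e i l)
            else 0) := by
    intro i j
    have h1 : ∑ q, s (w i j) q * u i j k * (s (w i j) q * u i j l)
        = w i j * (u i j k * u i j l) := by
      conv_rhs => rw [← hs _ (hw i j), Finset.sum_mul]
      exact Finset.sum_congr rfl fun q _ => by ring
    rw [h1]
    simp only [w, u]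
    by_cases hij : i < j
    · have h2 : |N i j| * (N i j).sign = N i j := by
        rw [mul_comm]; exact Int.sign_mul_abs _
      have h3 : N i j * (N i j).sign = |N i j| := by
        rw [mul_comm]; exact Int.sign_mul_self_eq_abs _
      simp only [hij, hij.ne, if_true, if_false]
      linear_combination (e i k * e j l + e j k * e i l
        + (N i j).sign * e j k * e j l) * h2 + e j k * e j l * h3
    · by_cases h : i = j <;> simp [h, hij]
  have hite : ∀ (p : Prop) [Decidable p] (f : Fin n → ℤ),
      ∑ x, (if p then f x else 0) = if p then ∑ x, f x else 0 := by
    intro p _ f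
    split_ifs <;> simp
  rw [Fintype.sum_prod_type, Fintype.sum_prod_type]
  simp only [hterm, Finset.sum_add_distrib]
  simp only [e, mul_ite, mul_one, mul_zero, hite, Finset.sum_ite_eq,
    Finset.sum_ite_eq', Finset.mem_univ, if_true]
  have hsym : ∀ i j, N i j = N j i := fun i j => hN.apply j i
  by_cases hkl : k = l
  · subst hkl
    have hsplit : ∑ j ∈ Finset.univ.erase k, |N k j|
        = ∑ j, (if k < j then |N k j| else 0) + ∑ j, (if j < k then |N j k| else 0) := by
      rw [← Finset.sum_add_distrib, ← Finset.sum_erase (a := k) Finset.univ (by simp)]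
      refine Finset.sum_congr rfl fun j hj => ?_
      rcases lt_or_gt_of_ne (Finset.ne_of_mem_erase hj) with h | h
      · simp [h, h.not_gt, hsym k j]
      · simp [h, h.not_gt]
    simp only [if_true, lt_irrefl, if_false]
    linarith
  · rcases lt_or_gt_of_ne hkl with h | h
    · simp [h, h.not_gt, Ne.symm hkl]
    · simp [h, h.not_gt, Ne.symm hkl, hsym k l]

theorem RepBySquares.of_congr {n r : ℕ} {M T T' : Matrix (Fin n) (Fin n) ℤ} (hT : T * T' = 1)
    (h : RepBySquares n r (Tᵀ * M * T)) : RepBySquares n r M := by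
  have h1 : T'ᵀ * (Tᵀ * M * T) * T' = (T * T')ᵀ * M * (T * T') := by
    simp only [Matrix.transpose_mul, Matrix.mul_assoc]
  have h2 := h.congr T'
  rwa [h1, hT, Matrix.transpose_one, Matrix.one_mul, Matrix.mul_one] at h2

theorem RepBySquares.mono {n r s : ℕ} {M : Matrix (Fin n) (Fin n) ℤ} (hM : RepBySquares n r M)
    (hrs : r ≤ s) : RepBySquares n s M := by
  obtain ⟨A, rfl⟩ := hM
  exact repBySquares_transpose_mul_self A (by simpa using hrs)

theorem abs_sum_le_mul {n : ℕ} {K b : ℝ} (hK : (n : ℝ) ≤ K) (hb : 0 ≤ b) (f : Fin n → ℝ)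
    (hf : ∀ k, |f k| ≤ b) : |∑ k, f k| ≤ K * b := by
  calc |∑ k, f k| ≤ ∑ k, |f k| := Finset.abs_sum_le_sum_abs _ _
    _ ≤ ∑ _k : Fin n, b := Finset.sum_le_sum fun k _ => hf k
    _ = n * b := by simp
    _ ≤ K * b := by gcongr

/-- If `M = Uᵀ diag(σ²) U` with `U` upper triangular, `U` and its inverse have entries bounded
by `K`, and the `σ i` are large and essentially nondecreasing, then `M` differs from some `BᵀB`
with `B` integral by a diagonally dominant matrix. -/
theorem exists_sub_transpose_mul_self_diagonallyDominant {n : ℕ} (M : Matrix (Fin n) (Fin n) ℤ)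
    {K : ℝ} (hn : (n : ℝ) ≤ K) (hK : 1 ≤ K) (σ : Fin n → ℝ) (U V : Matrix (Fin n) (Fin n) ℝ)
    (hU : ∀ i j, j < i → U i j = 0) (hV : ∀ i j, j < i → V i j = 0) (hVU : V * U = 1)
    (hUK : ∀ i j, |U i j| ≤ K) (hVK : ∀ i j, |V i j| ≤ K)
    (hσK : ∀ i, 9 * K ^ 18 ≤ σ i) (hσ : ∀ k i, k ≤ i → σ k ≤ K * σ i)
    (hM : M.map (fun x => (x : ℝ)) = Uᵀ * Matrix.diagonal (fun i => σ i ^ 2) * U) :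
    ∃ B : Matrix (Fin n) (Fin n) ℤ,
      ∀ i, ∑ j ∈ Finset.univ.erase i, |(M - Bᵀ * B) i j| ≤ (M - Bᵀ * B) i i := by
  have hK0 : 0 < K := by linarith
  have hσ0 : ∀ i, 0 < σ i := fun i => lt_of_lt_of_le (by positivity) (hσK i)
  set c : ℝ := 2 * K ^ 4 with hc
  have hc0 : 0 < c := by positivity
  set D : Matrix (Fin n) (Fin n) ℝ := Matrix.diagonal σ with hD
  set S : Matrix (Fin n) (Fin n) ℝ := Vᵀ * Matrix.diagonal (fun i => c * σ i) * V with hS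
  have hSsym : ∀ a b, S a b = S b a := by
    intro a b
    have : Sᵀ = S := by simp [hS, Matrix.transpose_mul, Matrix.mul_assoc]
    exact congrFun (congrFun this b) a
  have hSbound : ∀ a b, |S a b| ≤ K * (c * K ^ 3 * σ a) := by
    intro a b
    have : S a b = ∑ k, V k a * (c * σ k) * V k b := by
      simp [hS, Matrix.mul_apply, Matrix.diagonal_apply]
    rw [this]
    refine abs_sum_le_mul hn (by have := hσ0 a; positivity) _ fun k => ?_
    rcases lt_or_ge a k with h | h
    · rw [hV k a h]
      have := hσ0 a
      simp only [zero_mul, abs_zero]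
      positivity
    · have h1 := hσ k a h
      have h2 := hσ0 k
      have h3 := hσ0 a
      rw [abs_mul, abs_mul, abs_of_pos (mul_pos hc0 h2)]
      calc |V k a| * (c * σ k) * |V k b| ≤ K * (c * (K * σ a)) * K := by
            gcongr
            · exact hVK k a
            · exact hVK k b
        _ = c * K ^ 3 * σ a := by ring
  set P : Matrix (Fin n) (Fin n) ℝ := Matrix.of fun a b =>
    if a < b then S a b / σ a else if a = b then S a b / (2 * σ a) else 0 with hP
  have hPbound : ∀ a b, |P a b| ≤ c * K ^ 4 := by
    intro a b
    have h0 := hσ0 a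
    have h1 : |S a b| / σ a ≤ c * K ^ 4 := by
      rw [div_le_iff₀ h0]
      refine (hSbound a b).trans (le_of_eq (by ring))
    simp only [hP, Matrix.of_apply]
    split_ifs
    · rwa [abs_div, abs_of_pos h0]
    · rw [abs_div, abs_of_pos (by positivity : 0 < 2 * σ a)]
      refine le_trans ?_ h1
      gcongr
      linarith
    · rw [abs_zero]; positivity
  have hDP : D * P + Pᵀ * D = S := by
    ext a b
    have ha := (hσ0 a).ne'
    have hb := (hσ0 b).ne'
    simp only [hD, Matrix.add_apply, Matrix.diagonal_mul, Matrix.mul_diagonal,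
      Matrix.transpose_apply, hP, Matrix.of_apply]
    rcases lt_trichotomy a b with h | h | h
    · simp only [h, h.not_gt, h.ne', if_true, if_false]
      field_simp
      ring
    · subst h
      simp only [lt_irrefl, if_true, if_false]
      field_simp
      ring
    · simp only [h, h.not_gt, h.ne', if_true, if_false]
      rw [hSsym b a]
      field_simp
      ring
  set R : Matrix (Fin n) (Fin n) ℝ := D * U with hR
  set Δ₀ : Matrix (Fin n) (Fin n) ℝ := P * U with hΔ₀
  have hΔ₀bound : ∀ a b, |Δ₀ a b| ≤ K * (c * K ^ 4 * K) := by
    intro a b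
    rw [hΔ₀, Matrix.mul_apply]
    refine abs_sum_le_mul hn (by positivity) _ fun k => ?_
    rw [abs_mul]
    exact mul_le_mul (hPbound a k) (hUK k b) (abs_nonneg _) (by positivity)
  have hRapply : ∀ a b, R a b = σ a * U a b := fun a b => by
    simp [hR, hD, Matrix.diagonal_mul]
  set B : Matrix (Fin n) (Fin n) ℤ := Matrix.of fun k j => round ((R - Δ₀) k j) with hB
  set ρ : Matrix (Fin n) (Fin n) ℝ := R - Δ₀ - B.map (fun x => (x : ℝ)) with hρ
  have hρbound : ∀ a b, |ρ a b| ≤ 1 / 2 := fun a b => by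
    simpa [hρ, hB] using abs_sub_round ((R - Δ₀) a b)
  have hρzero : ∀ a b, b < a → ρ a b = 0 := by
    intro a b hab
    have h1 : R a b = 0 := by rw [hRapply, hU a b hab, mul_zero]
    have h2 : Δ₀ a b = 0 := by
      rw [hΔ₀, Matrix.mul_apply]
      refine Finset.sum_eq_zero fun k _ => ?_
      rcases lt_or_ge b k with h | h
      · rw [hU k b h, mul_zero]
      · have : k < a := lt_of_le_of_lt h hab
        simp [hP, this.not_gt, this.ne']
    simp [hρ, hB, h1, h2]
  set Δ := Δ₀ + ρ with hΔ
  have hΔbound : ∀ a b, |Δ a b| ≤ 3 * K ^ 10 := by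
    intro a b
    have h1 : (1 : ℝ) ≤ K ^ 10 := one_le_pow₀ hK
    calc |Δ a b| ≤ |Δ₀ a b| + |ρ a b| := abs_add_le _ _
      _ ≤ K * (c * K ^ 4 * K) + 1 / 2 := add_le_add (hΔ₀bound a b) (hρbound a b)
      _ = 2 * K ^ 10 + 1 / 2 := by rw [hc]; ring
      _ ≤ 3 * K ^ 10 := by linarith
  have hBΔ : B.map (fun x => (x : ℝ)) = R - Δ := by rw [hΔ, hρ]; abel
  set E := Rᵀ * ρ + ρᵀ * R - Δᵀ * Δ with hE
  have hmain : (M - Bᵀ * B).map (fun x => (x : ℝ))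
      = Matrix.diagonal (fun i => c * σ i) + E := by
    have h1 : (M - Bᵀ * B).map (fun x => (x : ℝ)) = M.map (fun x => (x : ℝ))
        - (B.map (fun x => (x : ℝ)))ᵀ * B.map (fun x => (x : ℝ)) := by
      ext a b
      simp [Matrix.mul_apply]
    have h2 : M.map (fun x => (x : ℝ)) = Rᵀ * R := by
      rw [hM, hR, Matrix.transpose_mul, hD, Matrix.diagonal_transpose, Matrix.mul_assoc,
        Matrix.mul_assoc, ← Matrix.mul_assoc (Matrix.diagonal σ) (Matrix.diagonal σ),
        Matrix.diagonal_mul_diagonal]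
      simp only [pow_two]
    have h3 : Rᵀ * Δ₀ + Δ₀ᵀ * R = Matrix.diagonal (fun i => c * σ i) := by
      have : Rᵀ * Δ₀ + Δ₀ᵀ * R = Uᵀ * (D * P + Pᵀ * D) * U := by
        rw [hR, hΔ₀, Matrix.transpose_mul, Matrix.transpose_mul, hD, Matrix.diagonal_transpose]
        noncomm_ring
      rw [this, hDP, hS]
      have : Uᵀ * (Vᵀ * Matrix.diagonal (fun i => c * σ i) * V) * U
          = (V * U)ᵀ * Matrix.diagonal (fun i => c * σ i) * (V * U) := by
        rw [Matrix.transpose_mul]; noncomm_ring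
      rw [this, hVU]; simp
    rw [h1, h2, hBΔ, ← h3, hE, Matrix.transpose_sub]
    have h4 : Δ = Δ₀ + ρ := hΔ
    have : (Rᵀ - Δᵀ) * (R - Δ) = Rᵀ * R - Rᵀ * Δ - Δᵀ * R + Δᵀ * Δ := by noncomm_ring
    rw [this]
    have h5 : Rᵀ * Δ = Rᵀ * Δ₀ + Rᵀ * ρ := by rw [h4, Matrix.mul_add]
    have h6 : Δᵀ * R = Δ₀ᵀ * R + ρᵀ * R := by rw [h4, Matrix.transpose_add, Matrix.add_mul]
    rw [h5, h6]
    abel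
  have hEbound : ∀ i j, |E i j| ≤ K ^ 3 * σ i + 9 * K ^ 21 := by
    intro i j
    have hi := hσ0 i
    have hterm : ∀ k x y, (i < k → x = 0 ∨ y = 0) → |x| ≤ K → |y| ≤ 1 / 2 →
        |σ k * x * y| ≤ K * σ i * K * (1 / 2) := by
      intro k x y h0 hx hy
      rcases lt_or_ge i k with h | h
      · rcases h0 h with h | h <;> rw [h] <;> simp only [mul_zero, zero_mul, abs_zero] <;>
          positivity
      · rw [abs_mul, abs_mul, abs_of_pos (hσ0 k)]
        have := hσ k i h
        have := hσ0 k
        gcongr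
    have h1 : |(Rᵀ * ρ) i j| ≤ K * (K * σ i * K * (1 / 2)) := by
      rw [Matrix.mul_apply]
      refine abs_sum_le_mul hn (by positivity) _ fun k => ?_
      rw [Matrix.transpose_apply, hRapply]
      exact hterm k _ _ (fun h => Or.inl (hU k i h)) (hUK k i) (hρbound k j)
    have h2 : |(ρᵀ * R) i j| ≤ K * (K * σ i * K * (1 / 2)) := by
      rw [Matrix.mul_apply]
      refine abs_sum_le_mul hn (by positivity) _ fun k => ?_
      rw [Matrix.transpose_apply, hRapply, mul_comm]
      exact hterm k _ _ (fun h => Or.inr (hρzero k i h)) (hUK k j) (hρbound k i)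
    have h3 : |(Δᵀ * Δ) i j| ≤ K * (3 * K ^ 10 * (3 * K ^ 10)) := by
      rw [Matrix.mul_apply]
      refine abs_sum_le_mul hn (by positivity) _ fun k => ?_
      rw [Matrix.transpose_apply, abs_mul]
      exact mul_le_mul (hΔbound k i) (hΔbound k j) (abs_nonneg _) (by positivity)
    have h4 : E i j = (Rᵀ * ρ) i j + (ρᵀ * R) i j - (Δᵀ * Δ) i j := rfl
    rw [h4]
    calc _ ≤ |(Rᵀ * ρ) i j| + |(ρᵀ * R) i j| + |(Δᵀ * Δ) i j| :=
          (abs_sub _ _).trans (by gcongr; exact abs_add_le _ _)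
      _ ≤ K * (K * σ i * K * (1 / 2)) + K * (K * σ i * K * (1 / 2))
          + K * (3 * K ^ 10 * (3 * K ^ 10)) := by gcongr
      _ = _ := by ring
  refine ⟨B, fun i => ?_⟩
  have hentry : ∀ j, ((M - Bᵀ * B) i j : ℝ) = (if i = j then c * σ i else 0) + E i j := by
    intro j
    have := congrFun (congrFun hmain i) j
    rw [Matrix.map_apply, Matrix.add_apply, Matrix.diagonal_apply] at this
    exact this
  have hcast : ∑ j ∈ Finset.univ.erase i, |((M - Bᵀ * B) i j : ℝ)|
      ≤ ((M - Bᵀ * B) i i : ℝ) := by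
    have h1 : ∑ j ∈ Finset.univ.erase i, |((M - Bᵀ * B) i j : ℝ)|
        = ∑ j ∈ Finset.univ.erase i, |E i j| := by
      refine Finset.sum_congr rfl fun j hj => ?_
      rw [hentry, if_neg (Finset.ne_of_mem_erase hj).symm, zero_add]
    have h2 : ∑ j ∈ Finset.univ.erase i, |E i j| + |E i i| = ∑ j, |E i j| :=
      Finset.sum_erase_add _ _ (Finset.mem_univ i)
    have h3 : ∑ j, |E i j| ≤ K * (K ^ 3 * σ i + 9 * K ^ 21) := by
      have := hσ0 i
      have := abs_sum_le_mul (b := K ^ 3 * σ i + 9 * K ^ 21) hn (by positivity) (fun j => |E i j|)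
        (fun j => by rw [abs_abs]; exact hEbound i j)
      rwa [abs_of_nonneg (Finset.sum_nonneg fun j _ => abs_nonneg _)] at this
    have h4 : K * (K ^ 3 * σ i + 9 * K ^ 21) ≤ c * σ i := by
      have := mul_le_mul_of_nonneg_left (hσK i) (by positivity : 0 ≤ K ^ 4)
      rw [hc]
      nlinarith
    rw [h1, hentry, if_pos rfl]
    linarith [neg_abs_le (E i i)]
  exact_mod_cast hcast

/-- Upper triangular matrices with ones on the diagonal. -/
def IsUpperUnitriangular {R : Type*} [Zero R] [One R] {n : ℕ} (U : Matrix (Fin n) (Fin n) R) :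
    Prop :=
  (∀ i, U i i = 1) ∧ ∀ i j, j < i → U i j = 0

theorem IsUpperUnitriangular.one {R : Type*} [Zero R] [One R] {n : ℕ} :
    IsUpperUnitriangular (1 : Matrix (Fin n) (Fin n) R) :=
  ⟨fun i => Matrix.one_apply_eq i, fun _ _ h => Matrix.one_apply_ne h.ne'⟩

theorem IsUpperUnitriangular.mul {R : Type*} [CommRing R] {n : ℕ}
    {U W : Matrix (Fin n) (Fin n) R} (hU : IsUpperUnitriangular U)
    (hW : IsUpperUnitriangular W) : IsUpperUnitriangular (U * W) := by
  refine ⟨fun i => ?_, fun i j hij => ?_⟩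
  · rw [Matrix.mul_apply, Finset.sum_eq_single i, hU.1, hW.1, one_mul]
    · intro k _ hk
      rcases lt_or_gt_of_ne hk with h | h
      · rw [hU.2 i k h, zero_mul]
      · rw [hW.2 k i h, mul_zero]
    · simp
  · rw [Matrix.mul_apply]
    refine Finset.sum_eq_zero fun k _ => ?_
    rcases lt_or_ge k i with h | h
    · rw [hU.2 i k h, zero_mul]
    · rw [hW.2 k j (lt_of_lt_of_le hij h), mul_zero]

theorem IsUpperUnitriangular.det_eq_one {R : Type*} [CommRing R] {n : ℕ}
    {U : Matrix (Fin n) (Fin n) R} (hU : IsUpperUnitriangular U) : U.det = 1 := by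
  rw [Matrix.det_of_isUpperTriangular (fun i j h => hU.2 i j h)]
  simp [hU.1]

theorem IsUpperUnitriangular.map_intCast {n : ℕ} {T : Matrix (Fin n) (Fin n) ℤ}
    (hT : IsUpperUnitriangular T) :
    IsUpperUnitriangular (T.map (fun x => (x : ℝ))) :=
  ⟨fun i => by simp [hT.1], fun i j h => by simp [hT.2 i j h]⟩

/-- A block upper triangular matrix indexed by `Fin (p + q)`. -/
def finBlocks {R : Type*} [Zero R] {p q : ℕ} (A : Matrix (Fin p) (Fin p) R)
    (B : Matrix (Fin p) (Fin q) R) (D : Matrix (Fin q) (Fin q) R) :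
    Matrix (Fin (p + q)) (Fin (p + q)) R :=
  (Matrix.fromBlocks A B 0 D).submatrix finSumFinEquiv.symm finSumFinEquiv.symm

section finBlocks

variable {R : Type*} [CommRing R] {p q : ℕ}

theorem finBlocks_mul (A A' : Matrix (Fin p) (Fin p) R) (B B' : Matrix (Fin p) (Fin q) R)
    (D D' : Matrix (Fin q) (Fin q) R) :
    finBlocks A B D * finBlocks A' B' D' = finBlocks (A * A') (A * B' + B * D') (D * D') := by
  simp [finBlocks, Matrix.submatrix_mul_equiv, Matrix.fromBlocks_multiply]

theorem finBlocks_one : finBlocks (1 : Matrix (Fin p) (Fin p) R) 0 (1 : Matrix (Fin q) (Fin q) R)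
    = 1 := by
  simp [finBlocks]

theorem isUpperUnitriangular_finBlocks {A : Matrix (Fin p) (Fin p) R}
    (B : Matrix (Fin p) (Fin q) R) {D : Matrix (Fin q) (Fin q) R}
    (hA : IsUpperUnitriangular A) (hD : IsUpperUnitriangular D) :
    IsUpperUnitriangular (finBlocks A B D) := by
  refine ⟨fun i => ?_, fun i j => ?_⟩
  · induction i using Fin.addCases with
    | left i => simp [finBlocks, hA.1]
    | right i => simp [finBlocks, hD.1]
  · induction i using Fin.addCases with
    | left i =>
      induction j using Fin.addCases with
      | left j => exact fun h => by simpa [finBlocks] using hA.2 i j h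
      | right j => exact fun h => absurd h (by simp [Fin.lt_def]; omega)
    | right i =>
      induction j using Fin.addCases with
      | left j => simp [finBlocks]
      | right j => exact fun h => by simpa [finBlocks] using hD.2 i j (by simpa using h)

theorem exists_eq_finBlocks {U : Matrix (Fin (p + q)) (Fin (p + q)) R}
    (hU : IsUpperUnitriangular U) :
    ∃ A B D, IsUpperUnitriangular A ∧ IsUpperUnitriangular D ∧
      U = finBlocks (p := p) (q := q) A B D := by
  refine ⟨Matrix.of fun i j => U (Fin.castAdd q i) (Fin.castAdd q j),
    Matrix.of fun i j => U (Fin.castAdd q i) (Fin.natAdd p j),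
    Matrix.of fun i j => U (Fin.natAdd p i) (Fin.natAdd p j),
    ⟨fun i => hU.1 _, fun i j h => hU.2 _ _ h⟩,
    ⟨fun i => hU.1 _, fun i j h => hU.2 _ _ (by simpa using h)⟩, ?_⟩
  ext i j
  induction i using Fin.addCases with
  | left i =>
    induction j using Fin.addCases with
    | left j => simp [finBlocks]
    | right j => simp [finBlocks]
  | right i =>
    induction j using Fin.addCases with
    | left j =>
      simpa [finBlocks] using hU.2 (Fin.natAdd p i) (Fin.castAdd q j) (by simp [Fin.lt_def]; omega)
    | right j => simp [finBlocks]

end finBlocks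

theorem abs_finBlocks_le {p q : ℕ} {A : Matrix (Fin p) (Fin p) ℝ}
    {B : Matrix (Fin p) (Fin q) ℝ} {D : Matrix (Fin q) (Fin q) ℝ} {K : ℝ} (hK : 0 ≤ K)
    (hA : ∀ i j, |A i j| ≤ K) (hB : ∀ i j, |B i j| ≤ K) (hD : ∀ i j, |D i j| ≤ K) (i j) :
    |finBlocks A B D i j| ≤ K := by
  induction i using Fin.addCases with
  | left i =>
    induction j using Fin.addCases with
    | left j => simpa [finBlocks] using hA i j
    | right j => simpa [finBlocks] using hB i j
  | right i =>
    induction j using Fin.addCases with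
    | left j => simp [finBlocks, hK]
    | right j => simpa [finBlocks] using hD i j

/-- Seysen's reduction: an upper unitriangular real matrix can be multiplied by an integral one so
that both the product and its inverse have small entries. -/
theorem exists_seysen_reduction (k : ℕ) : ∀ n ≤ 2 ^ k, ∀ U : Matrix (Fin n) (Fin n) ℝ,
    IsUpperUnitriangular U → ∃ T : Matrix (Fin n) (Fin n) ℤ, IsUpperUnitriangular T ∧
      ∃ V : Matrix (Fin n) (Fin n) ℝ, IsUpperUnitriangular V ∧
        V * (U * T.map (fun x => (x : ℝ))) = 1 ∧
        (∀ i j, |(U * T.map (fun x => (x : ℝ))) i j| ≤ 2 ^ (k ^ 2)) ∧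
        ∀ i j, |V i j| ≤ 2 ^ (k ^ 2) := by
  induction k with
  | zero =>
    intro n hn U hU
    have hn1 : n ≤ 1 := by simpa using hn
    have : Subsingleton (Fin n) := Fin.subsingleton_iff_le_one.2 hn1
    have hU1 : U = 1 := by
      ext i j
      rw [Subsingleton.elim j i, hU.1, Matrix.one_apply_eq]
    have hone : ∀ i j, |(1 : Matrix (Fin n) (Fin n) ℝ) i j| ≤ 2 ^ (0 ^ 2) := by
      intro i j
      rw [Subsingleton.elim j i, Matrix.one_apply_eq]
      simp
    refine ⟨1, .one, 1, .one, ?_, ?_, hone⟩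
    · simp [hU1]
    · simp [hU1]
  | succ k ih =>
    intro n hn U hU
    obtain ⟨p, q, rfl, hp, hq⟩ : ∃ p q, n = p + q ∧ p ≤ 2 ^ k ∧ q ≤ 2 ^ k := by
      refine ⟨min n (2 ^ k), n - min n (2 ^ k), by omega, by omega, ?_⟩
      rw [pow_succ] at hn
      omega
    obtain ⟨A, B, D, hA, hD, rfl⟩ := exists_eq_finBlocks hU
    obtain ⟨T₁, hT₁, V₁, hV₁, hVA, hAb, hV₁b⟩ := ih p hp A hA
    obtain ⟨T₂, hT₂, V₂, hV₂, hVD, hDb, hV₂b⟩ := ih q hq D hD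
    set A₁ := A * T₁.map (fun x => (x : ℝ)) with hA₁
    set D₂ := D * T₂.map (fun x => (x : ℝ)) with hD₂
    set C := V₁ * (B * T₂.map (fun x => (x : ℝ))) with hC
    let X : Matrix (Fin p) (Fin q) ℤ := Matrix.of fun i j => round (C i j)
    set F : Matrix (Fin p) (Fin q) ℝ := C - X.map (fun x => (x : ℝ)) with hF
    have hFb : ∀ i j, |F i j| ≤ 1 / 2 := fun i j => by
      simpa [hF, X] using abs_sub_round (C i j)
    have hT : (finBlocks T₁ (-(T₁ * X)) T₂).map (fun x => (x : ℝ))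
        = finBlocks (T₁.map (fun x => (x : ℝ)))
          (-(T₁.map (fun x => (x : ℝ)) * X.map (fun x => (x : ℝ))))
          (T₂.map (fun x => (x : ℝ))) := by
      have : (-(T₁ * X)).map (fun x => (x : ℝ))
          = -(T₁.map (fun x => (x : ℝ)) * X.map (fun x => (x : ℝ))) := by
        ext i j
        simp [Matrix.mul_apply]
      rw [← this]
      simp [finBlocks, ← Matrix.submatrix_map, Matrix.fromBlocks_map]
    have hUT : finBlocks A B D * (finBlocks T₁ (-(T₁ * X)) T₂).map (fun x => (x : ℝ))
        = finBlocks A₁ (A₁ * F) D₂ := by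
      rw [hT, finBlocks_mul]
      congr 1
      have : A₁ * C = B * T₂.map (fun x => (x : ℝ)) := by
        rw [hC, ← Matrix.mul_assoc, mul_eq_one_comm.1 hVA, Matrix.one_mul]
      rw [hF, Matrix.mul_sub, this, hA₁, Matrix.mul_neg, Matrix.mul_assoc]
      abel
    have hb : (2 : ℝ) ^ k * (2 ^ (k ^ 2) * (1 / 2)) ≤ 2 ^ ((k + 1) ^ 2) := by
      calc (2 : ℝ) ^ k * (2 ^ (k ^ 2) * (1 / 2)) ≤ 2 ^ k * (2 ^ (k ^ 2) * 1) := by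
            gcongr; norm_num
        _ = 2 ^ (k + k ^ 2) := by rw [pow_add, mul_one]
        _ ≤ 2 ^ ((k + 1) ^ 2) := pow_le_pow_right₀ (by norm_num) (by nlinarith)
    have hmono : (2 : ℝ) ^ (k ^ 2) ≤ 2 ^ ((k + 1) ^ 2) :=
      pow_le_pow_right₀ (by norm_num) (Nat.pow_le_pow_left k.le_succ 2)
    refine ⟨finBlocks T₁ (-(T₁ * X)) T₂, isUpperUnitriangular_finBlocks _ hT₁ hT₂,
      finBlocks V₁ (-(F * V₂)) V₂, isUpperUnitriangular_finBlocks _ hV₁ hV₂, ?_, ?_, ?_⟩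
    · rw [hUT, finBlocks_mul, hVA, hVD, ← finBlocks_one]
      congr 1
      rw [← Matrix.mul_assoc, hVA, Matrix.one_mul, Matrix.neg_mul, Matrix.mul_assoc, hVD,
        Matrix.mul_one, add_neg_cancel]
    · rw [hUT]
      refine abs_finBlocks_le (by positivity) (fun i j => (hAb i j).trans hmono)
        (fun i j => ?_) (fun i j => (hDb i j).trans hmono)
      rw [Matrix.mul_apply]
      refine (abs_sum_le_mul (by exact_mod_cast hp) (by positivity) _ fun l => ?_).trans hb
      rw [abs_mul]
      exact mul_le_mul (hAb i l) (hFb l j) (abs_nonneg _) (by positivity)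
    · refine abs_finBlocks_le (by positivity) (fun i j => (hV₁b i j).trans hmono)
        (fun i j => ?_) (fun i j => (hV₂b i j).trans hmono)
      rw [Matrix.neg_apply, abs_neg, Matrix.mul_apply]
      refine (abs_sum_le_mul (by exact_mod_cast hq) (by positivity) _ fun l => ?_).trans hb
      rw [abs_mul, mul_comm]
      exact mul_le_mul (hV₂b l j) (hFb i l) (abs_nonneg _) (by positivity)

/-- Every nonzero integral vector is a multiple of the first column of an invertible integral
matrix. -/
theorem exists_unimodular_of_ne_zero {n : ℕ} (v : Fin (n + 1) → ℤ) (hv : v ≠ 0) :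
    ∃ T T' : Matrix (Fin (n + 1)) (Fin (n + 1)) ℤ, T * T' = 1 ∧
      ∃ a : ℤ, a ≠ 0 ∧ v = fun i => a * T i 0 := by
  obtain ⟨m, snf⟩ := (Submodule.span ℤ {v}).smithNormalForm (Pi.basisFun ℤ (Fin (n + 1)))
  have hvmem : v ∈ Submodule.span ℤ {v} := Submodule.mem_span_singleton_self v
  have hm : 0 < m := by
    rcases Nat.eq_zero_or_pos m with rfl | h
    · exfalso
      have := snf.bN.ext_elem (x := ⟨v, hvmem⟩) (y := 0) (fun i => i.elim0)
      exact hv (congrArg Subtype.val this)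
    · exact h
  let j := snf.f ⟨0, hm⟩
  obtain ⟨k, hk⟩ := Submodule.mem_span_singleton.1 (snf.bN ⟨0, hm⟩).2
  have hk0 : k ≠ 0 := by
    rintro rfl
    rw [zero_smul] at hk
    exact snf.bN.ne_zero ⟨0, hm⟩ (Subtype.ext hk.symm)
  have hkv : k • v = snf.a ⟨0, hm⟩ • snf.bM j := by rw [hk, snf.snf]
  have hcoord : ∀ i, i ≠ j → snf.bM.repr v i = 0 := by
    intro i hi
    have h := congrArg (fun w => snf.bM.repr w i) hkv
    simp only [map_smul, Finsupp.smul_apply, Module.Basis.repr_self, smul_eq_mul,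
      Finsupp.single_eq_of_ne hi, mul_zero] at h
    exact (mul_eq_zero.1 h).resolve_left hk0
  have hvj : v = snf.bM.repr v j • snf.bM j := by
    conv_lhs => rw [← snf.bM.sum_repr v]
    exact Finset.sum_eq_single j (fun i _ hi => by rw [hcoord i hi, zero_smul]) (by simp)
  let b := snf.bM.reindex (Equiv.swap j 0)
  refine ⟨(Pi.basisFun ℤ _).toMatrix b, b.toMatrix (Pi.basisFun ℤ _),
    Module.Basis.toMatrix_mul_toMatrix_flip _ _, snf.bM.repr v j, ?_, ?_⟩
  · intro h
    rw [h, zero_smul] at hvj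
    exact hv hvj
  · conv_lhs => rw [hvj]
    ext i
    simp [b, Module.Basis.toMatrix_apply]

/-- Minkowski's theorem for the quadratic form `∑ i, h i * (U *ᵥ y) i ^ 2`. -/
theorem exists_int_sum_pow_le {m : ℕ} (hm : 0 < m) (U : Matrix (Fin m) (Fin m) ℝ)
    (hU : U.det = 1) (h : Fin m → ℝ) (hh : ∀ i, 0 < h i) :
    ∃ y : Fin m → ℤ, y ≠ 0 ∧
      (∑ i, h i * (U *ᵥ fun j => (y j : ℝ)) i ^ 2) ^ m ≤ (m : ℝ) ^ m * ∏ i, h i := by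
  have : Nonempty (Fin m) := ⟨⟨0, hm⟩⟩
  set R : Matrix (Fin m) (Fin m) ℝ := Matrix.diagonal (fun i => √(h i)) * U with hR
  have hdet : R.det = ∏ i, √(h i) := by
    rw [hR, Matrix.det_mul, hU, mul_one, Matrix.det_diagonal]
  have hpos : 0 < ∏ i, √(h i) := Finset.prod_pos fun i _ => Real.sqrt_pos.2 (hh i)
  set c : ℝ := (∏ i, √(h i)) ^ ((m : ℝ)⁻¹) with hc
  have hc0 : 0 ≤ c := by positivity
  have hcm : c ^ m = ∏ i, √(h i) := Real.rpow_inv_natCast_pow hpos.le hm.ne'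
  have hdet' : Rᵀ.det ≠ 0 := by rw [Matrix.det_transpose, hdet]; exact hpos.ne'
  have hli : LinearIndependent ℝ (fun i => Rᵀ i) :=
    Matrix.linearIndependent_rows_of_det_ne_zero hdet'
  let b := basisOfLinearIndependentOfCardEqFinrank hli (by simp)
  have hb : ⇑b = fun i => Rᵀ i := coe_basisOfLinearIndependentOfCardEqFinrank _ _
  have hvol : MeasureTheory.volume (ZSpan.fundamentalDomain b)
      = ENNReal.ofReal (∏ i, √(h i)) := by
    rw [ZSpan.volume_fundamentalDomain]
    have : Matrix.of ⇑b = Rᵀ := by rw [hb]; rfl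
    rw [this, Matrix.det_transpose, hdet, abs_of_pos hpos]
  have : Countable (Submodule.span ℤ (Set.range b)).toAddSubgroup :=
    inferInstanceAs (Countable (Submodule.span ℤ (Set.range b)))
  obtain ⟨⟨x, hx⟩, hx0, hxs⟩ :=
    MeasureTheory.exists_ne_zero_mem_lattice_of_measure_mul_two_pow_le_measure
      (s := Set.Icc (fun _ : Fin m => -c) (fun _ => c))
      (ZSpan.isAddFundamentalDomain' b MeasureTheory.volume)
      (fun x hx => ⟨fun i => neg_le_neg (hx.2 i), fun i => by simpa using neg_le.1 (hx.1 i)⟩)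
      (convex_Icc _ _) isCompact_Icc (by
        rw [hvol, Real.volume_Icc_pi]
        simp only [Finset.prod_const, Finset.card_univ, Fintype.card_fin,
          Module.finrank_fintype_fun_eq_card, sub_neg_eq_add, ← two_mul]
        rw [← ENNReal.ofReal_pow (by positivity), mul_pow, hcm,
          ENNReal.ofReal_mul (by positivity), ENNReal.ofReal_pow (by norm_num)]
        simp [mul_comm])
  obtain ⟨y, rfl⟩ := Submodule.mem_span_range_iff_exists_fun ℤ |>.1 hx
  have hRy : ∀ i, (∑ k, y k • b k) i = √(h i) * (U *ᵥ fun j => (y j : ℝ)) i := by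
    intro i
    have h1 : R *ᵥ (fun j => (y j : ℝ)) = Matrix.diagonal (fun i => √(h i)) *ᵥ
        (U *ᵥ fun j => (y j : ℝ)) := by rw [hR, Matrix.mulVec_mulVec]
    rw [← Matrix.mulVec_diagonal (fun i => √(h i)), ← h1]
    simp [hb, Matrix.mulVec, dotProduct, mul_comm]
  refine ⟨y, ?_, ?_⟩
  · rintro rfl
    exact hx0 (Subtype.ext (by simp))
  · have hle : ∑ i, h i * (U *ᵥ fun j => (y j : ℝ)) i ^ 2 ≤ m * c ^ 2 := by
      calc _ ≤ ∑ _i : Fin m, c ^ 2 := by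
            refine Finset.sum_le_sum fun i _ => ?_
            have h1 := hxs.1 i
            have h2 := hxs.2 i
            simp only [hRy] at h1 h2
            have h3 : h i * (U *ᵥ fun j => (y j : ℝ)) i ^ 2
                = (√(h i) * (U *ᵥ fun j => (y j : ℝ)) i) ^ 2 := by
              rw [mul_pow, Real.sq_sqrt (hh i).le]
            rw [h3]
            exact sq_le_sq' h1 h2
        _ = m * c ^ 2 := by simp
    have hnonneg : 0 ≤ ∑ i, h i * (U *ᵥ fun j => (y j : ℝ)) i ^ 2 :=
      Finset.sum_nonneg fun i _ => mul_nonneg (hh i).le (sq_nonneg _)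
    calc _ ≤ (m * c ^ 2) ^ m := pow_le_pow_left₀ hnonneg hle m
      _ = (m : ℝ) ^ m * (c ^ m) ^ 2 := by rw [mul_pow, ← pow_mul, ← pow_mul, mul_comm 2 m]
      _ = (m : ℝ) ^ m * ∏ i, h i := by
        rw [hcm, ← Finset.prod_pow]
        congr 1
        exact Finset.prod_congr rfl fun i _ => Real.sq_sqrt (hh i).le

/-- Minkowski's theorem applied to the first `m` variables. -/
theorem IsUpperUnitriangular.exists_int_sum_pow_le {n m : ℕ} (hm : 0 < m) (hmn : m ≤ n)
    {U : Matrix (Fin n) (Fin n) ℝ} (hU : IsUpperUnitriangular U) (h : ℕ → ℝ)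
    (hh : ∀ i, 0 < h i) :
    ∃ y : Fin n → ℤ, y ≠ 0 ∧ (∑ i : Fin n, h i * (U *ᵥ fun j => (y j : ℝ)) i ^ 2) ^ m
      ≤ (m : ℝ) ^ m * ∏ k ∈ Finset.range m, h k := by
  obtain ⟨r, rfl⟩ := Nat.exists_eq_add_of_le hmn
  obtain ⟨A, B, D, hA, -, rfl⟩ := exists_eq_finBlocks hU
  obtain ⟨x, hx0, hx⟩ := _root_.exists_int_sum_pow_le hm A hA.det_eq_one (fun i => h i)
    fun i => hh i
  refine ⟨Fin.append x 0, fun h0 => hx0 (funext fun i => ?_), ?_⟩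
  · simpa using congrFun h0 (Fin.castAdd r i)
  · rw [Finset.prod_range]
    convert hx using 2
    rw [Fin.sum_univ_add]
    simp [finBlocks, Matrix.mulVec, dotProduct, Fin.sum_univ_add]

theorem Matrix.IsSymm.dotProduct_mulVec_cons {R : Type*} [CommRing R] {n : ℕ}
    {N : Matrix (Fin (n + 1)) (Fin (n + 1)) R} (hN : N.IsSymm) (s : R) (x : Fin n → R) :
    (Fin.cons s x : Fin (n + 1) → R) ⬝ᵥ N *ᵥ (Fin.cons s x : Fin (n + 1) → R)
      = N 0 0 * s ^ 2 + 2 * s * ((fun j : Fin n => N 0 j.succ) ⬝ᵥ x)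
        + x ⬝ᵥ N.submatrix Fin.succ Fin.succ *ᵥ x := by
  have h : ∀ i : Fin n, N i.succ 0 = N 0 i.succ := fun i => hN.apply 0 i.succ
  simp only [dotProduct, Matrix.mulVec, Fin.sum_univ_succ, Fin.cons_zero, Fin.cons_succ, h,
    mul_add, Finset.sum_add_distrib, Matrix.submatrix_apply]
  have h1 : ∑ i : Fin n, x i * (N 0 i.succ * s) = s * ∑ i, N 0 i.succ * x i := by
    rw [Finset.mul_sum]
    exact Finset.sum_congr rfl fun i _ => by ring
  rw [h1]
  ring

theorem dotProduct_mulVec_congr {R : Type*} [CommRing R] {n m : ℕ}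
    (N : Matrix (Fin n) (Fin n) R) (T : Matrix (Fin n) (Fin m) R) (x : Fin m → R) :
    x ⬝ᵥ (Tᵀ * N * T) *ᵥ x = (T *ᵥ x) ⬝ᵥ N *ᵥ (T *ᵥ x) := by
  rw [Matrix.mul_assoc, ← Matrix.mulVec_mulVec, Matrix.dotProduct_mulVec,
    Matrix.vecMul_transpose, Matrix.mulVec_mulVec]

theorem intCast_dotProduct_mulVec {n : ℕ} {N : Matrix (Fin n) (Fin n) ℤ}
    {U : Matrix (Fin n) (Fin n) ℝ} {h : Fin n → ℝ}
    (hN : N.map (fun x => (x : ℝ)) = Uᵀ * Matrix.diagonal h * U) (x : Fin n → ℤ) :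
    ((x ⬝ᵥ N *ᵥ x : ℤ) : ℝ) = ∑ i, h i * (U *ᵥ fun j => (x j : ℝ)) i ^ 2 := by
  have h1 : ((x ⬝ᵥ N *ᵥ x : ℤ) : ℝ)
      = (fun j => (x j : ℝ)) ⬝ᵥ N.map (fun x => (x : ℝ)) *ᵥ (fun j => (x j : ℝ)) := by
    simp [dotProduct, Matrix.mulVec]
  rw [h1, hN, dotProduct_mulVec_congr]
  simp only [dotProduct, Matrix.mulVec_diagonal]
  exact Finset.sum_congr rfl fun i _ => by ring

theorem mulVec_ne_zero_of_mul_eq_one {n : ℕ} {T T' : Matrix (Fin n) (Fin n) ℤ}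
    (hT : T * T' = 1) {x : Fin n → ℤ} (hx : x ≠ 0) : T *ᵥ x ≠ 0 := by
  intro h
  apply hx
  rw [← Matrix.one_mulVec x, ← mul_eq_one_comm.1 hT, ← Matrix.mulVec_mulVec, h,
    Matrix.mulVec_zero]

/-- A positive definite integral form attains its minimum at the first column of an invertible
integral matrix. -/
theorem exists_unimodular_min {n : ℕ} (N : Matrix (Fin (n + 1)) (Fin (n + 1)) ℤ)
    (hN : ∀ x, x ≠ 0 → 0 < x ⬝ᵥ N *ᵥ x) :
    ∃ T T' : Matrix (Fin (n + 1)) (Fin (n + 1)) ℤ, T * T' = 1 ∧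
      ∀ x, x ≠ 0 → (Tᵀ * N * T) 0 0 ≤ x ⬝ᵥ N *ᵥ x := by
  obtain ⟨v, hv, hmin⟩ := (measure fun x : Fin (n + 1) → ℤ => (x ⬝ᵥ N *ᵥ x).toNat).wf.has_min
    {x | x ≠ 0} ⟨Pi.single 0 1, by simp⟩
  obtain ⟨T, T', hTT', a, ha, hva⟩ := exists_unimodular_of_ne_zero v hv
  refine ⟨T, T', hTT', fun x hx => ?_⟩
  have hle : v ⬝ᵥ N *ᵥ v ≤ x ⬝ᵥ N *ᵥ x := by
    have h1 : ¬ (x ⬝ᵥ N *ᵥ x).toNat < (v ⬝ᵥ N *ᵥ v).toNat := hmin x hx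
    have h2 := hN x hx
    omega
  set e : Fin (n + 1) → ℤ := Pi.single 0 1 with he
  have he0 : e ≠ 0 := by simp [he]
  have hTe : v = a • (T *ᵥ e) := by
    rw [hva]
    ext i
    simp [he]
  have hval : (Tᵀ * N * T) 0 0 = (T *ᵥ e) ⬝ᵥ N *ᵥ (T *ᵥ e) := by
    rw [← dotProduct_mulVec_congr]
    simp [he]
  have hpos := hN _ (mulVec_ne_zero_of_mul_eq_one hTT' he0)
  have ha2 : 1 ≤ a ^ 2 := by
    have : 0 < a ^ 2 := by positivity
    omega
  rw [hval]
  refine le_trans ?_ hle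
  rw [hTe, Matrix.mulVec_smul, dotProduct_smul, smul_dotProduct, smul_eq_mul, smul_eq_mul]
  nlinarith

/-- Hermite–Korkine–Zolotarev reduction: every positive definite integral form is equivalent to
one with Cholesky decomposition `Uᵀ * diag h * U` in which every block of consecutive `h i`
satisfies Minkowski's inequality. -/
theorem exists_hkz_reduction (n : ℕ) : ∀ N : Matrix (Fin n) (Fin n) ℤ, N.IsSymm →
    (∀ x, x ≠ 0 → 0 < x ⬝ᵥ N *ᵥ x) →
    ∃ T T' : Matrix (Fin n) (Fin n) ℤ, T * T' = 1 ∧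
      ∃ U : Matrix (Fin n) (Fin n) ℝ, IsUpperUnitriangular U ∧ ∃ h : ℕ → ℝ, (∀ i, 0 < h i) ∧
        (Tᵀ * N * T).map (fun x => (x : ℝ)) = Uᵀ * Matrix.diagonal (fun i : Fin n => h i) * U ∧
        ∀ i m, 0 < m → i + m ≤ n →
          h i ^ m ≤ (m : ℝ) ^ m * ∏ k ∈ Finset.range m, h (i + k) := by
  induction n with
  | zero =>
    intro N _ _
    exact ⟨1, 1, one_mul 1, 1, .one, fun _ => 1, fun _ => one_pos, Subsingleton.elim _ _,
      fun i m hm him => by omega⟩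
  | succ n ih =>
    intro N hN hpos
    obtain ⟨T₀, T₀', hT₀, hmin⟩ := exists_unimodular_min N hpos
    set N' := T₀ᵀ * N * T₀ with hN'
    have hN's : N'.IsSymm := by
      rw [hN', Matrix.IsSymm, Matrix.transpose_mul, Matrix.transpose_mul,
        Matrix.transpose_transpose, hN.eq, Matrix.mul_assoc]
    have hN'pos : ∀ x, x ≠ 0 → 0 < x ⬝ᵥ N' *ᵥ x := fun x hx => by
      rw [hN', dotProduct_mulVec_congr]
      exact hpos _ (mulVec_ne_zero_of_mul_eq_one hT₀ hx)
    set a := N' 0 0 with ha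
    have ha0 : 0 < a := by simpa using hN'pos (Pi.single 0 1) (by simp)
    set b : Fin n → ℤ := fun j => N' 0 j.succ with hb
    set C := N'.submatrix Fin.succ Fin.succ with hC
    have hCs : C.IsSymm := hN's.submatrix _
    have hSpos : ∀ x, x ≠ 0 → 0 < x ⬝ᵥ (a • C - Matrix.vecMulVec b b) *ᵥ x := by
      intro x hx
      have h1 := hN'pos (Fin.cons (-(b ⬝ᵥ x)) (a • x)) (fun h0 => hx (funext fun i => by
        simpa [ha0.ne'] using congrFun h0 i.succ))
      rw [hN's.dotProduct_mulVec_cons, ← ha, ← hb, ← hC, dotProduct_smul, Matrix.mulVec_smul,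
        dotProduct_smul, smul_dotProduct] at h1
      have h2 : x ⬝ᵥ (a • C - Matrix.vecMulVec b b) *ᵥ x
          = a * (x ⬝ᵥ C *ᵥ x) - (b ⬝ᵥ x) ^ 2 := by
        rw [Matrix.sub_mulVec, dotProduct_sub, Matrix.smul_mulVec, dotProduct_smul,
          Matrix.vecMulVec_mulVec, dotProduct_smul, dotProduct_comm x b]
        simp [sq]
      rw [h2]
      simp only [smul_eq_mul] at h1
      refine pos_of_mul_pos_right (a := a) ?_ ha0.le
      linarith
    obtain ⟨T₁, T₁', hT₁, U₁, hU₁, h₁, hh₁, hdecomp, hblock⟩ :=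
      ih (a • C - Matrix.vecMulVec b b) (by
        rw [Matrix.IsSymm, Matrix.transpose_sub, Matrix.transpose_smul, hCs.eq,
          Matrix.transpose_vecMulVec]) hSpos
    have haR : (0 : ℝ) < a := by exact_mod_cast ha0
    let bordered : Matrix (Fin n) (Fin n) ℤ → Matrix (Fin (n + 1)) (Fin (n + 1)) ℤ := fun T =>
      Matrix.of (Fin.cons (Fin.cons 1 0) fun i => Fin.cons 0 (T i))
    let h : ℕ → ℝ := fun i => Nat.casesOn i (a : ℝ) fun k => h₁ k / a
    let U : Matrix (Fin (n + 1)) (Fin (n + 1)) ℝ :=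
      Matrix.of (Fin.cons (Fin.cons 1 fun j => (b ᵥ* T₁) j / a) fun i => Fin.cons 0 (U₁ i))
    have hh : ∀ i, 0 < h i := fun i => by
      cases i with
      | zero => exact haR
      | succ k => exact div_pos (hh₁ k) haR
    have hU : IsUpperUnitriangular U := by
      refine ⟨fun i => ?_, fun i j hij => ?_⟩
      · cases i using Fin.cases with
        | zero => rfl
        | succ i => exact hU₁.1 i
      · cases i using Fin.cases with
        | zero => exact absurd hij (Fin.not_lt_zero _)
        | succ i =>
          cases j using Fin.cases with
          | zero => rfl
          | succ j => exact hU₁.2 i j (Fin.succ_lt_succ_iff.1 hij)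
    have hexp : ((bordered T₁)ᵀ * N' * bordered T₁).map (fun x => (x : ℝ))
        = Uᵀ * Matrix.diagonal (fun i : Fin (n + 1) => h i) * U := by
      have hN0 : ∀ j : Fin n, N' j.succ 0 = b j := fun j => hN's.apply 0 j.succ
      have hS : ∀ i j, ((T₁ᵀ * (a • C - Matrix.vecMulVec b b) * T₁) i j : ℤ)
          = a * (T₁ᵀ * C * T₁) i j - (b ᵥ* T₁) i * (b ᵥ* T₁) j := fun i j => by
        rw [Matrix.mul_sub, Matrix.sub_mul, Matrix.mul_vecMulVec, Matrix.vecMulVec_mul,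
          Matrix.mulVec_transpose, Matrix.mul_smul, Matrix.smul_mul,
          Matrix.sub_apply, Matrix.smul_apply, Matrix.vecMulVec_apply, smul_eq_mul]
      have hS' : ∀ i j, ((T₁ᵀ * C * T₁) i j : ℝ) = ((b ᵥ* T₁) i : ℝ) * (b ᵥ* T₁) j / a
          + (U₁ᵀ * Matrix.diagonal (fun i : Fin n => h₁ i) * U₁) i j / a := fun i j => by
        rw [← hdecomp, Matrix.map_apply, hS]
        push_cast
        field_simp
        ring
      ext i j
      rw [Matrix.map_apply]
      cases i using Fin.cases with
      | zero =>
        cases j using Fin.cases with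
        | zero =>
          simp [Matrix.mul_apply, Fin.sum_univ_succ, bordered, U, h, Matrix.diagonal_apply, ha]
        | succ j =>
          simp [Matrix.mul_apply, Fin.sum_univ_succ, bordered, U, h, Matrix.diagonal_apply]
          rw [mul_div_cancel₀ _ haR.ne']
          simp [Matrix.vecMul, dotProduct, hb]
      | succ i =>
        cases j using Fin.cases with
        | zero =>
          simp [Matrix.mul_apply, Fin.sum_univ_succ, bordered, U, h, Matrix.diagonal_apply]
          rw [div_mul_cancel₀ _ haR.ne']
          simp [Matrix.vecMul, dotProduct, hN0, mul_comm]
        | succ j =>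
          have h1 : ((bordered T₁)ᵀ * N' * bordered T₁) i.succ j.succ = (T₁ᵀ * C * T₁) i j := by
            simp [Matrix.mul_apply, Fin.sum_univ_succ, bordered, hC]
          rw [h1, hS']
          simp [Matrix.mul_apply, Fin.sum_univ_succ, U, h, Matrix.diagonal_apply]
          rw [div_mul_cancel₀ _ haR.ne', mul_div_assoc, Finset.sum_div]
          congr 1
          exact Finset.sum_congr rfl fun k _ => by ring
    have hTT' : (T₀ * bordered T₁) * (bordered T₁' * T₀') = 1 := by
      have h1 : bordered T₁ * bordered T₁' = 1 := by
        ext i j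
        have h2 := congrFun₂ hT₁
        simp only [Matrix.mul_apply] at h2
        cases i using Fin.cases <;> cases j using Fin.cases <;>
          simp [Matrix.mul_apply, Fin.sum_univ_succ, bordered, h2, Matrix.one_apply,
            (Fin.succ_ne_zero _).symm]
      rw [Matrix.mul_assoc, ← Matrix.mul_assoc (bordered T₁), h1, Matrix.one_mul, hT₀]
    have hexp' : ((T₀ * bordered T₁)ᵀ * N * (T₀ * bordered T₁)).map (fun x => (x : ℝ))
        = Uᵀ * Matrix.diagonal (fun i : Fin (n + 1) => h i) * U := by
      rw [← hexp, hN']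
      simp only [Matrix.transpose_mul, Matrix.mul_assoc]
    refine ⟨T₀ * bordered T₁, bordered T₁' * T₀', hTT', U, hU, h, hh, hexp', fun i m hm him => ?_⟩
    cases i with
    | zero =>
      obtain ⟨y, hy0, hy⟩ := hU.exists_int_sum_pow_le hm (by omega) h hh
      simp only [zero_add]
      refine le_trans (pow_le_pow_left₀ (hh 0).le ?_ m) hy
      rw [← intCast_dotProduct_mulVec hexp', dotProduct_mulVec_congr]
      exact Int.cast_le.2 (hmin _ (mulVec_ne_zero_of_mul_eq_one hTT' hy0))
    | succ i =>
      have h1 := hblock i m hm (by omega)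
      have h2 : ∀ k, h (i + 1 + k) = h₁ (i + k) / a := fun k => by
        rw [Nat.add_right_comm]
      have h3 : h (i + 1) = h₁ i / a := rfl
      simp only [h2, h3, Finset.prod_div_distrib, Finset.prod_const, Finset.card_range, div_pow]
      rw [← mul_div_assoc]
      gcongr

/-- Minkowski's inequality on all blocks forces the sequence to decrease slowly. -/
theorem le_exp_mul_of_block_le {n : ℕ} {h : ℕ → ℝ} (hh : ∀ i, 0 < h i)
    (hblock : ∀ i m, 0 < m → i + m ≤ n →
      h i ^ m ≤ (m : ℝ) ^ m * ∏ k ∈ Finset.range m, h (i + k))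
    {i j : ℕ} (hij : i ≤ j) (hj : j < n) :
    h i ≤ Real.exp ((1 + Real.log n) ^ 2) * h j := by
  set L := Real.log n with hL
  have hL0 : 0 ≤ L := Real.log_natCast_nonneg n
  let S : ℕ → ℝ := fun t => ∑ k ∈ Finset.range t, Real.log (h (j - k))
  have hS : ∀ t, S (t + 1) = S t + Real.log (h (j - t)) := fun t => Finset.sum_range_succ _ _
  have hstep : ∀ t, t ≤ j → t * Real.log (h (j - t)) ≤ (t + 1) * L + S t := by
    intro t ht
    have h1 := Real.log_le_log (pow_pos (hh _) _) (hblock (j - t) (t + 1) t.succ_pos (by omega))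
    rw [Real.log_mul (by positivity) (Finset.prod_pos fun k _ => hh _).ne', Real.log_pow,
      Real.log_pow, Real.log_prod fun k _ => (hh _).ne'] at h1
    have h2 : ∑ k ∈ Finset.range (t + 1), Real.log (h (j - t + k)) = S (t + 1) := by
      rw [← Finset.sum_range_reflect]
      refine Finset.sum_congr rfl fun k hk => ?_
      rw [Finset.mem_range] at hk
      congr 2
      omega
    rw [h2, hS] at h1
    have h3 : Real.log ((t + 1 : ℕ) : ℝ) ≤ L :=
      Real.log_le_log (by positivity) (by exact_mod_cast (by omega : t + 1 ≤ n))
    push_cast at h1 h3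
    nlinarith
  have hS_le : ∀ t, t ≤ j → S (t + 1) ≤ (t + 1) * (Real.log (h j) + L * harmonic t) := by
    intro t
    induction t with
    | zero => simp [S]
    | succ t ih =>
      intro ht
      have h1 := ih (by omega)
      have h2 := hstep (t + 1) ht
      rw [hS, harmonic_succ]
      push_cast at h2 ⊢
      have ht0 : (0 : ℝ) < t + 1 := by positivity
      refine le_of_mul_le_mul_left ?_ ht0
      have h3 : ((t : ℝ) + 1) * ((t + 1 + 1) * (Real.log (h j) + L * (harmonic t + (t + 1 : ℝ)⁻¹)))
          = (t + 2) * ((t + 1) * (Real.log (h j) + L * harmonic t)) + (t + 2) * L := by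
        field_simp
        ring
      rw [h3]
      nlinarith
  have hlog : Real.log (h i) ≤ (1 + L) ^ 2 + Real.log (h j) := by
    obtain ⟨t, ht, rfl⟩ : ∃ t, t ≤ j ∧ i = j - t := ⟨j - i, by omega, by omega⟩
    cases t with
    | zero => simpa using sq_nonneg (1 + L)
    | succ s =>
      have h1 := hS_le s (by omega)
      have h2 := hstep (s + 1) ht
      have h3 : (harmonic (s + 1) : ℝ) ≤ 1 + L :=
        (harmonic_le_one_add_log _).trans (add_le_add_right
          (Real.log_le_log (by positivity) (by exact_mod_cast (by omega : s + 1 ≤ n))) _)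
      rw [harmonic_succ] at h3
      push_cast at h2 h3
      have hs0 : (0 : ℝ) < s + 1 := by positivity
      refine le_of_mul_le_mul_left ?_ hs0
      have h4 : L * (harmonic s + (s + 1 : ℝ)⁻¹) ≤ L * (1 + L) :=
        mul_le_mul_of_nonneg_left h3 hL0
      have h5 : ((s : ℝ) + 1) * (L * (harmonic s + (s + 1 : ℝ)⁻¹))
          = (s + 1) * (L * harmonic s) + L := by
        field_simp
      have h6 := mul_le_mul_of_nonneg_left h4 hs0.le
      nlinarith
  rw [← Real.exp_log (hh i), ← Real.exp_log (hh j), ← Real.exp_add]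
  exact Real.exp_le_exp.2 hlog

/-- If every represented positive definite form is a sum of `g` squares, then so is every
represented form, positive definite or not. -/
theorem repBySquares_transpose_mul_self_of_forall_posDef {n g : ℕ}
    (hg : ∀ M : Matrix (Fin n) (Fin n) ℤ, M.IsSymm → (M.map (fun x => (x : ℝ))).PosDef →
      (∃ r : ℕ, 0 < r ∧ RepBySquares n r M) → RepBySquares n g M)
    {ι : Type*} [Fintype ι] (A : Matrix ι (Fin n) ℤ) : RepBySquares n g (Aᵀ * A) := by
  classical
  obtain ⟨s, hs⟩ := Module.projective_lifting_property A.mulVecLin.rangeRestrict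
    LinearMap.id A.mulVecLin.surjective_rangeRestrict
  have hs' : ∀ x, A *ᵥ s x = x := fun x => congrArg Subtype.val (LinearMap.congr_fun hs x)
  set P : Matrix (Fin n) (Fin n) ℤ := LinearMap.toMatrix' (s ∘ₗ A.mulVecLin.rangeRestrict) with hP
  have hPx : ∀ x, P *ᵥ x = s (A.mulVecLin.rangeRestrict x) := fun x => by
    rw [hP, ← Matrix.toLin'_apply, Matrix.toLin'_toMatrix']
    rfl
  have hAP : A * P = A := by
    refine Matrix.mulVec_injective (funext fun x => ?_)
    rw [← Matrix.mulVec_mulVec, hPx, hs']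
    rfl
  have hPP : P * P = P := by
    refine Matrix.mulVec_injective (funext fun x => ?_)
    rw [← Matrix.mulVec_mulVec, hPx, hPx]
    congr 1
    exact Subtype.ext (hs' _)
  set A' : Matrix (ι ⊕ Fin n) (Fin n) ℤ := Matrix.fromRows A (1 - P) with hA'
  have hinj : ∀ x, A' *ᵥ x = 0 → x = 0 := by
    intro x hx
    rw [hA', Matrix.fromRows_mulVec] at hx
    have h1 : A *ᵥ x = 0 := funext fun i => congrFun hx (Sum.inl i)
    have h2 : (1 - P) *ᵥ x = 0 := funext fun i => congrFun hx (Sum.inr i)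
    have h3 : A.mulVecLin.rangeRestrict x = 0 := Subtype.ext h1
    rwa [Matrix.sub_mulVec, Matrix.one_mulVec, hPx, h3, map_zero, sub_zero] at h2
  have hdet : (A'ᵀ * A').det ≠ 0 := by
    intro h0
    obtain ⟨x, hx0, hx⟩ := Matrix.exists_mulVec_eq_zero_iff.2 h0
    refine hx0 (hinj x ?_)
    have h1 := Matrix.dotProduct_mulVec x A'ᵀ (A' *ᵥ x)
    rw [Matrix.mulVec_mulVec, hx, dotProduct_zero, Matrix.vecMul_transpose] at h1
    exact dotProduct_self_eq_zero.1 h1.symm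
  have hpos : ((A'ᵀ * A').map (fun x => (x : ℝ))).PosDef := by
    have h1 : (A'ᵀ * A').map (fun x => (x : ℝ))
        = (A'.map (fun x => (x : ℝ)))ᴴ * A'.map (fun x => (x : ℝ)) := by
      ext i j
      simp [Matrix.mul_apply]
    rw [h1, (Matrix.posSemidef_conjTranspose_mul_self _).posDef_iff_isUnit, ← h1,
      Matrix.isUnit_iff_isUnit_det, isUnit_iff_ne_zero]
    have h2 := Int.cast_det (R := ℝ) (A'ᵀ * A')
    rw [← h2]
    exact Int.cast_ne_zero.2 hdet
  obtain ⟨C, hC⟩ := hg _ (by simp [Matrix.IsSymm, Matrix.transpose_mul]) hpos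
    ⟨Fintype.card (ι ⊕ Fin n) + 1, Nat.succ_pos _,
      repBySquares_transpose_mul_self A' (Nat.le_succ _)⟩
  refine ⟨C * P, ?_⟩
  have h1 : A' * P = Matrix.fromRows A 0 := by
    rw [hA', Matrix.fromRows_mul, hAP, Matrix.sub_mul, hPP, Matrix.one_mul, sub_self]
  calc Aᵀ * A = (A' * P)ᵀ * (A' * P) := by
        rw [h1, Matrix.transpose_fromRows, Matrix.fromCols_mul_fromRows]
        simp
    _ = Pᵀ * (A'ᵀ * A') * P := by simp only [Matrix.transpose_mul, Matrix.mul_assoc]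
    _ = (C * P)ᵀ * (C * P) := by
        rw [hC]
        simp only [Matrix.transpose_mul, Matrix.mul_assoc]

/-- A form in `n + 1` variables with a small nonzero value splits off few squares, leaving a form
in `n` variables. -/
theorem RepBySquares.of_exists_small_value {n g G : ℕ}
    (hg : ∀ M : Matrix (Fin n) (Fin n) ℤ, M.IsSymm → (M.map (fun x => (x : ℝ))).PosDef →
      (∃ r : ℕ, 0 < r ∧ RepBySquares n r M) → RepBySquares n g M)
    {M : Matrix (Fin (n + 1)) (Fin (n + 1)) ℤ} {r : ℕ} (hM : RepBySquares (n + 1) r M)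
    {v : Fin (n + 1) → ℤ} (hv : v ≠ 0) (hvG : v ⬝ᵥ M *ᵥ v ≤ G) :
    RepBySquares (n + 1) (g + G) M := by
  obtain ⟨A, rfl⟩ := hM
  obtain ⟨T, T', hT, a, ha, hva⟩ := exists_unimodular_of_ne_zero v hv
  set A' := A * T with hA'
  have hA'A' : Tᵀ * (Aᵀ * A) * T = A'ᵀ * A' := by
    simp only [hA', Matrix.transpose_mul, Matrix.mul_assoc]
  refine .of_congr hT ?_
  rw [hA'A']
  have hAv : ∀ k, (A *ᵥ v) k = a * A' k 0 := fun k => by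
    rw [hva, hA', Matrix.mul_apply, Finset.mul_sum]
    simp only [Matrix.mulVec, dotProduct, mul_left_comm]
  have hcard : Fintype.card {k // A' k 0 ≠ 0} ≤ G := by
    have h1 : v ⬝ᵥ (Aᵀ * A) *ᵥ v = ∑ k, (A *ᵥ v) k ^ 2 := by
      rw [← Matrix.mulVec_mulVec, Matrix.dotProduct_mulVec, Matrix.vecMul_transpose]
      exact Finset.sum_congr rfl fun k _ => (sq _).symm
    have h2 : ((Fintype.card {k // A' k 0 ≠ 0} : ℕ) : ℤ) ≤ ∑ k, (A *ᵥ v) k ^ 2 := by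
      rw [Fintype.card_subtype, Finset.card_filter]
      push_cast
      refine Finset.sum_le_sum fun k _ => ?_
      split_ifs with hk
      · have h3 : 0 < (A *ᵥ v) k ^ 2 := by
          rw [hAv]
          positivity
        omega
      · positivity
    rw [h1] at hvG
    exact_mod_cast h2.trans hvG
  let B : Matrix {k // A' k 0 ≠ 0} (Fin (n + 1)) ℤ := A'.submatrix Subtype.val id
  let A'' : Matrix {k // ¬ A' k 0 ≠ 0} (Fin n) ℤ := A'.submatrix Subtype.val Fin.succ
  obtain ⟨Z, hZ⟩ := repBySquares_transpose_mul_self_of_forall_posDef hg A''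
  let Z' : Matrix (Fin g) (Fin (n + 1)) ℤ := Matrix.of fun i => Fin.cons 0 (Z i)
  have hsplit : A'ᵀ * A' = (Matrix.fromRows Z' B)ᵀ * Matrix.fromRows Z' B := by
    rw [Matrix.transpose_fromRows, Matrix.fromCols_mul_fromRows]
    ext i j
    rw [Matrix.add_apply, Matrix.mul_apply,
      ← Fintype.sum_subtype_add_sum_subtype (fun k => A' k 0 ≠ 0), add_comm]
    congr 1
    have h0 : ∀ k : {k // ¬ A' k 0 ≠ 0}, A' k 0 = 0 := fun k => not_not.1 k.2
    cases i using Fin.cases with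
    | zero => simp [Matrix.mul_apply, Z', h0]
    | succ i =>
      cases j using Fin.cases with
      | zero => simp [Matrix.mul_apply, Z', h0]
      | succ j => simpa [Matrix.mul_apply, Z', A''] using congrFun₂ hZ i j
  rw [hsplit]
  refine repBySquares_transpose_mul_self _ ?_
  rw [Fintype.card_sum, Fintype.card_fin]
  omega

theorem two_pow_clog_sq_le_exp (n : ℕ) :
    (2 : ℝ) ^ (Nat.clog 2 n ^ 2) ≤ Real.exp (4 * (1 + Real.log n) ^ 2) := by
  have hL : 0 ≤ Real.log n := Real.log_natCast_nonneg n
  have h2 : (1 / 2 : ℝ) < Real.log 2 := by linarith [Real.log_two_gt_d9]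
  have h2' : Real.log 2 < 1 := by linarith [Real.log_two_lt_d9]
  have hk : Nat.clog 2 n * Real.log 2 ≤ 1 + Real.log n := by
    rcases le_or_gt n 1 with hn | hn
    · rw [Nat.clog_of_right_le_one hn]
      push_cast
      linarith
    · have h1 := Real.log_le_log (by positivity)
        (Nat.cast_le (α := ℝ).2 (Nat.pow_pred_clog_lt_self one_lt_two hn).le)
      have h3 : 0 < Nat.clog 2 n := Nat.clog_pos one_lt_two hn
      have h4 : ((Nat.clog 2 n).pred : ℝ) = Nat.clog 2 n - 1 := by
        rw [Nat.pred_eq_sub_one, Nat.cast_pred h3]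
      push_cast at h1
      rw [Real.log_pow, h4] at h1
      linarith
  rw [← Real.exp_log (show (0 : ℝ) < 2 ^ (Nat.clog 2 n ^ 2) by positivity), Real.log_pow]
  refine Real.exp_le_exp.2 ?_
  push_cast
  have h5 : (0 : ℝ) ≤ Nat.clog 2 n * Real.log 2 := by positivity
  have h6 : (Nat.clog 2 n * Real.log 2) ^ 2 ≤ (1 + Real.log n) ^ 2 := pow_le_pow_left₀ h5 hk 2
  have h7 : (0 : ℝ) ≤ (Nat.clog 2 n : ℝ) ^ 2 * Real.log 2 := by positivity
  nlinarith

/-- A form with large minimum is a sum of `4 * n ^ 2 + n` squares. -/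
theorem repBySquares_of_large_minimum {n : ℕ} {M : Matrix (Fin n) (Fin n) ℤ} (hM : M.IsSymm)
    (hmin : ∀ x, x ≠ 0 →
      81 * Real.exp (152 * (1 + Real.log n) ^ 2) ≤ ((x ⬝ᵥ M *ᵥ x : ℤ) : ℝ)) :
    RepBySquares n (4 * n ^ 2 + n) M := by
  set lam : ℝ := (1 + Real.log n) ^ 2 with hlam
  have hlam0 : 0 ≤ lam := sq_nonneg _
  have hpow : ∀ k : ℕ, Real.exp (4 * lam) ^ k = Real.exp (4 * k * lam) := fun k => by
    rw [← Real.exp_nat_mul]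
    congr 1
    ring
  have hnK : (n : ℝ) ≤ Real.exp (4 * lam) := by
    rcases Nat.eq_zero_or_pos n with rfl | hn
    · simpa using (Real.exp_pos _).le
    · rw [← Real.exp_log (Nat.cast_pos (α := ℝ).2 hn)]
      refine Real.exp_le_exp.2 ?_
      rw [hlam]
      nlinarith [Real.log_natCast_nonneg n]
  have hK1 : 1 ≤ Real.exp (4 * lam) := Real.one_le_exp (by positivity)
  obtain ⟨T, T', hT, U, hU, h, hh, hdecomp, hblock⟩ := exists_hkz_reduction n M hM fun x hx => by
    have := lt_of_lt_of_le (by positivity) (hmin x hx)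
    exact_mod_cast this
  have hratio : ∀ i j : ℕ, i ≤ j → j < n → h i ≤ Real.exp lam * h j := fun i j hij hj =>
    le_exp_mul_of_block_le hh hblock hij hj
  obtain ⟨T₂, hT₂, V, hV, hVU, hUK, hVK⟩ :=
    exists_seysen_reduction (Nat.clog 2 n) n (Nat.le_pow_clog one_lt_two n) U hU
  have hT₂inv : T₂ * T₂⁻¹ = 1 := Matrix.mul_nonsing_inv _ (by simp [hT₂.det_eq_one])
  refine .of_congr hT (.of_congr hT₂inv ?_)
  set N := T₂ᵀ * (Tᵀ * M * T) * T₂ with hN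
  have hNs : N.IsSymm := by
    simp only [hN, Matrix.IsSymm, Matrix.transpose_mul, Matrix.transpose_transpose, hM.eq,
      Matrix.mul_assoc]
  have hh0 : ∀ hn : 0 < n, 81 * Real.exp (152 * lam) ≤ h 0 := by
    intro hn
    set e : Fin n → ℤ := Pi.single ⟨0, hn⟩ 1 with he
    have h1 := hmin (T *ᵥ e) (mulVec_ne_zero_of_mul_eq_one hT (by simp [he]))
    rw [← dotProduct_mulVec_congr, intCast_dotProduct_mulVec hdecomp] at h1
    have h2 : ∀ i : Fin n, (U *ᵥ fun j => (e j : ℝ)) i = U i ⟨0, hn⟩ := fun i => by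
      simp [Matrix.mulVec, dotProduct, he, Pi.single_apply]
    rw [Finset.sum_eq_single ⟨0, hn⟩ (fun i _ hi => by
      rw [h2, hU.2 i _ (Fin.lt_def.2 (Nat.pos_of_ne_zero fun h0 => hi (Fin.ext h0)))]
      simp) (by simp), h2, hU.1] at h1
    simpa using h1
  obtain ⟨B, hB⟩ := exists_sub_transpose_mul_self_diagonallyDominant N hnK hK1
    (fun i => √(h i)) (U * T₂.map (fun x => (x : ℝ))) V
    (hU.mul hT₂.map_intCast).2 hV.2 hVU
    (fun i j => (hUK i j).trans (two_pow_clog_sq_le_exp n))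
    (fun i j => (hVK i j).trans (two_pow_clog_sq_le_exp n))
    (fun i => by
      refine Real.le_sqrt_of_sq_le ?_
      have h1 := hh0 (Nat.zero_lt_of_lt i.2)
      have h2 := hratio 0 i (Nat.zero_le _) i.2
      have h3 : Real.exp lam * (9 * Real.exp (4 * lam) ^ 18) ^ 2
          ≤ 81 * Real.exp (152 * lam) := by
        rw [mul_pow, ← pow_mul, hpow, mul_left_comm, ← Real.exp_add]
        norm_num
        nlinarith
      exact le_of_mul_le_mul_left (h3.trans (h1.trans h2)) (Real.exp_pos _))
    (fun k i hki => by
      rw [← Real.sqrt_sq (Real.exp_pos (4 * lam)).le, ← Real.sqrt_mul (sq_nonneg _)]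
      refine Real.sqrt_le_sqrt ((hratio k i hki i.2).trans ?_)
      rw [hpow]
      refine mul_le_mul_of_nonneg_right (Real.exp_le_exp.2 ?_) (hh i).le
      push_cast
      linarith)
    (by
      have h1 : N.map (fun x => (x : ℝ)) = (T₂.map (fun x => (x : ℝ)))ᵀ
          * (Tᵀ * M * T).map (fun x => (x : ℝ)) * T₂.map (fun x => (x : ℝ)) := by
        ext i j
        simp [hN, Matrix.mul_apply]
      rw [h1, hdecomp]
      simp only [Real.sq_sqrt (hh _).le, Matrix.transpose_mul, Matrix.mul_assoc])
  obtain ⟨C, hC⟩ := exists_eq_transpose_mul_self_of_diagonallyDominant (N - Bᵀ * B)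
    (by rw [Matrix.IsSymm, Matrix.transpose_sub, hNs.eq, Matrix.transpose_mul,
      Matrix.transpose_transpose]) hB
  have hNBC : N = (Matrix.fromRows B C)ᵀ * Matrix.fromRows B C := by
    rw [Matrix.transpose_fromRows, Matrix.fromCols_mul_fromRows, ← hC, add_sub_cancel]
  rw [hNBC]
  refine repBySquares_transpose_mul_self _ (le_of_eq ?_)
  simp
  ring

theorem one_add_log_natCast_sq_le {n : ℕ} (hn : 0 < n) :
    152 * (1 + Real.log n) ^ 2 ≤ √n + 4864 ^ 2 := by
  have hnR : (0 : ℝ) < n := by exact_mod_cast hn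
  set t : ℝ := √(√(√n)) with ht
  have ht0 : 0 < t := by positivity
  have hlog : Real.log n = 8 * Real.log t := by
    rw [ht, Real.log_sqrt (by positivity), Real.log_sqrt (by positivity),
      Real.log_sqrt hnR.le]
    ring
  have ht4 : √n = (t ^ 2) ^ 2 := by
    rw [ht, Real.sq_sqrt (by positivity), Real.sq_sqrt (by positivity)]
  have h1 : 1 + Real.log n ≤ 8 * t := by linarith [Real.log_le_sub_one_of_pos ht0]
  have h2 : (1 + Real.log n) ^ 2 ≤ (8 * t) ^ 2 :=
    pow_le_pow_left₀ (by linarith [Real.log_natCast_nonneg n]) h1 2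
  rw [ht4]
  nlinarith [sq_nonneg (t ^ 2 - 4864)]

theorem large_minimum_bound_le {n : ℕ} (hn : 0 < n) :
    81 * Real.exp (152 * (1 + Real.log n) ^ 2) ≤
      81 * Real.exp (4864 ^ 2) * (n : ℝ) ^ 10 *
        Real.exp ((4 + 2 * √2) * √n + 2 * Real.log n ^ 2) := by
  have h1 : Real.exp (152 * (1 + Real.log n) ^ 2) ≤
      Real.exp (4864 ^ 2) * Real.exp ((4 + 2 * √2) * √n + 2 * Real.log n ^ 2) := by
    rw [← Real.exp_add]
    refine Real.exp_le_exp.2 ((one_add_log_natCast_sq_le hn).trans ?_)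
    nlinarith [Real.sqrt_nonneg n, mul_nonneg (Real.sqrt_nonneg 2) (Real.sqrt_nonneg n),
      sq_nonneg (Real.log n)]
  have h2 : (1 : ℝ) ≤ (n : ℝ) ^ 10 := one_le_pow₀ (by exact_mod_cast hn)
  calc _ ≤ 81 * (Real.exp (4864 ^ 2) * Real.exp ((4 + 2 * √2) * √n + 2 * Real.log n ^ 2)) * 1 := by
        linarith
    _ ≤ 81 * (Real.exp (4864 ^ 2) * Real.exp ((4 + 2 * √2) * √n + 2 * Real.log n ^ 2))
          * (n : ℝ) ^ 10 := by gcongr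
    _ = _ := by ring

/-- There is a constant `D₃ > 0` such that, with
`G(n) = D₃·n^{10}·e^{(4+2√2)√n + 2(ln n)²}`, for every `n ≥ 2` and every positive integer `g`:
if every `(n−1)`-variable positive definite integral quadratic form represented by some `I_r`
is represented by `I_g`, then every `n`-variable positive definite integral quadratic form
represented by some `I_r` is represented by `I_m` with `m = max(g + ⌊G(n)⌋, 4n² + n)`;
i.e. `g_ℤ(n) ≤ max{g_ℤ(n−1) + G(n), 4n² + n}`. -/
theorem gZ_recursive_bound :
    ∃ D₃ : ℝ, 0 < D₃ ∧ ∀ n : ℕ, 2 ≤ n → ∀ g : ℕ, 0 < g →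
      (∀ M' : Matrix (Fin (n - 1)) (Fin (n - 1)) ℤ, M'.IsSymm →
        (M'.map (fun x => (x : ℝ))).PosDef →
        (∃ r : ℕ, 0 < r ∧ RepBySquares (n - 1) r M') →
        RepBySquares (n - 1) g M') →
      ∀ M : Matrix (Fin n) (Fin n) ℤ, M.IsSymm →
        (M.map (fun x => (x : ℝ))).PosDef →
        (∃ r : ℕ, 0 < r ∧ RepBySquares n r M) →
        RepBySquares n
          (max (g + ⌊D₃ * (n : ℝ) ^ 10 *
              Real.exp ((4 + 2 * Real.sqrt 2) * Real.sqrt n + 2 * (Real.log n) ^ 2)⌋₊)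
            (4 * n ^ 2 + n)) M := by
  refine ⟨81 * Real.exp (4864 ^ 2), by positivity, fun n hn g _ hg M hM _ hrep => ?_⟩
  obtain ⟨n, rfl⟩ : ∃ k, n = k + 1 := ⟨n - 1, by omega⟩
  obtain ⟨r, -, hr⟩ := hrep
  have hbound := large_minimum_bound_le (Nat.succ_pos n)
  set G : ℝ := 81 * Real.exp (4864 ^ 2) * ((n + 1 : ℕ) : ℝ) ^ 10 *
    Real.exp ((4 + 2 * √2) * √((n + 1 : ℕ) : ℝ) + 2 * Real.log ((n + 1 : ℕ) : ℝ) ^ 2) with hG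
  by_cases hsmall : ∃ v : Fin (n + 1) → ℤ, v ≠ 0 ∧ v ⬝ᵥ M *ᵥ v ≤ (⌊G⌋₊ : ℤ)
  · obtain ⟨v, hv, hvG⟩ := hsmall
    exact (hr.of_exists_small_value hg hv hvG).mono (le_max_left _ _)
  · push Not at hsmall
    refine (repBySquares_of_large_minimum hM fun x hx => hbound.trans ?_).mono (le_max_right _ _)
    have h1 : ((⌊G⌋₊ + 1 : ℤ) : ℝ) ≤ ((x ⬝ᵥ M *ᵥ x : ℤ) : ℝ) := Int.cast_le.2 (hsmall x hx)
    push_cast at h1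
    exact (Nat.lt_floor_add_one G).le.trans h1
end

section
/- For every ε ∈ (0,1) there exists s₀ such that for every integer s ≥ s₀ the following holds: if M is an n-variable positive definite integral quadratic form such that the form s·M is NOT represented by I_r for any positive integer r, then n ≥ (1−ε)·(ln s/(4+2√2))². (Equivalently, φ(s) ≥ (ln s/((4+4√2)√(1/2)))²·(1+o(1)), where φ(s) is the smallest n for which there exists an n-variable positive definite integral quadratic form f such that s·f is not a sum of squares of integral linear forms.) -/
open scoped Matrix

/-- The block matrix with first row `(1, u)`, first column `(1, 0)` and lower right block `U`. -/
def triCons {R : Type*} [Zero R] [One R] {n : ℕ} (u : Fin n → R) (U : Matrix (Fin n) (Fin n) R) :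
    Matrix (Fin (n + 1)) (Fin (n + 1)) R :=
  Matrix.of (Fin.cons (Fin.cons 1 u) fun i => Fin.cons 0 (U i))

lemma triCons_mulVec {R : Type*} [CommRing R] {n : ℕ} (u : Fin n → R)
    (U : Matrix (Fin n) (Fin n) R) (x : Fin (n + 1) → R) :
    triCons u U *ᵥ x = Fin.cons (x 0 + u ⬝ᵥ Fin.tail x) (U *ᵥ Fin.tail x) := by
  ext i
  refine Fin.cases ?_ (fun i => ?_) i <;>
    simp [triCons, Matrix.mulVec, dotProduct, Fin.sum_univ_succ, Fin.tail]

lemma det_triCons {R : Type*} [CommRing R] {n : ℕ} (u : Fin n → R)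
    (U : Matrix (Fin n) (Fin n) R) : (triCons u U).det = U.det := by
  rw [Matrix.det_succ_column_zero, Fin.sum_univ_succ]
  have h : (triCons u U).submatrix (Fin.succAbove 0) Fin.succ = U := by
    ext i j
    simp [triCons]
  rw [h]
  simp [triCons]

lemma triCons_map {n : ℕ} (u : Fin n → ℤ) (U : Matrix (Fin n) (Fin n) ℤ) :
    (triCons u U).map (fun x => (x : ℝ)) =
      triCons (fun i => (u i : ℝ)) (U.map (fun x => (x : ℝ))) := by
  ext i j
  refine Fin.cases ?_ (fun i => ?_) i <;> refine Fin.cases ?_ (fun j => ?_) j <;> simp [triCons]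

/-- The quadratic form `∑ h i * (N x)_i ^ 2`. -/
def diagForm {n : ℕ} (h : ℕ → ℝ) (N : Matrix (Fin n) (Fin n) ℝ) (x : Fin n → ℝ) : ℝ :=
  ∑ i : Fin n, h i * (N *ᵥ x) i ^ 2

lemma diagForm_triCons {n : ℕ} (h : ℕ → ℝ) (ν : Fin n → ℝ) (N : Matrix (Fin n) (Fin n) ℝ)
    (x : Fin (n + 1) → ℝ) :
    diagForm h (triCons ν N) x =
      h 0 * (x 0 + ν ⬝ᵥ Fin.tail x) ^ 2 + diagForm (fun i => h (i + 1)) N (Fin.tail x) := by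
  simp [diagForm, triCons_mulVec, Fin.sum_univ_succ]

/-- `Reduced n h N` says that the form `diagForm h N` is reduced: `N` is upper unitriangular, the
first basis vector of every projected lattice is a shortest nonzero vector, and the basis is
size-reduced in the dual sense. -/
inductive Reduced : (n : ℕ) → (ℕ → ℝ) → Matrix (Fin n) (Fin n) ℝ → Prop
  | nil (h : ℕ → ℝ) (N : Matrix (Fin 0) (Fin 0) ℝ) : Reduced 0 h N
  | cons {n : ℕ} (h : ℕ → ℝ) (ν : Fin n → ℝ) (N : Matrix (Fin n) (Fin n) ℝ)
      (tail : Reduced n (fun i => h (i + 1)) N) (pos : 0 < h 0)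
      (min : ∀ z : Fin (n + 1) → ℤ, z ≠ 0 → h 0 ≤ diagForm h (triCons ν N) (fun i => (z i : ℝ)))
      (size : ∀ x : Fin n → ℝ, |ν ⬝ᵥ x| ≤ (∑ i, |(N *ᵥ x) i|) / 2) :
      Reduced (n + 1) h (triCons ν N)

/-- Babai rounding with respect to a reduced system of coordinates. -/
lemma Reduced.exists_round {n : ℕ} {h : ℕ → ℝ} {N : Matrix (Fin n) (Fin n) ℝ}
    (hN : Reduced n h N) (ν : Fin n → ℝ) :
    ∃ u : Fin n → ℤ, ∀ x : Fin n → ℝ,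
      |(fun i => ν i + u i) ⬝ᵥ x| ≤ (∑ i, |(N *ᵥ x) i|) / 2 := by
  induction hN with
  | nil h N => exact ⟨0, fun x => by simp⟩
  | @cons n h μ N tail pos min size ih =>
    set w : ℝ := ν 0 - round (ν 0) with hw
    obtain ⟨u, hu⟩ := ih (fun i => Fin.tail ν i - w * μ i)
    refine ⟨Fin.cons (-round (ν 0)) u, fun x => ?_⟩
    have h1 : (fun i => ν i + ((Fin.cons (-round (ν 0)) u : Fin (n + 1) → ℤ) i : ℝ)) ⬝ᵥ x =
        w * (x 0 + μ ⬝ᵥ Fin.tail x) +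
          (fun i => (Fin.tail ν i - w * μ i) + u i) ⬝ᵥ Fin.tail x := by
      have h3 : (fun i => ν i.succ + (u i : ℝ)) ⬝ᵥ Fin.tail x = w * (μ ⬝ᵥ Fin.tail x) +
          (fun i => (Fin.tail ν i - w * μ i) + u i) ⬝ᵥ Fin.tail x := by
        simp only [dotProduct]
        rw [Finset.mul_sum, ← Finset.sum_add_distrib]
        exact Finset.sum_congr rfl fun i _ => by simp only [Fin.tail]; ring
      have h4 : (fun i => ν i + ((Fin.cons (-round (ν 0)) u : Fin (n + 1) → ℤ) i : ℝ)) ⬝ᵥ x =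
          w * x 0 + (fun i => ν i.succ + (u i : ℝ)) ⬝ᵥ Fin.tail x := by
        simp [dotProduct, Fin.sum_univ_succ, Fin.tail, hw, sub_eq_add_neg]
      rw [h4, h3]
      ring
    have h2 : |w| ≤ 1 / 2 := abs_sub_round _
    rw [h1, triCons_mulVec, Fin.sum_univ_succ]
    simp only [Fin.cons_zero, Fin.cons_succ]
    refine (abs_add_le _ _).trans ?_
    rw [abs_mul]
    have := mul_le_mul_of_nonneg_right h2 (abs_nonneg (x 0 + μ ⬝ᵥ Fin.tail x))
    linarith [hu (Fin.tail x)]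

lemma Reduced.abs_le {n : ℕ} {h : ℕ → ℝ} {N : Matrix (Fin n) (Fin n) ℝ} (hN : Reduced n h N)
    (x : Fin n → ℝ) (j : Fin n) : |x j| ≤ ∑ i, |(N *ᵥ x) i| := by
  induction hN with
  | nil h N => exact j.elim0
  | @cons n h μ N tail pos min size ih =>
    rw [triCons_mulVec, Fin.sum_univ_succ]
    simp only [Fin.cons_zero, Fin.cons_succ]
    have h0 : 0 ≤ ∑ i, |(N *ᵥ Fin.tail x) i| := Finset.sum_nonneg fun i _ => abs_nonneg _
    refine Fin.cases ?_ (fun j => ?_) j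
    · have h1 := abs_sub (x 0 + μ ⬝ᵥ Fin.tail x) (μ ⬝ᵥ Fin.tail x)
      rw [add_sub_cancel_right] at h1
      linarith [size (Fin.tail x)]
    · have := ih (Fin.tail x) j
      exact this.trans (le_add_of_nonneg_left (abs_nonneg _))

lemma Reduced.pos {n : ℕ} {h : ℕ → ℝ} {N : Matrix (Fin n) (Fin n) ℝ} (hN : Reduced n h N)
    (k : ℕ) (hk : k < n) : 0 < h k := by
  induction hN generalizing k with
  | nil h N => omega
  | cons h μ N tail pos min size ih =>
    cases k with
    | zero => exact pos
    | succ k => exact ih k (by omega)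

/-- Minkowski's theorem for a box: a unimodular diagonalised form takes a small value. -/
lemma exists_int_sum_sq_le {ι : Type*} [Fintype ι] [DecidableEq ι] [Nonempty ι]
    (N : Matrix ι ι ℝ) (hN : N.det = 1) (h : ι → ℝ) (hpos : ∀ i, 0 < h i) :
    ∃ z : ι → ℤ, z ≠ 0 ∧ ∑ i, h i * (N *ᵥ fun j => (z j : ℝ)) i ^ 2 ≤
      Fintype.card ι * (∏ i, h i) ^ ((Fintype.card ι : ℝ)⁻¹) := by
  classical
  set G : ℝ := (∏ i, h i) ^ ((Fintype.card ι : ℝ)⁻¹) with hG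
  have hP : 0 < ∏ i, h i := Finset.prod_pos fun i _ => hpos i
  have hG0 : 0 < G := Real.rpow_pos_of_pos hP _
  have hGpow : G ^ Fintype.card ι = ∏ i, h i :=
    Real.rpow_inv_natCast_pow hP.le Fintype.card_ne_zero
  set R : ι → ℝ := fun i => √(G / h i) with hR
  have hR0 : ∀ i, 0 ≤ R i := fun i => Real.sqrt_nonneg _
  have hR2 : ∀ i, h i * R i ^ 2 = G := fun i => by
    rw [hR, Real.sq_sqrt (div_pos hG0 (hpos i)).le]
    field_simp [(hpos i).ne']
  have hRprod : ∏ i, R i = 1 := by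
    have h1 : (∏ i, R i) ^ 2 = 1 := by
      have h2 : (∏ i, h i) * (∏ i, R i) ^ 2 = ∏ i, h i := by
        rw [← Finset.prod_pow, ← Finset.prod_mul_distrib, Finset.prod_congr rfl fun i _ => hR2 i,
          Finset.prod_const, Finset.card_univ, hGpow]
      exact mul_left_cancel₀ hP.ne' (by rw [h2, mul_one])
    exact (pow_eq_one_iff_of_nonneg (Finset.prod_nonneg fun i _ => hR0 i) two_ne_zero).1 h1
  set s : Set (ι → ℝ) := Matrix.toLin' N⁻¹ '' Set.Icc (-R) R with hs
  have hvol : MeasureTheory.volume s = 2 ^ Module.finrank ℝ (ι → ℝ) := by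
    rw [hs, MeasureTheory.Measure.addHaar_image_linearMap, LinearMap.det_toLin',
      Matrix.det_nonsing_inv, hN, Real.volume_Icc_pi]
    have h3 : ∀ i, R i - (-R) i = 2 * R i := fun i => by simp only [Pi.neg_apply]; ring
    simp only [h3]
    rw [← ENNReal.ofReal_prod_of_nonneg fun i _ => mul_nonneg zero_le_two (hR0 i),
      Finset.prod_mul_distrib, hRprod]
    simp
  have : DiscreteTopology (Submodule.span ℤ (Set.range (Pi.basisFun ℝ ι))).toAddSubgroup :=
    ZSpan.discreteTopology_pi_basisFun
  have : Countable (Submodule.span ℤ (Set.range (Pi.basisFun ℝ ι))).toAddSubgroup :=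
    countable_of_Lindelof_of_discrete
  obtain ⟨⟨x, hxL⟩, hx0, hxs⟩ :=
    MeasureTheory.exists_ne_zero_mem_lattice_of_measure_mul_two_pow_le_measure
      (L := (Submodule.span ℤ (Set.range (Pi.basisFun ℝ ι))).toAddSubgroup) (s := s)
      (ZSpan.isAddFundamentalDomain' (Pi.basisFun ℝ ι) MeasureTheory.volume)
      (by
        rintro _ ⟨y, hy, rfl⟩
        refine ⟨-y, ?_, map_neg _ _⟩
        rw [Set.mem_Icc] at hy ⊢
        exact ⟨neg_le_neg hy.2, by simpa using neg_le_neg hy.1⟩)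
      ((convex_Icc _ _).linear_image _)
      (isCompact_Icc.image (LinearMap.continuous_of_finiteDimensional _))
      (by
        rw [hvol, ZSpan.fundamentalDomain_pi_basisFun, MeasureTheory.volume_pi_pi]
        simp)
  have hz : ∀ i, ∃ c : ℤ, (c : ℝ) = x i := fun i => by
    simpa using ((Pi.basisFun ℝ ι).mem_span_iff_repr_mem ℤ x).1 hxL i
  choose z hz using hz
  have hzx : (fun j => (z j : ℝ)) = x := funext hz
  refine ⟨z, ?_, ?_⟩
  · rintro rfl
    apply hx0
    ext i
    simp [← hz i]
  · obtain ⟨y, hy, hyx⟩ := hxs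
    have hNx : N *ᵥ x = y := by
      rw [← show Matrix.toLin' N⁻¹ y = x from hyx, Matrix.toLin'_apply, Matrix.mulVec_mulVec,
        Matrix.mul_nonsing_inv _ (by simp [hN]), Matrix.one_mulVec]
    rw [hzx, hNx]
    calc ∑ i, h i * y i ^ 2 ≤ ∑ _i : ι, G := by
          refine Finset.sum_le_sum fun i _ => ?_
          rw [← hR2 i]
          exact mul_le_mul_of_nonneg_left (sq_le_sq' (hy.1 i) (hy.2 i)) (hpos i).le
      _ = _ := by simp

lemma Reduced.apply_of_lt {n : ℕ} {h : ℕ → ℝ} {N : Matrix (Fin n) (Fin n) ℝ} (hN : Reduced n h N)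
    {i j : Fin n} (hij : j < i) : N i j = 0 := by
  induction hN with
  | nil h N => exact i.elim0
  | cons h μ N tail pos min size ih =>
    revert hij
    refine Fin.cases (fun hij => ?_) (fun i => ?_) i
    · exact absurd hij (Fin.not_lt_zero _)
    · refine Fin.cases (fun _ => ?_) (fun j hij => ?_) j
      · simp [triCons]
      · simpa [triCons] using ih (Fin.succ_lt_succ_iff.1 hij)

lemma Reduced.apply_self {n : ℕ} {h : ℕ → ℝ} {N : Matrix (Fin n) (Fin n) ℝ} (hN : Reduced n h N)
    (i : Fin n) : N i i = 1 := by
  induction hN with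
  | nil h N => exact i.elim0
  | cons h μ N tail pos min size ih =>
    refine Fin.cases ?_ (fun i => ?_) i
    · simp [triCons]
    · simpa [triCons] using ih i

lemma Fin.sum_eq_sum_castLE {n a : ℕ} (ha : a ≤ n) (f : Fin n → ℝ)
    (hf : ∀ j : Fin n, a ≤ j → f j = 0) : ∑ j, f j = ∑ j, f (Fin.castLE ha j) := by
  obtain ⟨p, rfl⟩ := Nat.exists_eq_add_of_le ha
  rw [Fin.sum_univ_add, Finset.sum_eq_zero (s := Finset.univ) (f := fun i => f (Fin.natAdd a i))
    fun i _ => hf _ (by simp), add_zero]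
  rfl

lemma Reduced.log_head_le {n : ℕ} {h : ℕ → ℝ} {N : Matrix (Fin n) (Fin n) ℝ}
    (hN : Reduced n h N) (m : ℕ) (hm : m < n) :
    (m + 1) * Real.log (h 0) ≤
      (m + 1) * Real.log (m + 1) + ∑ i ∈ Finset.range (m + 1), Real.log (h i) := by
  have hm' : m + 1 ≤ n := hm
  set N' := N.submatrix (Fin.castLE hm') (Fin.castLE hm') with hN'
  have hdet : N'.det = 1 := by
    rw [Matrix.det_of_isUpperTriangular]
    · simp [hN', hN.apply_self]
    · intro i j hij
      exact hN.apply_of_lt (by simpa using hij)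
  have hpos : ∀ i : Fin (m + 1), 0 < h i := fun i => hN.pos _ (by omega)
  obtain ⟨z, hz0, hz⟩ := exists_int_sum_sq_le N' hdet (fun i => h i) hpos
  set Z : Fin n → ℤ := fun i => if hi : i.1 < m + 1 then z ⟨i, hi⟩ else 0 with hZ
  have hZz : ∀ i, Z (Fin.castLE hm' i) = z i := fun i => by simp only [hZ, Fin.val_castLE, Fin.is_lt, dite_true]
  have hZ1 : ∀ j : Fin n, m + 1 ≤ j → Z j = 0 := fun j hj => by simp [hZ]; omega
  have hmul : ∀ i, (N *ᵥ fun j => (Z j : ℝ)) i = ∑ j, N i (Fin.castLE hm' j) * z j := fun i => by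
    rw [Matrix.mulVec, dotProduct, Fin.sum_eq_sum_castLE hm' _ fun j hj => by simp [hZ1 j hj]]
    simp [hZz]
  have hform : diagForm h N (fun j => (Z j : ℝ)) =
      ∑ i : Fin (m + 1), h i * (N' *ᵥ fun j => (z j : ℝ)) i ^ 2 := by
    rw [diagForm, Fin.sum_eq_sum_castLE hm']
    · refine Finset.sum_congr rfl fun i _ => ?_
      rw [hmul]
      rfl
    · intro i hi
      rw [hmul, Finset.sum_eq_zero]
      · simp
      · intro j _
        rw [hN.apply_of_lt, zero_mul]
        rw [Fin.lt_def, Fin.val_castLE]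
        omega
  have hZ0 : Z ≠ 0 := by
    intro h0
    apply hz0
    ext i
    rw [← hZz, h0]
    rfl
  have hle : h 0 ≤ diagForm h N (fun j => (Z j : ℝ)) := by
    cases hN with
    | nil => omega
    | cons _ ν N tail pos min size => exact min Z hZ0
  have hP : 0 < ∏ i : Fin (m + 1), h i := Finset.prod_pos fun i _ => hpos i
  rw [hform] at hle
  have h1 := Real.log_le_log (hN.pos 0 (by omega)) (hle.trans hz)
  rw [Fintype.card_fin, Real.log_mul (by positivity) (Real.rpow_pos_of_pos hP _).ne',
    Real.log_rpow hP, Real.log_prod fun i _ => (hpos i).ne',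
    Fin.sum_univ_eq_sum_range (fun i => Real.log (h i))] at h1
  have h2 := mul_le_mul_of_nonneg_left h1 (by positivity : (0 : ℝ) ≤ m + 1)
  refine h2.trans_eq ?_
  push_cast
  field_simp

lemma Reduced.log_le {n : ℕ} {h : ℕ → ℝ} {N : Matrix (Fin n) (Fin n) ℝ}
    (hN : Reduced n h N) (k m : ℕ) (hm : k + m < n) :
    (m + 1) * Real.log (h k) ≤
      (m + 1) * Real.log (m + 1) + ∑ i ∈ Finset.range (m + 1), Real.log (h (k + i)) := by
  induction k generalizing n h with
  | zero => simpa using hN.log_head_le m (by omega)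
  | succ k ih =>
    cases hN with
    | nil => omega
    | cons _ ν N tail pos min size => simpa [add_right_comm] using ih tail (by omega)

lemma sum_range_le_of_averaging {v : ℕ → ℝ} {L : ℝ} {J : ℕ} (hv0 : v 0 ≤ 0)
    (hv : ∀ j ≤ J, (j + 1) * v j ≤ (j + 1) * L + ∑ i ∈ Finset.range (j + 1), v i) (j : ℕ)
    (hj : j ≤ J) : ∑ i ∈ Finset.range (j + 1), v i ≤ (j + 1) * (L * harmonic j) := by
  induction j with
  | zero => simpa using hv0
  | succ p ih =>
    have h1 := ih (by omega)
    have h2 := hv (p + 1) hj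
    rw [Finset.sum_range_succ] at h2 ⊢
    rw [harmonic_succ]
    push_cast at h2 ⊢
    set S := ∑ i ∈ Finset.range (p + 1), v i
    set H : ℝ := (harmonic p : ℝ)
    have hp : (0 : ℝ) < p + 1 := by positivity
    have h3 : (p + 1) * v (p + 1) ≤ (p + 2) * L + (p + 1) * (L * H) := by linarith
    have h4 : (p + 1 : ℝ) * ((p + 1 + 1) * (L * (H + (p + 1 : ℝ)⁻¹))) =
        (p + 1) * ((p + 2) * (L * H)) + (p + 2) * L := by
      field_simp
      ring
    refine le_of_mul_le_mul_left ?_ hp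
    rw [h4]
    nlinarith [mul_le_mul_of_nonneg_left h1 hp.le]

lemma le_of_averaging {v : ℕ → ℝ} {L : ℝ} (hL : 0 ≤ L) {J : ℕ} (hv0 : v 0 ≤ 0)
    (hv : ∀ j ≤ J, (j + 1) * v j ≤ (j + 1) * L + ∑ i ∈ Finset.range (j + 1), v i) (j : ℕ)
    (hj : j ≤ J) : v j ≤ L * (3 + Real.log j) := by
  cases j with
  | zero => simpa using hv0.trans (by positivity)
  | succ p =>
    have h1 := sum_range_le_of_averaging hv0 hv p (by omega)
    have h2 := hv (p + 1) hj
    rw [Finset.sum_range_succ] at h2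
    push_cast at h2 ⊢
    have h3 : (harmonic p : ℝ) ≤ 1 + Real.log p := harmonic_le_one_add_log p
    have h4 : Real.log p ≤ Real.log (p + 1) := by
      rcases Nat.eq_zero_or_pos p with rfl | hp
      · simp
      · exact Real.log_le_log (by positivity) (by linarith)
    have hp : (0 : ℝ) < p + 1 := by positivity
    have h5 : L * harmonic p ≤ L * (1 + Real.log (p + 1)) :=
      mul_le_mul_of_nonneg_left (by linarith) hL
    refine le_of_mul_le_mul_left ?_ hp
    nlinarith [mul_le_mul_of_nonneg_left h5 hp.le, mul_nonneg hp.le hL,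
      mul_nonneg (Nat.cast_nonneg (α := ℝ) p) hL]

/-- The bound on how much the squared Gram–Schmidt lengths of a reduced basis can drop. -/
noncomputable def dropBound (n : ℕ) : ℝ := Real.exp (Real.log n * (3 + Real.log n))

lemma one_le_dropBound (n : ℕ) : 1 ≤ dropBound n :=
  Real.one_le_exp (by have := Real.log_natCast_nonneg n; positivity)

lemma Reduced.le_dropBound_mul {n : ℕ} {h : ℕ → ℝ} {N : Matrix (Fin n) (Fin n) ℝ}
    (hN : Reduced n h N) {k l : ℕ} (hkl : k ≤ l) (hl : l < n) : h k ≤ dropBound n * h l := by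
  have hL : 0 ≤ Real.log n := Real.log_natCast_nonneg n
  have hlog : ∀ j : ℕ, j + 1 ≤ n → Real.log ((j : ℝ) + 1) ≤ Real.log n := fun j hj =>
    Real.log_le_log (by positivity) (by exact_mod_cast hj)
  have key := le_of_averaging (v := fun j => Real.log (h (l - j)) - Real.log (h l)) hL (J := l)
    (by simp) (fun j hj => by
      have h1 := hN.log_le (l - j) j (by omega)
      have h2 : ∑ i ∈ Finset.range (j + 1), Real.log (h (l - j + i)) =
          ∑ i ∈ Finset.range (j + 1), Real.log (h (l - i)) := by
        rw [← Finset.sum_range_reflect]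
        refine Finset.sum_congr rfl fun i hi => ?_
        rw [Finset.mem_range] at hi
        congr 2
        omega
      rw [Finset.sum_sub_distrib, ← h2, Finset.sum_const, Finset.card_range, nsmul_eq_mul]
      push_cast
      have h3 := mul_le_mul_of_nonneg_left (hlog j (by omega)) (by positivity : (0 : ℝ) ≤ j + 1)
      linarith) (l - k) (by omega)
  have h4 : Real.log ((l - k : ℕ) : ℝ) ≤ Real.log n := by
    rcases Nat.eq_zero_or_pos (l - k) with h0 | h0
    · simpa [h0] using hL
    · exact Real.log_le_log (by exact_mod_cast h0) (by exact_mod_cast (by omega : l - k ≤ n))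
  have hk0 := hN.pos k (by omega)
  have hl0 := hN.pos l hl
  rw [dropBound, ← Real.exp_log hk0, ← Real.exp_log hl0, ← Real.exp_add, Real.exp_le_exp]
  simp only [Nat.sub_sub_self hkl] at key
  have h5 := mul_le_mul_of_nonneg_left h4 hL
  linarith

lemma mul_sq_sum_abs_mulVec_le {n : ℕ} {h : ℕ → ℝ} {N : Matrix (Fin n) (Fin n) ℝ} {c q : ℝ}
    (hc : ∀ i < n, c ≤ q * h i) (x : Fin n → ℝ) (hc0 : 0 ≤ c) :
    c * (∑ i, |(N *ᵥ x) i|) ^ 2 ≤ n * q * diagForm h N x := by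
  have h1 : (∑ i, |(N *ᵥ x) i|) ^ 2 ≤ n * ∑ i, (N *ᵥ x) i ^ 2 := by
    simpa using sq_sum_le_card_mul_sum_sq (s := Finset.univ) (f := fun i => |(N *ᵥ x) i|)
  calc c * (∑ i, |(N *ᵥ x) i|) ^ 2 ≤ c * (n * ∑ i, (N *ᵥ x) i ^ 2) :=
        mul_le_mul_of_nonneg_left h1 hc0
    _ = n * ∑ i, c * (N *ᵥ x) i ^ 2 := by rw [← Finset.mul_sum]; ring
    _ ≤ n * ∑ i : Fin n, q * h i * (N *ᵥ x) i ^ 2 := by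
        gcongr with i _
        exact hc i i.2
    _ = _ := by
        rw [diagForm, mul_assoc, Finset.mul_sum (a := q)]
        simp only [mul_assoc]

lemma Reduced.mul_sq_sum_abs_le {n : ℕ} {h : ℕ → ℝ} {N : Matrix (Fin n) (Fin n) ℝ}
    (hN : Reduced n h N) {c q : ℝ} (hc : ∀ i < n, c ≤ q * h i) (x : Fin n → ℝ) (hc0 : 0 ≤ c) :
    c * (∑ i, |x i|) ^ 2 ≤ n ^ 3 * q * diagForm h N x := by
  have h1 : ∑ i, |x i| ≤ n * ∑ i, |(N *ᵥ x) i| := by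
    refine (Finset.sum_le_sum fun i _ => hN.abs_le x i).trans_eq ?_
    simp
  have h2 : (∑ i, |x i|) ^ 2 ≤ (n * ∑ i, |(N *ᵥ x) i|) ^ 2 :=
    pow_le_pow_left₀ (Finset.sum_nonneg fun i _ => abs_nonneg _) h1 2
  calc c * (∑ i, |x i|) ^ 2 ≤ c * (n * ∑ i, |(N *ᵥ x) i|) ^ 2 :=
        mul_le_mul_of_nonneg_left h2 hc0
    _ = n ^ 2 * (c * (∑ i, |(N *ᵥ x) i|) ^ 2) := by ring
    _ ≤ n ^ 2 * (n * q * diagForm h N x) :=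
        mul_le_mul_of_nonneg_left (mul_sq_sum_abs_mulVec_le hc x hc0) (by positivity)
    _ = _ := by ring

/-- The integral quadratic form with Gram matrix `A` is a sum of squares of linear forms. -/
def IsSumSqForm {n : ℕ} (A : Matrix (Fin n) (Fin n) ℤ) : Prop :=
  A ∈ AddSubmonoid.closure (Set.range fun v : Fin n → ℤ => Matrix.vecMulVec v v)

lemma isSumSqForm_vecMulVec {n : ℕ} (v : Fin n → ℤ) : IsSumSqForm (Matrix.vecMulVec v v) :=
  AddSubmonoid.subset_closure ⟨v, rfl⟩

lemma IsSumSqForm.exists_eq_transpose_mul {n : ℕ} {A : Matrix (Fin n) (Fin n) ℤ}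
    (hA : IsSumSqForm A) : ∃ r : ℕ, 0 < r ∧ ∃ B : Matrix (Fin r) (Fin n) ℤ, A = Bᵀ * B := by
  induction hA using AddSubmonoid.closure_induction with
  | mem x hx =>
    obtain ⟨v, rfl⟩ := hx
    refine ⟨1, one_pos, Matrix.of fun _ => v, ?_⟩
    ext i j
    simp [Matrix.mul_apply, Matrix.vecMulVec_apply]
  | zero => exact ⟨1, one_pos, 0, by simp⟩
  | add x y _ _ hx hy =>
    obtain ⟨r, hr, B, rfl⟩ := hx
    obtain ⟨r', _, B', rfl⟩ := hy
    refine ⟨r + r', by omega, Matrix.of (Fin.append (fun k => B k) fun k => B' k), ?_⟩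
    ext i j
    simp [Matrix.mul_apply, Fin.sum_univ_add]

lemma IsSumSqForm.lift {n : ℕ} {A : Matrix (Fin n) (Fin n) ℤ} (hA : IsSumSqForm A) :
    IsSumSqForm (Matrix.of (Fin.cons 0 fun i => Fin.cons 0 (A i)) :
      Matrix (Fin (n + 1)) (Fin (n + 1)) ℤ) := by
  induction hA using AddSubmonoid.closure_induction with
  | mem x hx =>
    obtain ⟨v, rfl⟩ := hx
    convert isSumSqForm_vecMulVec (Fin.cons 0 v : Fin (n + 1) → ℤ) using 1
    ext i j
    refine Fin.cases ?_ (fun i => ?_) i <;> refine Fin.cases ?_ (fun j => ?_) j <;>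
      simp [Matrix.vecMulVec_apply]
  | zero =>
    change _ ∈ AddSubmonoid.closure _
    convert AddSubmonoid.zero_mem _ using 1
    ext i j
    refine Fin.cases ?_ (fun i => ?_) i <;> refine Fin.cases ?_ (fun j => ?_) j <;> simp
  | add x y _ _ hx hy =>
    change _ ∈ AddSubmonoid.closure _
    convert AddSubmonoid.add_mem _ hx hy using 1
    ext i j
    refine Fin.cases ?_ (fun i => ?_) i <;> refine Fin.cases ?_ (fun j => ?_) j <;> simp

/-- The remainder after splitting off the rounded first row of `A` with pivot `t`. -/
def splitRemainder {n : ℕ} (A : Matrix (Fin (n + 1)) (Fin (n + 1)) ℤ) (t : ℤ) :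
    Matrix (Fin n) (Fin n) ℤ :=
  Matrix.of fun i j => A i.succ j.succ - A 0 i.succ / t * (A 0 j.succ / t) -
    if i = j then A 0 i.succ % t else 0

lemma sum_emod_le {n : ℕ} (a : Fin n → ℤ) {t : ℤ} (ht : 0 < t) : ∑ j, a j % t ≤ n * t := by
  simpa using Finset.sum_le_sum (s := Finset.univ) fun j _ => (Int.emod_lt_of_pos (a j) ht).le

lemma IsSumSqForm.of_splitRemainder {n : ℕ} {A : Matrix (Fin (n + 1)) (Fin (n + 1)) ℤ}
    (hA : A.IsSymm) {t : ℤ} (ht : 0 < t) (hle : t ^ 2 + n * t ≤ A 0 0)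
    (h : IsSumSqForm (splitRemainder A t)) : IsSumSqForm A := by
  set e : Fin n → ℤ := fun j => A 0 j.succ % t with he
  have he0 : ∀ j, 0 ≤ e j := fun j => Int.emod_nonneg _ ht.ne'
  have hrest : 0 ≤ A 0 0 - t ^ 2 - ∑ j, e j := by
    linarith [sum_emod_le (fun j : Fin n => A 0 j.succ) ht]
  have hd : ∀ j : Fin n, t * (A 0 j.succ / t) + e j = A 0 j.succ := fun j =>
    Int.mul_ediv_add_emod _ _
  have hsmul : ∀ (c : ℤ) (v : Fin (n + 1) → ℤ), 0 ≤ c →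
      IsSumSqForm (c • Matrix.vecMulVec v v) := fun c v hc => by
    lift c to ℕ using hc
    rw [natCast_zsmul]
    exact AddSubmonoid.nsmul_mem _ (isSumSqForm_vecMulVec v) c
  have hdecomp : A = Matrix.vecMulVec (Fin.cons t fun j => A 0 j.succ / t)
        (Fin.cons t fun j => A 0 j.succ / t) +
      ∑ j, e j • Matrix.vecMulVec (Fin.cons 1 (Pi.single j 1)) (Fin.cons 1 (Pi.single j 1)) +
      (A 0 0 - t ^ 2 - ∑ j, e j) • Matrix.vecMulVec (Fin.cons 1 0) (Fin.cons 1 0) +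
      Matrix.of (Fin.cons 0 fun i => Fin.cons 0 (splitRemainder A t i)) := by
    ext i j
    refine Fin.cases ?_ (fun i => ?_) i <;> refine Fin.cases ?_ (fun j => ?_) j
    · simp [-zsmul_eq_mul, Matrix.sum_apply, Matrix.vecMulVec_apply]
      ring
    · simp [-zsmul_eq_mul, Matrix.sum_apply, Matrix.vecMulVec_apply, Pi.single_apply, hd]
    · simp [-zsmul_eq_mul, Matrix.sum_apply, Matrix.vecMulVec_apply, Pi.single_apply, hA.apply 0 i.succ,
        mul_comm _ t, hd]
    · simp [-zsmul_eq_mul, Matrix.sum_apply, Matrix.vecMulVec_apply, Pi.single_apply, splitRemainder, he]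
      split_ifs with hij
      · subst hij
        ring
      · ring
  rw [hdecomp]
  exact AddSubmonoid.add_mem _ (AddSubmonoid.add_mem _ (AddSubmonoid.add_mem _
    (isSumSqForm_vecMulVec _) (AddSubmonoid.sum_mem _ fun j _ => hsmul _ _ (he0 j)))
    (hsmul _ _ hrest)) h.lift

/-- The value at a real vector of the quadratic form with Gram matrix `M`. -/
def gramForm {n : ℕ} (M : Matrix (Fin n) (Fin n) ℝ) (x : Fin n → ℝ) : ℝ := x ⬝ᵥ M *ᵥ x

lemma gramForm_cons {n : ℕ} {M : Matrix (Fin (n + 1)) (Fin (n + 1)) ℝ} (hM : M.IsSymm) (x₀ : ℝ)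
    (x : Fin n → ℝ) :
    gramForm M (Fin.cons x₀ x) = M 0 0 * x₀ ^ 2 + 2 * x₀ * (∑ j, M 0 j.succ * x j) +
      gramForm (M.submatrix Fin.succ Fin.succ) x := by
  have h1 : ∀ j : Fin n, M j.succ 0 = M 0 j.succ := fun j => hM.apply 0 j.succ
  simp only [gramForm, dotProduct, Matrix.mulVec, Fin.sum_univ_succ, Fin.cons_zero,
    Fin.cons_succ, Matrix.submatrix_apply, h1, mul_add, Finset.sum_add_distrib]
  have h2 : ∑ i, x i * (M 0 i.succ * x₀) = x₀ * ∑ i, M 0 i.succ * x i := by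
    rw [Finset.mul_sum]
    exact Finset.sum_congr rfl fun i _ => by ring
  rw [h2]
  ring

lemma gramForm_splitRemainder {n : ℕ} (A : Matrix (Fin (n + 1)) (Fin (n + 1)) ℤ) (t : ℤ)
    (x : Fin n → ℝ) :
    gramForm ((splitRemainder A t).map fun a => (a : ℝ)) x =
      gramForm ((A.map fun a => (a : ℝ)).submatrix Fin.succ Fin.succ) x -
        (∑ j : Fin n, ((A 0 j.succ / t : ℤ) : ℝ) * x j) ^ 2 -
        ∑ j : Fin n, ((A 0 j.succ % t : ℤ) : ℝ) * x j ^ 2 := by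
  have h1 : (∑ j : Fin n, ((A 0 j.succ / t : ℤ) : ℝ) * x j) ^ 2 =
      ∑ i : Fin n, x i * ∑ j : Fin n,
        ((A 0 i.succ / t : ℤ) : ℝ) * ((A 0 j.succ / t : ℤ) : ℝ) * x j := by
    rw [sq, Finset.sum_mul]
    refine Finset.sum_congr rfl fun i _ => ?_
    rw [Finset.mul_sum, Finset.mul_sum]
    exact Finset.sum_congr rfl fun j _ => by ring
  rw [h1]
  simp only [gramForm, dotProduct, Matrix.mulVec, splitRemainder, Matrix.map_apply,
    Matrix.of_apply, Matrix.submatrix_apply]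
  rw [← Finset.sum_sub_distrib, ← Finset.sum_sub_distrib]
  refine Finset.sum_congr rfl fun i _ => ?_
  push_cast
  simp only [sub_mul, Finset.sum_sub_distrib, ite_mul, zero_mul, Finset.sum_ite_eq,
    Finset.mem_univ, if_true]
  ring

lemma splitRemainder_isSymm {n : ℕ} {A : Matrix (Fin (n + 1)) (Fin (n + 1)) ℤ} (hA : A.IsSymm)
    (t : ℤ) : (splitRemainder A t).IsSymm := by
  refine Matrix.IsSymm.ext fun i j => ?_
  simp only [splitRemainder, Matrix.of_apply, hA.apply i.succ j.succ,
    mul_comm (A 0 j.succ / t)]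
  congr 1
  by_cases hij : i = j
  · subst hij
    rfl
  · rw [if_neg hij, if_neg (Ne.symm hij)]

/-- The pivot `t` of the splitting with `t ^ 2 + n * t` close to `a` from below. -/
lemma exists_pivot {n : ℕ} {a : ℤ} (ha : n + 1 ≤ a) :
    ∃ t : ℤ, 1 ≤ t ∧ t ^ 2 + n * t ≤ a ∧ a ≤ t ^ 2 + (2 * n + 3) * t := by
  have hex : ∃ t : ℕ, a < ((t : ℤ) + 1) ^ 2 + n * ((t : ℤ) + 1) :=
    ⟨a.toNat, by
      have := Int.self_le_toNat a
      nlinarith⟩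
  classical
  obtain ⟨t, ht, hmin⟩ : ∃ t : ℕ, a < ((t : ℤ) + 1) ^ 2 + n * ((t : ℤ) + 1) ∧
      ∀ t' < t, ¬ a < ((t' : ℤ) + 1) ^ 2 + n * ((t' : ℤ) + 1) :=
    ⟨Nat.find hex, Nat.find_spec hex, fun t' h => Nat.find_min hex h⟩
  cases t with
  | zero => exact absurd ht (by push_cast; linarith)
  | succ t =>
    have h1 := not_lt.1 (hmin t t.lt_succ_self)
    push_cast at ht h1 ⊢
    refine ⟨t + 1, by omega, h1, ?_⟩
    have : (0 : ℤ) ≤ t * n := by positivity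
    nlinarith

lemma sq_div_le_of_pivot {a b E X t n α : ℝ} (ht : 1 ≤ t) (hn : 0 ≤ n) (hα : 0 < α)
    (hαt : α ≤ t ^ 2 + (2 * n + 3) * t) (hab : a = t * b + E) (hE : |E| ≤ t * X) :
    b ^ 2 ≤ a ^ 2 / α * (1 + (4 * n + 7) / t) + 2 * t * X ^ 2 := by
  have ht0 : 0 < t := by linarith
  have hE2 : E ^ 2 ≤ t ^ 2 * X ^ 2 := by
    rw [← mul_pow]
    exact sq_le_sq' (by linarith [abs_le.1 hE]) (abs_le.1 hE).2
  have h1 : t ^ 3 * b ^ 2 ≤ (t + 1) * a ^ 2 + 2 * t ^ 2 * (t ^ 2 * X ^ 2) := by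
    have e1 : t ^ 3 * b ^ 2 = t * (a - E) ^ 2 := by rw [hab]; ring
    have e2 : (t + t ^ 2) * E ^ 2 ≤ (2 * t ^ 2) * (t ^ 2 * X ^ 2) :=
      mul_le_mul (by nlinarith) hE2 (sq_nonneg _) (by positivity)
    nlinarith [sq_nonneg (a + t * E)]
  have h2 : (t + 1) * α ≤ t ^ 2 * (t + (4 * n + 7)) := by
    have : (t + 1) * α ≤ (t + 1) * (t ^ 2 + (2 * n + 3) * t) := by gcongr
    nlinarith [mul_nonneg hn (by nlinarith : 0 ≤ t ^ 2 - t)]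
  have h3 : (t + 1) * a ^ 2 ≤ t ^ 3 * (a ^ 2 / α * (1 + (4 * n + 7) / t)) := by
    have : t ^ 3 * (a ^ 2 / α * (1 + (4 * n + 7) / t)) =
        a ^ 2 / α * (t ^ 2 * (t + (4 * n + 7))) := by field_simp
    rw [this]
    calc (t + 1) * a ^ 2 = a ^ 2 / α * ((t + 1) * α) := by field_simp
      _ ≤ _ := by gcongr
  have h4 : 0 < t ^ 3 := by positivity
  refine le_of_mul_le_mul_left ?_ h4
  calc t ^ 3 * b ^ 2 ≤ _ := h1
    _ ≤ _ := by nlinarith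

lemma intCast_map_isSymm {n : ℕ} {A : Matrix (Fin n) (Fin n) ℤ} (hA : A.IsSymm) :
    (A.map fun a => (a : ℝ)).IsSymm :=
  Matrix.IsSymm.ext fun i j => by simp [hA.apply i j]

lemma sum_row_eq_of_ediv {n : ℕ} (a : Fin n → ℤ) (t : ℤ) (x : Fin n → ℝ) :
    ∑ j, (a j : ℝ) * x j =
      t * (∑ j, ((a j / t : ℤ) : ℝ) * x j) + ∑ j, ((a j % t : ℤ) : ℝ) * x j := by
  rw [Finset.mul_sum, ← Finset.sum_add_distrib]
  refine Finset.sum_congr rfl fun j _ => ?_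
  have h : (a j : ℝ) = t * ((a j / t : ℤ) : ℝ) + ((a j % t : ℤ) : ℝ) := by
    exact_mod_cast (Int.mul_ediv_add_emod (a j) t).symm
  rw [h]
  ring

lemma gramForm_splitRemainder_le {n : ℕ} {A : Matrix (Fin (n + 1)) (Fin (n + 1)) ℤ}
    (hA : A.IsSymm) {t : ℤ} (ht : 1 ≤ t) (hle : t ^ 2 + n * t ≤ A 0 0) (y : ℝ) (x : Fin n → ℝ) :
    gramForm ((splitRemainder A t).map fun a => (a : ℝ)) x ≤
      gramForm (A.map fun a => (a : ℝ)) (Fin.cons y x) := by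
  rw [gramForm_splitRemainder, gramForm_cons (intCast_map_isSymm hA)]
  simp only [Matrix.map_apply, sum_row_eq_of_ediv (fun j : Fin n => A 0 j.succ) t x]
  set e : Fin n → ℝ := fun j => ((A 0 j.succ % t : ℤ) : ℝ)
  have h2 : ∑ j, e j * (y + x j) ^ 2 =
      (∑ j, e j) * y ^ 2 + 2 * y * (∑ j, e j * x j) + ∑ j, e j * x j ^ 2 := by
    rw [Finset.sum_mul, Finset.mul_sum, ← Finset.sum_add_distrib, ← Finset.sum_add_distrib]
    exact Finset.sum_congr rfl fun j _ => by ring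
  have h3 : 0 ≤ ∑ j, e j * (y + x j) ^ 2 := Finset.sum_nonneg fun j _ =>
    mul_nonneg (Int.cast_nonneg (Int.emod_nonneg _ (by omega))) (sq_nonneg _)
  have h4 : (t : ℝ) ^ 2 + ∑ j, e j ≤ A 0 0 := by
    have := sum_emod_le (fun j : Fin n => A 0 j.succ) (by omega : 0 < t)
    have h6 : ((t ^ 2 + ∑ j : Fin n, A 0 j.succ % t : ℤ) : ℝ) ≤ A 0 0 :=
      Int.cast_le.2 (by linarith)
    rwa [Int.cast_add, Int.cast_pow, Int.cast_sum] at h6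
  have h5 : 0 ≤ ((A 0 0 : ℝ) - t ^ 2 - ∑ j, e j) * y ^ 2 := mul_nonneg (by linarith) (sq_nonneg _)
  linarith [sq_nonneg (t * y + ∑ j : Fin n, ((A 0 j.succ / t : ℤ) : ℝ) * x j)]

lemma gramForm_complete_square {n : ℕ} {M : Matrix (Fin (n + 1)) (Fin (n + 1)) ℝ} (hM : M.IsSymm)
    (h0 : M 0 0 ≠ 0) (x₀ : ℝ) (x : Fin n → ℝ) :
    gramForm M (Fin.cons x₀ x) = M 0 0 * (x₀ + (∑ j, M 0 j.succ * x j) / M 0 0) ^ 2 +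
      (gramForm (M.submatrix Fin.succ Fin.succ) x - (∑ j, M 0 j.succ * x j) ^ 2 / M 0 0) := by
  rw [gramForm_cons hM]
  field_simp
  ring

lemma le_gramForm_splitRemainder {n : ℕ} (A : Matrix (Fin (n + 1)) (Fin (n + 1)) ℤ)
    {t : ℤ} (ht : 1 ≤ t) (h0 : 0 < A 0 0) (hle : A 0 0 ≤ t ^ 2 + (2 * n + 3) * t)
    (x : Fin n → ℝ) :
    gramForm ((A.map fun a => (a : ℝ)).submatrix Fin.succ Fin.succ) x -
        (∑ j : Fin n, (A 0 j.succ : ℝ) * x j) ^ 2 / A 0 0 * (1 + (4 * n + 7) / t) -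
        3 * (t * (∑ j, |x j|) ^ 2) ≤
      gramForm ((splitRemainder A t).map fun a => (a : ℝ)) x := by
  rw [gramForm_splitRemainder]
  set e : Fin n → ℝ := fun j => ((A 0 j.succ % t : ℤ) : ℝ)
  set X := ∑ j, |x j| with hX
  have ht' : (1 : ℝ) ≤ t := by exact_mod_cast ht
  have he0 : ∀ j, 0 ≤ e j := fun j => Int.cast_nonneg (Int.emod_nonneg _ (by omega))
  have het : ∀ j, e j ≤ t := fun j =>
    Int.cast_le.2 (Int.emod_lt_of_pos (A 0 j.succ) (by omega : 0 < t)).le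
  have hEX : |∑ j, e j * x j| ≤ t * X := by
    rw [hX, Finset.mul_sum]
    refine (Finset.abs_sum_le_sum_abs _ _).trans (Finset.sum_le_sum fun j _ => ?_)
    rw [abs_mul, abs_of_nonneg (he0 j)]
    exact mul_le_mul_of_nonneg_right (het j) (abs_nonneg _)
  have hWX : ∑ j, e j * x j ^ 2 ≤ t * X ^ 2 := by
    have h1 : ∑ j, |x j| ^ 2 ≤ X ^ 2 :=
      Finset.sum_sq_le_sq_sum_of_nonneg fun j _ => abs_nonneg _
    refine le_trans ?_ (mul_le_mul_of_nonneg_left h1 (by linarith))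
    rw [Finset.mul_sum]
    refine Finset.sum_le_sum fun j _ => ?_
    rw [sq_abs]
    exact mul_le_mul_of_nonneg_right (het j) (sq_nonneg _)
  have := sq_div_le_of_pivot (n := n) (α := A 0 0) ht' n.cast_nonneg (by exact_mod_cast h0)
    (by exact_mod_cast hle) (sum_row_eq_of_ediv (fun j : Fin n => A 0 j.succ) t x) hEX
  linarith

lemma pivot_bounds {n κ m R α t c : ℝ} (hκ : 1 ≤ κ) (hn : 0 ≤ n) (hnm : n + 3 ≤ m) (hR : 0 ≤ R)
    (hc : 1 ≤ κ * c) (hα : R ^ 2 / 2 * c ≤ α) (hαc : α ≤ R ^ 2 * c) (ht : 1 ≤ t)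
    (hl : t ^ 2 + n * t ≤ α) (hu : α ≤ t ^ 2 + (2 * n + 3) * t) :
    R ≤ 2 * κ * m * t ∧ t ≤ R * κ * c := by
  have hm : 0 < m := by linarith
  have hc0 : 0 < c := by nlinarith
  constructor
  · refine le_of_sq_le_sq ?_ (by positivity)
    have h0 : R ^ 2 ≤ 2 * κ * α := by nlinarith [mul_le_mul_of_nonneg_left hc (sq_nonneg R)]
    have h1 : α ≤ 2 * m * t ^ 2 := by
      have h4 : 0 ≤ (2 * n + 3) * (t ^ 2 - t) := mul_nonneg (by linarith) (by nlinarith)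
      have h5 : 0 ≤ (2 * m - 2 * n - 4) * t ^ 2 := mul_nonneg (by linarith) (sq_nonneg t)
      linarith
    have h2 : κ * (m * t ^ 2) ≤ κ * m * (κ * (m * t ^ 2)) :=
      le_mul_of_one_le_left (by positivity) (by nlinarith)
    have h3 : 2 * κ * α ≤ 2 * κ * (2 * m * t ^ 2) := by gcongr
    linarith
  · refine le_of_sq_le_sq ?_ (by positivity)
    have h1 : R ^ 2 * c ≤ R ^ 2 * c * (κ * (κ * c)) :=
      le_mul_of_one_le_right (by positivity) (by nlinarith)
    have h2 : 0 ≤ n * t := by positivity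
    linarith

lemma loss_bound {n κ m R t c X Q y : ℝ} (hκ : 1 ≤ κ) (hn : 0 ≤ n) (hnm : n + 3 ≤ m) (hR : 0 < R)
    (ht : 1 ≤ t) (hRt : R ≤ 2 * κ * m * t) (htR : t ≤ R * κ * c) (hQ : 0 ≤ Q)
    (hX : c * X ^ 2 ≤ κ * Q) (hy : y ≤ R ^ 2 * (2 * κ * Q)) :
    y * ((4 * n + 7) / t) + 3 * (t * X ^ 2) ≤ 35 * κ ^ 2 * m ^ 2 * R * Q := by
  have hm : 1 ≤ m := by linarith
  have hloss : y * ((4 * n + 7) / t) ≤ 16 * κ ^ 2 * m ^ 2 * R * Q := by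
    have h2 : (4 * n + 7) / t ≤ 4 * m * (2 * κ * m) / R := by
      rw [div_le_div_iff₀ (by linarith) hR]
      calc (4 * n + 7) * R ≤ 4 * m * (2 * κ * m * t) :=
            mul_le_mul (by linarith) hRt hR.le (by positivity)
        _ = _ := by ring
    calc _ ≤ R ^ 2 * (2 * κ * Q) * (4 * m * (2 * κ * m) / R) :=
          mul_le_mul hy h2 (by positivity) (by positivity)
      _ = _ := by
        field_simp
        ring
  have hloss' : t * X ^ 2 ≤ κ ^ 2 * m ^ 2 * R * Q := by
    calc t * X ^ 2 ≤ R * κ * c * X ^ 2 := mul_le_mul_of_nonneg_right htR (sq_nonneg X)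
      _ = R * κ * (c * X ^ 2) := by ring
      _ ≤ R * κ * (κ * Q) := mul_le_mul_of_nonneg_left hX (by positivity)
      _ = κ ^ 2 * R * Q * 1 := by ring
      _ ≤ κ ^ 2 * R * Q * m ^ 2 := mul_le_mul_of_nonneg_left (one_le_pow₀ hm) (by positivity)
      _ = _ := by ring
  have hpos : 0 ≤ κ ^ 2 * m ^ 2 * R * Q := by positivity
  linarith

/-- A form close to a large multiple of a reduced form is a sum of squares. -/
lemma Reduced.isSumSqForm {n : ℕ} {h : ℕ → ℝ} {N : Matrix (Fin n) (Fin n) ℝ} (hN : Reduced n h N)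
    {m κ q R : ℝ} (hκ : 1 ≤ κ) (hq : 0 ≤ q) (hqκ : m ^ 3 * q ≤ κ) (hR : 2 * κ * m ≤ R)
    (hnm : n + 2 ≤ m) (hdrop : ∀ k l, k ≤ l → l < n → h k ≤ q * h l) (hκh : ∀ k < n, 1 ≤ κ * h k)
    {σ : ℝ} (hσ : R ^ 2 / 2 + n * (35 * κ ^ 2 * m ^ 2 * R) ≤ σ)
    {A : Matrix (Fin n) (Fin n) ℤ} (hA : A.IsSymm)
    (hlow : ∀ x, σ * diagForm h N x ≤ gramForm (A.map fun a => (a : ℝ)) x)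
    (hup : ∀ x, gramForm (A.map fun a => (a : ℝ)) x ≤ R ^ 2 * diagForm h N x) :
    IsSumSqForm A := by
  induction hN generalizing σ with
  | nil h N =>
    rw [Subsingleton.elim A 0]
    exact AddSubmonoid.zero_mem _
  | @cons n h ν N tail pos min size ih =>
    push_cast at hnm hσ
    have hn0 : (0 : ℝ) ≤ n := n.cast_nonneg
    have hm : 0 < m := by linarith
    have hR0 : 0 < R := by nlinarith
    have hm1 : 1 ≤ m := by linarith
    set l : ℝ := 35 * κ ^ 2 * m ^ 2 * R with hl
    have hl0 : 0 ≤ l := by positivity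
    have hσR : R ^ 2 / 2 ≤ σ := by nlinarith [mul_nonneg hn0 hl0]
    have hAr := intCast_map_isSymm hA
    have hcons : ∀ x₀ x, diagForm h (triCons ν N) (Fin.cons x₀ x) =
        h 0 * (x₀ + ν ⬝ᵥ x) ^ 2 + diagForm (fun i => h (i + 1)) N x := fun x₀ x => by
      rw [diagForm_triCons, Fin.cons_zero, Fin.tail_cons]
    have hdiag0 : diagForm (fun i => h (i + 1)) N 0 = 0 := by simp [diagForm]
    have hgram0 : gramForm ((A.map fun a => (a : ℝ)).submatrix Fin.succ Fin.succ) 0 = 0 := by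
      simp [gramForm]
    set α : ℝ := (A 0 0 : ℝ) with hα
    have hαlow : σ * h 0 ≤ α := by
      simpa [hcons, gramForm_cons hAr, hdiag0, hgram0] using hlow (Fin.cons 1 0)
    have hαup : α ≤ R ^ 2 * h 0 := by
      simpa [hcons, gramForm_cons hAr, hdiag0, hgram0] using hup (Fin.cons 1 0)
    have hκ0 : 1 ≤ κ * h 0 := hκh 0 (by omega)
    have hακ : R ^ 2 ≤ 2 * κ * α := by
      have h1 : R ^ 2 / 2 * h 0 ≤ α := (mul_le_mul_of_nonneg_right hσR pos.le).trans hαlow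
      nlinarith [mul_le_mul_of_nonneg_left hκ0 (sq_nonneg R)]
    have hαm : m ≤ α := by
      have h1 : (2 * κ * m) ^ 2 ≤ R ^ 2 := by gcongr
      have h2 : 2 * κ * (2 * κ * m ^ 2) ≤ 2 * κ * α := by nlinarith
      have h3 := le_of_mul_le_mul_left h2 (by positivity)
      nlinarith [mul_le_mul hm1 hκ zero_le_one hm.le]
    obtain ⟨t, ht1, htl, htu⟩ := exists_pivot (n := n) (a := A 0 0) (by
      have : (n : ℝ) + 1 ≤ (A 0 0 : ℝ) := by linarith
      exact_mod_cast this)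
    have ht1' : (1 : ℝ) ≤ t := by exact_mod_cast ht1
    have ht0' : (0 : ℝ) < t := by linarith
    have htl' : (t : ℝ) ^ 2 + n * t ≤ α := by rw [hα]; exact_mod_cast htl
    have htu' : α ≤ (t : ℝ) ^ 2 + (2 * n + 3) * t := by rw [hα]; exact_mod_cast htu
    obtain ⟨hRt, htR⟩ := pivot_bounds (m := m) hκ hn0 (by linarith) hR0.le hκ0
      ((mul_le_mul_of_nonneg_right hσR pos.le).trans hαlow) hαup ht1' htl' htu'
    refine IsSumSqForm.of_splitRemainder hA (t := t) (by omega) htl ?_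
    refine ih ?_ ?_ ?_ (σ := σ - l) ?_ (splitRemainder_isSymm hA t) ?_ ?_
    · linarith
    · exact fun k l' hkl hl' => hdrop (k + 1) (l' + 1) (by omega) (by omega)
    · exact fun k hk => hκh (k + 1) (by omega)
    · linarith
    · intro x
      set Q := diagForm (fun i => h (i + 1)) N x with hQ
      have hα0 : 0 < α := by linarith
      have hsplit := le_gramForm_splitRemainder A ht1 (Int.cast_pos.1 hα0) htu x
      have hQ0 : 0 ≤ Q :=
        Finset.sum_nonneg fun i _ => mul_nonneg (tail.pos i i.2).le (sq_nonneg _)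
      have hσ0 : 0 ≤ σ := by linarith [sq_nonneg R]
      have hlow' : σ * Q + (∑ j : Fin n, (A 0 j.succ : ℝ) * x j) ^ 2 / α ≤
          gramForm ((A.map fun a => (a : ℝ)).submatrix Fin.succ Fin.succ) x := by
        have h1 := hlow (Fin.cons (-((∑ j : Fin n, (A 0 j.succ : ℝ) * x j) / α)) x)
        rw [hcons, gramForm_complete_square hAr hα0.ne'] at h1
        simp only [Matrix.map_apply, ← hα, neg_add_cancel, ne_eq, OfNat.ofNat_ne_zero,
          not_false_eq_true, zero_pow, mul_zero, zero_add, mul_add] at h1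
        have h2 : ∀ z : ℝ, 0 ≤ σ * (h 0 * z ^ 2) := fun z =>
          mul_nonneg hσ0 (mul_nonneg pos.le (sq_nonneg _))
        linarith [h2 (-((∑ j : Fin n, (A 0 j.succ : ℝ) * x j) / α) + ν ⬝ᵥ x)]
      have hhead : h 0 * (∑ j, |x j|) ^ 2 ≤ κ * Q ∧ h 0 * (ν ⬝ᵥ x) ^ 2 ≤ κ * Q := by
        have hc : ∀ i < n, h 0 ≤ q * h (i + 1) := fun i hi => hdrop 0 (i + 1) (by omega) (by omega)
        have hnm' : (n : ℝ) ^ 3 ≤ m ^ 3 := by gcongr; linarith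
        have h1 : (n : ℝ) ^ 3 * q ≤ κ := (mul_le_mul_of_nonneg_right hnm' hq).trans hqκ
        have h2 : (n : ℝ) * q ≤ κ := by
          refine le_trans (mul_le_mul_of_nonneg_right ?_ hq) hqκ
          nlinarith [mul_le_mul hm1 hm1 zero_le_one hm.le]
        refine ⟨(tail.mul_sq_sum_abs_le hc x pos.le).trans (mul_le_mul_of_nonneg_right h1 hQ0), ?_⟩
        refine le_trans (mul_le_mul_of_nonneg_left ?_ pos.le)
          ((mul_sq_sum_abs_mulVec_le hc x pos.le).trans (mul_le_mul_of_nonneg_right h2 hQ0))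
        have h3 : 0 ≤ ∑ i, |(N *ᵥ x) i| := Finset.sum_nonneg fun i _ => abs_nonneg _
        rw [← sq_abs (ν ⬝ᵥ x)]
        exact pow_le_pow_left₀ (abs_nonneg _) ((size x).trans (by linarith)) 2
      have hFup : gramForm ((A.map fun a => (a : ℝ)).submatrix Fin.succ Fin.succ) x ≤
          R ^ 2 * (2 * κ * Q) := by
        have h1 := hup (Fin.cons 0 x)
        rw [hcons, gramForm_cons hAr] at h1
        simp only [mul_zero, zero_mul, zero_add, ne_eq, OfNat.ofNat_ne_zero, not_false_eq_true,
          zero_pow] at h1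
        refine h1.trans (mul_le_mul_of_nonneg_left ?_ (sq_nonneg R))
        nlinarith [hhead.2]
      have hloss := loss_bound (m := m) hκ hn0 (by linarith) hR0 ht1' hRt htR hQ0 hhead.1
        (y := (∑ j : Fin n, (A 0 j.succ : ℝ) * x j) ^ 2 / α)
        (by linarith [mul_nonneg hσ0 hQ0])
      rw [mul_one_add] at hsplit
      rw [sub_mul]
      linarith
    · intro x
      refine (gramForm_splitRemainder_le hA ht1 htl (-(ν ⬝ᵥ x)) x).trans
        ((hup (Fin.cons (-(ν ⬝ᵥ x)) x)).trans_eq ?_)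
      rw [hcons]
      simp

lemma mulVec_intCast {m n : ℕ} (U : Matrix (Fin m) (Fin n) ℤ) (z : Fin n → ℤ) :
    ((U.map fun a => (a : ℝ)) *ᵥ fun j => (z j : ℝ)) = fun i => ((U *ᵥ z) i : ℝ) := by
  ext i
  simp [Matrix.mulVec, dotProduct]

lemma gramForm_smul {n : ℕ} (M : Matrix (Fin n) (Fin n) ℝ) (c : ℝ) (x : Fin n → ℝ) :
    gramForm M (c • x) = c ^ 2 * gramForm M x := by
  simp only [gramForm, Matrix.mulVec_smul, smul_dotProduct, dotProduct_smul, smul_eq_mul]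
  ring

lemma gramForm_transpose_mul_mul {n : ℕ} (M U : Matrix (Fin n) (Fin n) ℝ) (x : Fin n → ℝ) :
    gramForm (Uᵀ * M * U) x = gramForm M (U *ᵥ x) := by
  rw [gramForm, gramForm, Matrix.mul_assoc, ← Matrix.mulVec_mulVec, Matrix.dotProduct_mulVec,
    Matrix.vecMul_transpose, Matrix.mulVec_mulVec]

/-- A positive definite form has a shortest nonzero integral vector. -/
lemma exists_shortest {n : ℕ} {M : Matrix (Fin (n + 1)) (Fin (n + 1)) ℝ}
    (hM : ∀ x, x ≠ 0 → 0 < gramForm M x) :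
    ∃ z : Fin (n + 1) → ℤ, z ≠ 0 ∧ ∀ w : Fin (n + 1) → ℤ, w ≠ 0 →
      gramForm M (fun i => (z i : ℝ)) ≤ gramForm M (fun i => (w i : ℝ)) := by
  have hcont : Continuous (gramForm M) := by
    unfold gramForm
    fun_prop
  obtain ⟨x₀, hx₀, hmin⟩ := (isCompact_sphere (0 : Fin (n + 1) → ℝ) 1).exists_isMinOn
    (NormedSpace.sphere_nonempty.2 zero_le_one) hcont.continuousOn
  set c := gramForm M x₀
  have hc : 0 < c := hM x₀ (by rintro rfl; simp at hx₀)
  have hbound : ∀ x, c * ‖x‖ ^ 2 ≤ gramForm M x := fun x => by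
    rcases eq_or_ne x 0 with rfl | hx
    · simp [gramForm]
    · have hx' : ‖x‖ ≠ 0 := norm_ne_zero_iff.2 hx
      have h1 : c ≤ gramForm M (‖x‖⁻¹ • x) := hmin (by simp [norm_smul, hx'])
      rw [gramForm_smul] at h1
      have h2 : gramForm M x = ‖x‖ ^ 2 * ((‖x‖⁻¹) ^ 2 * gramForm M x) := by field_simp
      rw [h2, mul_comm c]
      gcongr
  set e : Fin (n + 1) → ℤ := Pi.single 0 1
  set B := gramForm M (fun i => (e i : ℝ))
  have hfin : {z : Fin (n + 1) → ℤ | z ≠ 0 ∧ gramForm M (fun i => (z i : ℝ)) ≤ B}.Finite := by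
    refine (Set.finite_Icc (fun _ => -⌈B / c⌉ - 1) (fun _ => ⌈B / c⌉ + 1)).subset ?_
    rintro z ⟨-, hz⟩
    have hz' : ∀ i, ((z i : ℝ)) ^ 2 ≤ B / c := fun i => by
      rw [le_div_iff₀ hc, mul_comm]
      refine le_trans (mul_le_mul_of_nonneg_left ?_ hc.le) ((hbound _).trans hz)
      rw [← sq_abs]
      exact pow_le_pow_left₀ (abs_nonneg _) (norm_le_pi_norm (fun i => (z i : ℝ)) i) 2
    have hz2 : ∀ i, z i ^ 2 ≤ ⌈B / c⌉ := fun i => by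
      have := (hz' i).trans (Int.le_ceil _)
      exact_mod_cast this
    exact ⟨fun i => by nlinarith [hz2 i], fun i => by nlinarith [hz2 i]⟩
  obtain ⟨z, ⟨hz0, hzB⟩, hz⟩ := hfin.exists_minimalFor (fun z => gramForm M fun i => (z i : ℝ)) _
    ⟨e, by simp [e], le_rfl⟩
  refine ⟨z, hz0, fun w hw => ?_⟩
  by_cases hwB : gramForm M (fun i => (w i : ℝ)) ≤ B
  · exact (le_total _ _).elim id fun h => hz ⟨hw, hwB⟩ h
  · exact hzB.trans (not_le.1 hwB).le

lemma exists_eq_smul_primitive {n : ℕ} {z : Fin n → ℤ} (hz : z ≠ 0) :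
    ∃ (g : ℤ) (w f : Fin n → ℤ), g ≠ 0 ∧ z = g • w ∧ f ⬝ᵥ w = 1 := by
  obtain ⟨g, hg⟩ := (IsPrincipalIdealRing.principal (Ideal.span (Set.range z))).principal
  have hdvd : ∀ i, ∃ w, z i = g * w := fun i => by
    have : z i ∈ Ideal.span (Set.range z) := Ideal.subset_span ⟨i, rfl⟩
    rw [hg] at this
    exact Ideal.mem_span_singleton.1 this
  choose w hw using hdvd
  have hg0 : g ≠ 0 := by
    rintro rfl
    exact hz (funext fun i => by simp [hw])
  have hgm : g ∈ Ideal.span (Set.range z) := by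
    rw [hg]
    exact Submodule.mem_span_singleton_self g
  obtain ⟨f, hf⟩ := Ideal.mem_span_range_iff_exists_fun.1 hgm
  refine ⟨g, w, f, hg0, funext hw, mul_left_cancel₀ hg0 ?_⟩
  rw [mul_one, dotProduct, Finset.mul_sum]
  refine Eq.trans (Finset.sum_congr rfl fun i _ => ?_) hf
  rw [hw]
  ring

/-- A primitive integral vector is the first column of a unimodular matrix. -/
lemma exists_unimodular_of_primitive {n : ℕ} {w f : Fin (n + 1) → ℤ} (hf : f ⬝ᵥ w = 1) :
    ∃ U : Matrix (Fin (n + 1)) (Fin (n + 1)) ℤ, IsUnit U.det ∧ ∀ i, U i 0 = w i := by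
  set φ : (Fin (n + 1) → ℤ) →ₗ[ℤ] ℤ := dotProductBilin ℤ ℤ f with hφ
  have hφ' : ∀ x, φ x = f ⬝ᵥ x := fun x => rfl
  obtain ⟨m, ⟨b⟩⟩ := Submodule.nonempty_basis_of_pid (Pi.basisFun ℤ (Fin (n + 1)))
    (LinearMap.ker φ)
  let B := Module.Basis.mkFinCons w b
    (fun c x hx hcx => by
      have := congrArg φ hcx
      rw [map_add, map_smul, LinearMap.mem_ker.1 hx, hφ', hf, map_zero] at this
      simpa using this)
    (fun z => ⟨-(φ z), by rw [LinearMap.mem_ker, map_add, map_smul, hφ' w, hf]; simp⟩)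
  have hB0 : B 0 = w := by simp [B]
  obtain rfl : m = n := by
    have := Fintype.card_congr (B.indexEquiv (Pi.basisFun ℤ (Fin (n + 1))))
    simpa using this
  refine ⟨(Pi.basisFun ℤ (Fin (m + 1))).toMatrix B, ?_, fun i => ?_⟩
  · rw [← Module.Basis.det_apply]
    exact Module.Basis.isUnit_det _ _
  · rw [Module.Basis.toMatrix_apply, hB0]
    simp

/-- Every positive definite form is integrally equivalent to a reduced one. -/
theorem exists_reduced {n : ℕ} {M : Matrix (Fin n) (Fin n) ℝ} (hsymm : M.IsSymm)
    (hM : ∀ x, x ≠ 0 → 0 < gramForm M x) :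
    ∃ (U : Matrix (Fin n) (Fin n) ℤ) (h : ℕ → ℝ) (N : Matrix (Fin n) (Fin n) ℝ),
      IsUnit U.det ∧ Reduced n h N ∧
        ∀ x, gramForm M ((U.map fun a => (a : ℝ)) *ᵥ x) = diagForm h N x := by
  induction n with
  | zero => exact ⟨1, 0, 1, by simp, .nil _ _, fun x => by simp [gramForm, diagForm]⟩
  | succ n ih =>
    obtain ⟨z, hz0, hz⟩ := exists_shortest hM
    obtain ⟨g, w, f, hg, rfl, hf⟩ := exists_eq_smul_primitive hz0
    obtain ⟨U₁, hU₁, hcol⟩ := exists_unimodular_of_primitive hf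
    have hw0 : w ≠ 0 := by
      rintro rfl
      simp at hf
    have hw : ∀ v : Fin (n + 1) → ℤ, v ≠ 0 →
        gramForm M (fun i => (w i : ℝ)) ≤ gramForm M (fun i => (v i : ℝ)) := fun v hv => by
      refine le_trans ?_ (hz v hv)
      have h1 : (fun i => (((g • w) i : ℤ) : ℝ)) = (g : ℝ) • fun i => (w i : ℝ) := by
        ext i
        simp
      rw [h1, gramForm_smul]
      have h2 : (1 : ℝ) ≤ (g : ℝ) ^ 2 := by
        exact_mod_cast Int.one_le_abs (pow_ne_zero 2 hg) |>.trans_eq (abs_of_nonneg (sq_nonneg g))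
      refine le_mul_of_one_le_left (hM _ fun h0 => hw0 ?_).le h2
      exact funext fun i => Int.cast_eq_zero.1 (congrFun h0 i)
    set V := U₁.map fun a => (a : ℝ) with hV
    have hVinj : ∀ x, V *ᵥ x = 0 → x = 0 := fun x hx => by
      refine Matrix.eq_zero_of_mulVec_eq_zero (M := V) ?_ hx
      have h1 : V.det = (U₁.det : ℝ) := ((Int.castRingHom ℝ).map_det U₁).symm
      rw [h1]
      exact_mod_cast hU₁.ne_zero
    set M₁ := Vᵀ * M * V with hM₁
    have hM₁s : M₁.IsSymm := by
      rw [hM₁, Matrix.IsSymm]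
      simp [Matrix.transpose_mul, hsymm.eq, Matrix.mul_assoc]
    have hM₁p : ∀ x, x ≠ 0 → 0 < gramForm M₁ x := fun x hx => by
      rw [hM₁, gramForm_transpose_mul_mul]
      exact hM _ fun h => hx (hVinj x h)
    have hM₁w : gramForm M (fun i => (w i : ℝ)) = M₁ 0 0 := by
      have h1 : gramForm M₁ (Pi.single 0 1) = M₁ 0 0 := by simp [gramForm]
      rw [← h1, hM₁, gramForm_transpose_mul_mul]
      congr 1
      ext i
      simp [hV, hcol]
    have hpos : 0 < M₁ 0 0 := by
      rw [← hM₁w]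
      exact hM _ fun h0 => hw0 (funext fun i => Int.cast_eq_zero.1 (congrFun h0 i))
    set ν : Fin n → ℝ := fun j => M₁ 0 j.succ / M₁ 0 0 with hν
    set M' : Matrix (Fin n) (Fin n) ℝ :=
      Matrix.of fun i j => M₁ i.succ j.succ - M₁ 0 i.succ * M₁ 0 j.succ / M₁ 0 0 with hM'
    have hsq : ∀ x₀ x, gramForm M₁ (Fin.cons x₀ x) =
        M₁ 0 0 * (x₀ + ν ⬝ᵥ x) ^ 2 + gramForm M' x := fun x₀ x => by
      have h1 : ν ⬝ᵥ x = (∑ j, M₁ 0 j.succ * x j) / M₁ 0 0 := by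
        rw [dotProduct, Finset.sum_div]
        exact Finset.sum_congr rfl fun j _ => by ring
      have h2 : gramForm M' x = gramForm (M₁.submatrix Fin.succ Fin.succ) x -
          (∑ j, M₁ 0 j.succ * x j) ^ 2 / M₁ 0 0 := by
        rw [sq, mul_div_assoc, Finset.sum_mul]
        simp only [gramForm, dotProduct, Matrix.mulVec]
        rw [← Finset.sum_sub_distrib]
        refine Finset.sum_congr rfl fun i _ => ?_
        simp only [hM', Matrix.of_apply, Matrix.submatrix_apply, sub_mul, Finset.sum_sub_distrib,
          mul_sub, Finset.mul_sum, Finset.sum_div]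
        exact congrArg _ (Finset.sum_congr rfl fun j _ => by ring)
      rw [gramForm_complete_square hM₁s hpos.ne', h1, h2]
    obtain ⟨U', h', N', hU', hN', hUN⟩ := ih (M := M')
      (Matrix.IsSymm.ext fun i j => by
        simp only [hM', Matrix.of_apply, hM₁s.apply i.succ j.succ, mul_comm (M₁ 0 j.succ)])
      fun x hx => by
        have h1 := hsq (-(ν ⬝ᵥ x)) x
        rw [neg_add_cancel, sq, mul_zero, mul_zero, zero_add] at h1
        rw [← h1]
        exact hM₁p _ fun h0 => hx (funext fun i => by simpa using congrFun h0 i.succ)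
    obtain ⟨u, hu⟩ := hN'.exists_round (ν ᵥ* U'.map fun a => (a : ℝ))
    have hval : ∀ x, gramForm M (((U₁ * triCons u U').map fun a => (a : ℝ)) *ᵥ x) =
        diagForm (fun k => Nat.casesOn k (M₁ 0 0) h')
          (triCons (fun i => (ν ᵥ* U'.map fun a => (a : ℝ)) i + u i) N') x := fun x => by
      rw [Matrix.map_mul_intCast, ← Matrix.mulVec_mulVec, ← gramForm_transpose_mul_mul, ← hM₁,
        triCons_map, triCons_mulVec, hsq, hUN, diagForm_triCons, Matrix.dotProduct_mulVec]
      have h1 : (fun i => (ν ᵥ* U'.map fun a => (a : ℝ)) i + (u i : ℝ)) =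
        (ν ᵥ* U'.map fun a => (a : ℝ)) + fun i => (u i : ℝ) := rfl
      rw [h1, add_dotProduct]
      change _ = M₁ 0 0 * _ ^ 2 + diagForm h' N' (Fin.tail x)
      ring
    refine ⟨U₁ * triCons u U', fun k => Nat.casesOn k (M₁ 0 0) h',
      triCons (fun i => (ν ᵥ* U'.map fun a => (a : ℝ)) i + u i) N', ?_, ?_, hval⟩
    · rw [Matrix.det_mul, det_triCons]
      exact hU₁.mul hU'
    · refine .cons _ _ _ hN' hpos (fun z hz => ?_) hu
      rw [← hval, mulVec_intCast, ← hM₁w]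
      refine hw _ fun h0 => hz ?_
      refine Matrix.eq_zero_of_mulVec_eq_zero (M := U₁ * triCons u U') ?_ h0
      rw [Matrix.det_mul, det_triCons]
      exact (hU₁.mul hU').ne_zero

lemma Reduced.diagForm_single {n : ℕ} {h : ℕ → ℝ} {N : Matrix (Fin (n + 1)) (Fin (n + 1)) ℝ}
    (hN : Reduced (n + 1) h N) : diagForm h N (Pi.single 0 1) = h 0 := by
  cases hN with
  | cons ν N tail pos min size =>
    have h1 : Fin.tail (Pi.single 0 1 : Fin (n + 1) → ℝ) = 0 := by
      ext i
      simp [Fin.tail]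
    rw [diagForm_triCons, h1]
    simp [diagForm]

/-- Multiples of an integral form by at least `sumSqThreshold n` are sums of squares. -/
noncomputable def sumSqThreshold (n : ℕ) : ℝ := 4900 * (n + 2) ^ 18 * dropBound n ^ 4

theorem exists_smul_eq_transpose_mul {n : ℕ} {M : Matrix (Fin n) (Fin n) ℤ} (hsymm : M.IsSymm)
    (hM : ∀ x, x ≠ 0 → 0 < gramForm (M.map fun a => (a : ℝ)) x) {s : ℕ}
    (hs : sumSqThreshold n ≤ s) :
    ∃ r : ℕ, 0 < r ∧ ∃ A : Matrix (Fin r) (Fin n) ℤ, (s : ℤ) • M = Aᵀ * A := by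
  obtain ⟨U, h, N, hU, hN, hval⟩ := exists_reduced (intCast_map_isSymm hsymm) hM
  have hq := one_le_dropBound n
  set q := dropBound n
  set m : ℝ := n + 2 with hm
  have hn0 : (0 : ℝ) ≤ n := n.cast_nonneg
  have hm1 : 1 ≤ m := by linarith
  set κ : ℝ := m ^ 3 * q with hκ
  have hqκ : q ≤ κ := le_mul_of_one_le_left (by linarith) (one_le_pow₀ hm1)
  have hR : 70 * κ ^ 2 * m ^ 3 ≤ √(s : ℝ) := by
    refine Real.le_sqrt_of_sq_le (le_trans (le_of_eq ?_) hs)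
    rw [sumSqThreshold, hκ]
    ring
  have hR2 : √(s : ℝ) ^ 2 = s := Real.sq_sqrt s.cast_nonneg
  have hh : ∀ k < n, 1 ≤ κ * h k := by
    intro k hk
    obtain ⟨p, rfl⟩ : ∃ p, n = p + 1 := ⟨n - 1, by omega⟩
    refine le_trans ?_ ((hN.le_dropBound_mul (Nat.zero_le k) hk).trans
      (mul_le_mul_of_nonneg_right hqκ (hN.pos k hk).le))
    have h0 := hval (Pi.single 0 1)
    rw [hN.diagForm_single] at h0
    have h1 := hN.pos 0 (by omega)
    have h2 : (Pi.single 0 1 : Fin (p + 1) → ℝ) =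
        fun j => ((Pi.single 0 1 : Fin (p + 1) → ℤ) j : ℝ) := by
      ext j
      simp [Pi.single_apply]
    rw [h2, mulVec_intCast, gramForm, mulVec_intCast] at h0
    set z := U *ᵥ Pi.single 0 1
    have h3 : ((z ⬝ᵥ M *ᵥ z : ℤ) : ℝ) = h 0 := by
      rw [← h0]
      simp [dotProduct]
    rw [← h3] at h1 ⊢
    have h4 : 0 < z ⬝ᵥ M *ᵥ z := Int.cast_pos.1 h1
    exact_mod_cast h4
  have hgram : ∀ x, gramForm ((((s : ℤ) • (Uᵀ * M * U))).map fun a => (a : ℝ)) x =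
      √(s : ℝ) ^ 2 * diagForm h N x := fun x => by
    have h1 : (((s : ℤ) • (Uᵀ * M * U))).map (fun a => (a : ℝ)) =
        (s : ℝ) • ((U.map fun a => (a : ℝ))ᵀ * (M.map fun a => (a : ℝ)) *
          (U.map fun a => (a : ℝ))) := by
      rw [← Matrix.transpose_map, ← Matrix.map_mul_intCast, ← Matrix.map_mul_intCast]
      ext i j
      simp only [Matrix.map_apply, Matrix.smul_apply, smul_eq_mul]
      push_cast
      rfl
    rw [h1, hR2, ← hval, ← gramForm_transpose_mul_mul]
    simp [gramForm, Matrix.smul_mulVec]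
  have hκ1 : 1 ≤ κ := hq.trans hqκ
  have hm0 : 0 ≤ m := by linarith
  have hrep : IsSumSqForm ((s : ℤ) • (Uᵀ * M * U)) := by
    refine hN.isSumSqForm (m := m) (κ := κ) (q := q) (R := √s) (σ := √(s : ℝ) ^ 2) hκ1 (by linarith)
      hκ.ge ?_ hm.ge (fun k l hkl hl => hN.le_dropBound_mul hkl hl) hh ?_ ?_ (fun x => (hgram x).ge)
      (fun x => (hgram x).le)
    · refine le_trans ?_ hR
      have h1 : κ * m ≤ κ ^ 2 * m ^ 3 := by
        have := le_mul_of_one_le_right (by positivity : 0 ≤ κ * m)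
          (one_le_mul_of_one_le_of_one_le hκ1 (one_le_pow₀ hm1 (n := 2)))
        linarith
      have h2 : 0 ≤ κ * m := by positivity
      linarith
    · have h1 : n * (70 * κ ^ 2 * m ^ 2) ≤ √(s : ℝ) := by
        refine le_trans ?_ hR
        have : 0 ≤ (m - n) * (70 * κ ^ 2 * m ^ 2) := mul_nonneg (by linarith) (by positivity)
        linarith
      have h2 := mul_le_mul_of_nonneg_right h1 (Real.sqrt_nonneg (s : ℝ))
      linarith
    · rw [Matrix.IsSymm, Matrix.transpose_smul]
      congr 1
      simp [Matrix.transpose_mul, hsymm.eq, Matrix.mul_assoc]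
  obtain ⟨r, hr, B, hB⟩ := hrep.exists_eq_transpose_mul
  refine ⟨r, hr, B * U⁻¹, ?_⟩
  calc (s : ℤ) • M = (U * U⁻¹)ᵀ * ((s : ℤ) • M) * (U * U⁻¹) := by
        rw [Matrix.mul_nonsing_inv _ hU]
        simp
    _ = (U⁻¹)ᵀ * ((s : ℤ) • (Uᵀ * M * U)) * U⁻¹ := by
        rw [Matrix.transpose_mul]
        simp only [Matrix.mul_assoc, Matrix.smul_mul, Matrix.mul_smul]
    _ = _ := by
        rw [hB, Matrix.transpose_mul]
        simp only [Matrix.mul_assoc]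

lemma log_sumSqThreshold_le (n : ℕ) :
    Real.log (sumSqThreshold n) ≤
      9 + 60 * Real.log (√((n : ℝ) + 2)) + 16 * Real.log (√((n : ℝ) + 2)) ^ 2 := by
  have hL : Real.log √((n : ℝ) + 2) = Real.log ((n : ℝ) + 2) / 2 := Real.log_sqrt (by positivity)
  have h0 : 0 ≤ Real.log n := Real.log_natCast_nonneg n
  have h1 : Real.log n ≤ Real.log ((n : ℝ) + 2) := by
    rcases n.eq_zero_or_pos with rfl | hn
    · simpa using Real.log_nonneg (by norm_num)
    · exact Real.log_le_log (by exact_mod_cast hn) (by linarith)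
  have h2 : Real.log 4900 ≤ 9 := by
    rw [Real.log_le_iff_le_exp (by norm_num)]
    have := Real.exp_one_gt_d9
    calc (4900 : ℝ) ≤ 2.7182818283 ^ 9 := by norm_num
      _ ≤ Real.exp 1 ^ 9 := by gcongr
      _ = Real.exp 9 := by rw [← Real.exp_nat_mul]; norm_num
  rw [sumSqThreshold, Real.log_mul (by positivity) (by unfold dropBound; positivity),
    Real.log_mul (by norm_num) (by positivity), Real.log_pow, Real.log_pow, dropBound,
    Real.log_exp, hL]
  push_cast
  nlinarith

lemma eventually_log_sumSqThreshold_le :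
    ∀ᶠ n : ℕ in Filter.atTop, Real.log (sumSqThreshold n) ≤ 2 * √(n : ℝ) := by
  have hlim : Filter.Tendsto (fun n : ℕ => √((n : ℝ) + 2)) Filter.atTop Filter.atTop :=
    Real.tendsto_sqrt_atTop.comp
      (Filter.tendsto_atTop_add_const_right _ _ tendsto_natCast_atTop_atTop)
  have ho : (fun y : ℝ => 9 + 60 * Real.log y + 16 * Real.log y ^ 2) =o[Filter.atTop] id :=
    ((Asymptotics.isLittleO_const_id_atTop 9).add
      (Real.isLittleO_log_id_atTop.const_mul_left 60)).add
      ((Real.isLittleO_pow_log_id_atTop (n := 2)).const_mul_left 16)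
  filter_upwards [hlim.eventually (ho.bound one_pos), Filter.eventually_ge_atTop 1] with n hn hn1
  refine (log_sumSqThreshold_le n).trans ((le_abs_self _).trans (hn.trans ?_))
  have h1 : (1 : ℝ) ≤ n := by exact_mod_cast hn1
  rw [id, one_mul, Real.norm_of_nonneg (Real.sqrt_nonneg _), Real.sqrt_le_left (by positivity),
    mul_pow, Real.sq_sqrt n.cast_nonneg]
  linarith

/-- For every `ε ∈ (0,1)` there exists `s₀` such that for every integer `s ≥ s₀`:
if `M` is an `n`-variable positive definite integral quadratic form such that `s·M` is not
represented by any `I_r`, then `n ≥ (1−ε)·(ln s/(4+2√2))²`.  Equivalently,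
`φ(s) ≥ (ln s/((4+4√2)√(1/2)))²·(1+o(1))`. -/
theorem phi_lower_bound :
    ∀ ε : ℝ, 0 < ε → ε < 1 → ∃ s₀ : ℕ, ∀ s : ℕ, s₀ ≤ s →
      ∀ n : ℕ, ∀ M : Matrix (Fin n) (Fin n) ℤ, M.IsSymm →
        (M.map (fun x => (x : ℝ))).PosDef →
        (¬ ∃ r : ℕ, 0 < r ∧ RepBySquares n r ((s : ℤ) • M)) →
        (1 - ε) * (Real.log s / (4 + 2 * Real.sqrt 2)) ^ 2 ≤ (n : ℝ) := by
  intro ε hε0 hε1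
  obtain ⟨n₀, hn₀⟩ := Filter.eventually_atTop.1 eventually_log_sumSqThreshold_le
  obtain ⟨s₀, hs₀⟩ := exists_nat_ge (∑ n ∈ Finset.range n₀, sumSqThreshold n)
  have hpos : ∀ n, 0 < sumSqThreshold n := fun n => by
    unfold sumSqThreshold dropBound
    positivity
  refine ⟨max s₀ 1, fun s hs n M hsymm hM hrep => ?_⟩
  have hsmall : (s : ℝ) < sumSqThreshold n := by
    by_contra! hle
    refine hrep (exists_smul_eq_transpose_mul hsymm (fun x hx => ?_) hle)
    simpa [gramForm] using hM.dotProduct_mulVec_pos hx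
  have hs₀s : (s₀ : ℝ) ≤ s := by exact_mod_cast (le_max_left _ _).trans hs
  have hs1 : (1 : ℝ) ≤ s := by exact_mod_cast (le_max_right _ _).trans hs
  have hn : n₀ ≤ n := by
    by_contra! hlt
    have := Finset.single_le_sum (fun i _ => (hpos i).le) (Finset.mem_range.2 hlt)
    linarith
  have hlog : Real.log s ≤ 2 * √(n : ℝ) :=
    (Real.log_le_log (by linarith) hsmall.le).trans (hn₀ n hn)
  have hlog0 : 0 ≤ Real.log s := Real.log_nonneg hs1
  have h1 : Real.log s / (4 + 2 * √2) ≤ √(n : ℝ) := by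
    rw [div_le_iff₀ (by positivity)]
    nlinarith [Real.sqrt_nonneg 2, Real.sqrt_nonneg (n : ℝ),
      mul_nonneg (Real.sqrt_nonneg 2) (Real.sqrt_nonneg (n : ℝ))]
  calc (1 - ε) * (Real.log s / (4 + 2 * √2)) ^ 2 ≤ 1 * (√(n : ℝ)) ^ 2 := by
        gcongr
        linarith
    _ = (n : ℝ) := by rw [one_mul, Real.sq_sqrt n.cast_nonneg]
end
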